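/- Let L be a positive definite, integral, strongly square free, totally-reflective ℤ-lattice of rank 4 with det L = p₁²⋯p_r²·q₁⋯q_s, where p₁ < … < p_r and q₁ < … < q_s are primes, all p_i, q_j pairwise distinct (necessarily r ≤ 9 and s ≤ 8 − r). Then, whenever the respective index occurs: p₁ ≤ 191, p₂ ≤ 661, p₃ ≤ 1601, p₄ ≤ 2069, p₅ ≤ 1831, p₆ ≤ 997, p₇ ≤ 449, p₈ ≤ 157, p₉ ≤ 47, and q₁ ≤ 11287, q₂ ≤ 6427, q₃ ≤ 3613, q₄ ≤ 1597, q₅ ≤ 653, q₆ ≤ 229, q₇ ≤ 67, q₈ ≤ 19. -/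

import Mathlib

open Matrix

/-- The bilinear form attached to a Gram matrix `G` on `ℤ^m`. -/
def Bf {m : ℕ} (G : Matrix (Fin m) (Fin m) ℤ) (x y : Fin m → ℤ) : ℤ :=
  x ⬝ᵥ G.mulVec y

/-- A vector of the lattice `ℤ^m` is primitive if it is not a proper multiple of a lattice
vector. -/
def PrimVec {m : ℕ} (v : Fin m → ℤ) : Prop :=
  ∀ c : ℤ, 1 < c → ¬∃ w : Fin m → ℤ, c • w = v

/-- `v` is a root of the lattice `(ℤ^m, G)`: it is nonzero, primitive, and the associated
reflection `x ↦ x − (2·b(x,v)/b(v,v))·v` maps the lattice into itself. -/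
def IsRootM {m : ℕ} (G : Matrix (Fin m) (Fin m) ℤ) (v : Fin m → ℤ) : Prop :=
  v ≠ 0 ∧ PrimVec v ∧
    ∀ x : Fin m → ℤ, ∃ y : Fin m → ℤ, ∀ i,
      (y i : ℚ) = (x i : ℚ) - 2 * (Bf G x v : ℚ) / (Bf G v v : ℚ) * (v i : ℚ)

/-- The lattice `(ℤ^m, G)` is reflective if its roots span a sublattice of full rank. -/
def ReflectiveM {m : ℕ} (G : Matrix (Fin m) (Fin m) ℤ) : Prop :=
  Module.finrank ℤ (Submodule.span ℤ {v : Fin m → ℤ | IsRootM G v}) = m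

/-- Positive definiteness of the Gram matrix `G`. -/
def PosDefM {m : ℕ} (G : Matrix (Fin m) (Fin m) ℤ) : Prop :=
  ∀ v : Fin m → ℤ, v ≠ 0 → 0 < Bf G v v

/-- Two integral lattices, given by Gram matrices, are in the same genus if the Gram
matrices are congruent over the ring `ℤ_p` of `p`-adic integers for every prime `p`. -/
def SameGenusM {m : ℕ} (G₁ G₂ : Matrix (Fin m) (Fin m) ℤ) : Prop :=
  ∀ (p : ℕ) [Fact p.Prime],
    ∃ S : Matrix (Fin m) (Fin m) ℤ_[p], IsUnit S.det ∧
      Sᵀ * G₁.map (Int.cast : ℤ → ℤ_[p]) * S = G₂.map (Int.cast : ℤ → ℤ_[p])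

/-- The lattice `(ℤ^m, G)` is totally-reflective if every lattice in its genus is
reflective. -/
def TotallyReflectiveM {m : ℕ} (G : Matrix (Fin m) (Fin m) ℤ) : Prop :=
  ∀ G' : Matrix (Fin m) (Fin m) ℤ, G'.IsSymm → PosDefM G' → SameGenusM G G' → ReflectiveM G'

/-- The lattice `(ℤ^m, G)` is square free: all elementary divisors of `G` are square free. -/
def SquareFreeM {m : ℕ} (G : Matrix (Fin m) (Fin m) ℤ) : Prop :=
  ∃ (S T : Matrix (Fin m) (Fin m) ℤ) (d : Fin m → ℤ),
    IsUnit S.det ∧ IsUnit T.det ∧ S * G * T = Matrix.diagonal d ∧ ∀ i, Squarefree (d i)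

/-- Strongly square free: square free and `v_p(det) ≤ m/2` for every prime `p`. -/
def StronglySquareFreeM {m : ℕ} (G : Matrix (Fin m) (Fin m) ℤ) : Prop :=
  SquareFreeM G ∧ ∀ p : ℕ, p.Prime → (G.det.natAbs).factorization p ≤ m / 2


section basics
variable {m : ℕ}

lemma Bf_add_left (G : Matrix (Fin m) (Fin m) ℤ) (x y z : Fin m → ℤ) :
    Bf G (x + y) z = Bf G x z + Bf G y z := by
  simp [Bf, add_dotProduct]

lemma Bf_smul_left (G : Matrix (Fin m) (Fin m) ℤ) (c : ℤ) (x z : Fin m → ℤ) :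
    Bf G (c • x) z = c * Bf G x z := by
  rw [Bf, Bf, smul_dotProduct, smul_eq_mul]

lemma Bf_add_right (G : Matrix (Fin m) (Fin m) ℤ) (x y z : Fin m → ℤ) :
    Bf G x (y + z) = Bf G x y + Bf G x z := by
  simp [Bf, mulVec_add, dotProduct_add]

lemma Bf_smul_right (G : Matrix (Fin m) (Fin m) ℤ) (c : ℤ) (x z : Fin m → ℤ) :
    Bf G x (c • z) = c * Bf G x z := by
  rw [Bf, Bf, mulVec_smul, dotProduct_smul, smul_eq_mul]

lemma Bf_neg_right (G : Matrix (Fin m) (Fin m) ℤ) (x z : Fin m → ℤ) :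
    Bf G x (-z) = - Bf G x z := by
  simp [Bf, mulVec_neg]

lemma Bf_neg_left (G : Matrix (Fin m) (Fin m) ℤ) (x z : Fin m → ℤ) :
    Bf G (-x) z = - Bf G x z := by
  simp [Bf]

lemma Bf_sub_left (G : Matrix (Fin m) (Fin m) ℤ) (x y z : Fin m → ℤ) :
    Bf G (x - y) z = Bf G x z - Bf G y z := by
  simp [Bf, sub_dotProduct]

lemma Bf_sub_right (G : Matrix (Fin m) (Fin m) ℤ) (x y z : Fin m → ℤ) :
    Bf G x (y - z) = Bf G x y - Bf G x z := by
  simp [Bf, mulVec_sub, dotProduct_sub]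

lemma Bf_comm {G : Matrix (Fin m) (Fin m) ℤ} (hG : G.IsSymm) (x y : Fin m → ℤ) :
    Bf G x y = Bf G y x := by
  unfold Bf
  rw [dotProduct_mulVec, ← mulVec_transpose, hG.eq, dotProduct_comm]

lemma Bf_pos_nonneg {G : Matrix (Fin m) (Fin m) ℤ} (hp : PosDefM G) (x : Fin m → ℤ) :
    0 ≤ Bf G x x := by
  by_cases h : x = 0
  · subst h; simp [Bf]
  · exact (hp x h).le

lemma Bf_cs {G : Matrix (Fin m) (Fin m) ℤ} (hG : G.IsSymm) (hp : PosDefM G) (x y : Fin m → ℤ) :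
    Bf G x y ^ 2 ≤ Bf G x x * Bf G y y := by
  by_cases h : y = 0
  · subst h; simp [Bf]
  have hy := hp y h
  have h1 := Bf_pos_nonneg hp ((Bf G y y) • x - (Bf G x y) • y)
  simp only [Bf_sub_left, Bf_sub_right, Bf_smul_left, Bf_smul_right, Bf_comm hG y x] at h1
  have h2 : 0 ≤ Bf G y y * (Bf G x x * Bf G y y - Bf G x y ^ 2) := by
    nlinarith
  have := nonneg_of_mul_nonneg_right h2 hy
  linarith

/-- If `n v = t e` with `e` primitive then `n ∣ t`. -/
lemma prim_dvd {e v : Fin m → ℤ} (he : PrimVec e) {n t : ℤ} (hn : n ≠ 0)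
    (h : n • v = t • e) : n ∣ t := by
  have hg : 0 < Int.gcd n t := Int.gcd_pos_of_ne_zero_left _ hn
  obtain ⟨n', t', hco, hn', ht'⟩ := Int.exists_gcd_one hg
  have hd : ∀ i, n' ∣ e i := by
    intro i
    have h1 : n * v i = t * e i := by simpa using congrFun h i
    have h2 : (Int.gcd n t : ℤ) * (n' * v i) = (Int.gcd n t : ℤ) * (t' * e i) := by
      calc _ = (n' * (Int.gcd n t : ℤ)) * v i := by ring
        _ = (t' * (Int.gcd n t : ℤ)) * e i := by rw [← hn', ← ht', h1]
        _ = _ := by ring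
    have h3 := mul_left_cancel₀ (by exact_mod_cast hg.ne') h2
    exact (Int.isCoprime_iff_gcd_eq_one.mpr hco).dvd_of_dvd_mul_left ⟨v i, h3.symm⟩
  have hu : n'.natAbs = 1 := by
    by_contra hne
    have h0 : n'.natAbs ≠ 0 := by
      intro h0
      have : n' = 0 := by omega
      rw [this] at hn'; simp at hn'; exact hn hn'
    refine he n'.natAbs (by omega) ⟨fun i => e i / (n'.natAbs : ℤ), ?_⟩
    ext i
    simp only [Pi.smul_apply, smul_eq_mul]
    exact Int.mul_ediv_cancel' (by simpa using hd i)
  rw [hn']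
  have : n' ∣ 1 := by
    rw [← Int.natAbs_dvd_natAbs, hu]; simp
  calc n' * (Int.gcd n t : ℤ) ∣ 1 * (Int.gcd n t : ℤ) := mul_dvd_mul_right this _
    _ ∣ t := by rw [one_mul]; exact Int.gcd_dvd_right ..

lemma root_dvd {G : Matrix (Fin m) (Fin m) ℤ} (hp : PosDefM G) {e : Fin m → ℤ}
    (he : IsRootM G e) (x : Fin m → ℤ) : Bf G e e ∣ 2 * Bf G x e := by
  obtain ⟨h0, h1, h2⟩ := he
  have hn := hp e h0
  obtain ⟨y, hy⟩ := h2 x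
  refine prim_dvd (v := x - y) h1 hn.ne' ?_
  ext i
  have := hy i
  have hn' : (Bf G e e : ℚ) ≠ 0 := by exact_mod_cast hn.ne'
  field_simp at this
  simp only [Pi.smul_apply, Pi.sub_apply, smul_eq_mul]
  have : (Bf G e e : ℚ) * (x i - y i) = 2 * Bf G x e * e i := by linarith
  exact_mod_cast this

/-- coroot functional -/
def phi (G : Matrix (Fin m) (Fin m) ℤ) (e x : Fin m → ℤ) : ℤ := 2 * Bf G x e / Bf G e e

lemma phi_mul {G : Matrix (Fin m) (Fin m) ℤ} (hp : PosDefM G) {e : Fin m → ℤ}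
    (he : IsRootM G e) (x : Fin m → ℤ) : phi G e x * Bf G e e = 2 * Bf G x e :=
  Int.ediv_mul_cancel (root_dvd hp he x)

lemma root_pos {G : Matrix (Fin m) (Fin m) ℤ} (hp : PosDefM G) {e : Fin m → ℤ}
    (he : IsRootM G e) : 0 < Bf G e e := hp e he.1

lemma phi_self {G : Matrix (Fin m) (Fin m) ℤ} (hp : PosDefM G) {e : Fin m → ℤ}
    (he : IsRootM G e) : phi G e e = 2 :=
  mul_right_cancel₀ (root_pos hp he).ne' (phi_mul hp he e)

lemma phi_add {G : Matrix (Fin m) (Fin m) ℤ} (hp : PosDefM G) {e : Fin m → ℤ}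
    (he : IsRootM G e) (x y : Fin m → ℤ) : phi G e (x + y) = phi G e x + phi G e y := by
  apply mul_right_cancel₀ (root_pos hp he).ne'
  rw [add_mul, phi_mul hp he, phi_mul hp he, phi_mul hp he, Bf_add_left]; ring

lemma phi_smul {G : Matrix (Fin m) (Fin m) ℤ} (hp : PosDefM G) {e : Fin m → ℤ}
    (he : IsRootM G e) (c : ℤ) (x : Fin m → ℤ) : phi G e (c • x) = c * phi G e x := by
  apply mul_right_cancel₀ (root_pos hp he).ne'
  rw [mul_assoc, phi_mul hp he, phi_mul hp he, Bf_smul_left]; ring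

/-- `phi` respects congruences. -/
lemma phi_congr {G : Matrix (Fin m) (Fin m) ℤ} (hp : PosDefM G) {e : Fin m → ℤ}
    (he : IsRootM G e) (l : ℤ) (x y : Fin m → ℤ) (h : ∀ i, l ∣ x i - y i) :
    l ∣ phi G e x - phi G e y := by
  choose z hz using h
  have : x = y + l • z := by
    ext i; simp only [Pi.add_apply, Pi.smul_apply, smul_eq_mul]; linarith [hz i]
  rw [this, phi_add hp he, phi_smul hp he]
  simp

lemma Bf_congr_left (G : Matrix (Fin m) (Fin m) ℤ) (l : ℤ) (x y z : Fin m → ℤ)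
    (h : ∀ i, l ∣ x i - y i) : l ∣ Bf G x z - Bf G y z := by
  choose w hw using h
  have : x = y + l • w := by
    ext i; simp only [Pi.add_apply, Pi.smul_apply, smul_eq_mul]; linarith [hw i]
  rw [this, Bf_add_left, Bf_smul_left]
  simp

/-- Hadamard inequality. -/
lemma hadamard : ∀ (m : ℕ) (M : Matrix (Fin m) (Fin m) ℤ), M.IsSymm → PosDefM M → 0 < M.det →
    M.det ≤ ∏ i, M i i
  | 0, M, _, _, _ => by simp
  | m+1, M, hs, hp, hd => by
    set v : Fin (m+1) → ℤ := fun i => M.adjugate i 0 with hv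
    have hMv : M.mulVec v = M.det • (Pi.single 0 1) := by
      ext i
      have := congrFun (congrFun (mul_adjugate M) i) 0
      simp only [mulVec, dotProduct, mul_apply, hv] at *
      rw [this]
      simp [Matrix.one_apply, Pi.single_apply]
    have hvv : Bf M v v = M.det * v 0 := by
      rw [Bf, hMv, dotProduct_smul, smul_eq_mul]; simp
    have hev : Bf M (Pi.single 0 1) v = M.det := by rw [Bf, hMv, dotProduct_smul, smul_eq_mul]; simp
    have hee : Bf M (Pi.single 0 1) (Pi.single 0 1) = M 0 0 := by simp [Bf]
    have hv0 : v 0 = (M.submatrix Fin.succ Fin.succ).det := by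
      simp [hv, adjugate_fin_succ_eq_det_submatrix]
    have hvne : v ≠ 0 := by
      intro h; rw [h] at hev; simp [Bf] at hev; omega
    have h1 := hp v hvne
    rw [hvv] at h1
    have hv0p : 0 < v 0 := pos_of_mul_pos_right h1 hd.le |> fun h => h
    have hcs := Bf_cs hs hp (Pi.single 0 1) v
    rw [hev, hee, hvv] at hcs
    have h2 : M.det ≤ M 0 0 * v 0 := by nlinarith
    have hpos' : PosDefM (M.submatrix Fin.succ Fin.succ) := by
      intro w hw
      have := hp (Fin.cons 0 w) (by
        intro h; apply hw; ext i; simpa using congrFun h i.succ)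
      simpa [Bf, dotProduct, mulVec, Fin.sum_univ_succ] using this
    have ih := hadamard m (M.submatrix Fin.succ Fin.succ) (hs.submatrix _) hpos' (hv0 ▸ hv0p)
    have h00 : 0 < M 0 0 := by
      rw [← hee]; apply hp; intro h; simpa using congrFun h 0
    rw [Fin.prod_univ_succ]
    rw [hv0] at h2
    calc M.det ≤ _ := h2
      _ ≤ _ := by
        apply mul_le_mul_of_nonneg_left _ h00.le
        simpa using ih

end basics

section rootbasis

def RootBasis (G E : Matrix (Fin 4) (Fin 4) ℤ) : Prop :=
  E.det ≠ 0 ∧ ∀ i, IsRootM G (E i)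

lemma exists_rootBasis' {S : Set (Fin 4 → ℤ)} (h : Module.finrank ℤ (Submodule.span ℤ S) = 4) :
    ∃ f : Fin 4 → (Fin 4 → ℤ), (∀ i, f i ∈ S) ∧ LinearIndependent ℤ f := by
  let c : (Fin 4 → ℤ) →ₗ[ℤ] (Fin 4 → ℚ) := (Int.castAddHom ℚ).toIntLinearMap.compLeft (Fin 4)
  have hc : ∀ x i, c x i = (x i : ℚ) := fun x i => rfl
  have hcinj : Function.Injective c := by
    intro x y hxy; ext i
    have := congrFun hxy i
    rw [hc, hc] at this; exact_mod_cast this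
  have hn : Module.finrank ℚ (Submodule.span ℚ (c '' S)) = 4 := by
    apply le_antisymm
    · calc _ ≤ Module.finrank ℚ (Fin 4 → ℚ) := Submodule.finrank_le _
        _ = 4 := by simp
    · let b := Module.finBasisOfFinrankEq ℤ (Submodule.span ℤ S) h
      have hb : LinearIndependent ℤ (fun i => c (b i : Fin 4 → ℤ)) := by
        have h1 := b.linearIndependent.map' (Submodule.subtype _) (Submodule.ker_subtype _)
        exact h1.map' c (LinearMap.ker_eq_bot.mpr hcinj)
      have hb' : LinearIndependent ℚ (fun i => c (b i : Fin 4 → ℤ)) :=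
        (LinearIndependent.iff_fractionRing ℤ ℚ).mp hb
      have hmem : ∀ i, c (b i : Fin 4 → ℤ) ∈ Submodule.span ℚ (c '' S) := by
        intro i
        have : ∀ x ∈ Submodule.span ℤ S, c x ∈ Submodule.span ℚ (c '' S) := by
          intro x hx
          induction hx using Submodule.span_induction with
          | mem x hx => exact Submodule.subset_span ⟨x, hx, rfl⟩
          | zero => simp
          | add x y _ _ h1 h2 => rw [map_add]; exact Submodule.add_mem _ h1 h2
          | smul a x _ h1 =>
            rw [map_smul]
            exact zsmul_mem h1 a
        exact this _ (b i).2
      have h2 : LinearIndependent ℚ (fun i => (⟨_, hmem i⟩ : Submodule.span ℚ (c '' S))) := by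
        apply LinearIndependent.of_comp (Submodule.subtype _)
        exact hb'
      simpa using h2.fintype_card_le_finrank
  obtain ⟨f, hf, -, hli⟩ := Submodule.exists_fun_fin_finrank_span_eq ℚ (c '' S)
  choose g hg hgf using hf
  refine ⟨fun i => g (Fin.cast hn.symm i), fun i => hg _, ?_⟩
  have h1 : LinearIndependent ℚ (fun i : Fin 4 => f (Fin.cast hn.symm i)) :=
    hli.comp _ (Fin.cast_injective hn.symm)
  have h2 : LinearIndependent ℤ (fun i : Fin 4 => f (Fin.cast hn.symm i)) :=
    (LinearIndependent.iff_fractionRing ℤ ℚ).mpr h1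
  apply LinearIndependent.of_comp c
  convert h2 using 1
  ext i : 1
  exact hgf _

lemma exists_rootBasis {G : Matrix (Fin 4) (Fin 4) ℤ} (h : ReflectiveM G) :
    ∃ E, RootBasis G E := by
  obtain ⟨f', hf, hli'⟩ := exists_rootBasis' h
  refine ⟨Matrix.of f', ?_, fun i => hf _⟩
  intro hd
  obtain ⟨v, hv, hv0⟩ := Matrix.exists_vecMul_eq_zero_iff.mpr hd
  apply hv
  rw [Fintype.linearIndependent_iff] at hli'
  ext i
  refine hli' v ?_ i
  ext k
  have := congrFun hv0 k
  simpa [vecMul, dotProduct] using this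

variable {G E : Matrix (Fin 4) (Fin 4) ℤ}

def CC (G E : Matrix (Fin 4) (Fin 4) ℤ) : Matrix (Fin 4) (Fin 4) ℤ :=
  Matrix.of fun i j => phi G (E i) (E j)

def nn (G E : Matrix (Fin 4) (Fin 4) ℤ) (i : Fin 4) : ℤ := Bf G (E i) (E i)

def YY (G E : Matrix (Fin 4) (Fin 4) ℤ) : Matrix (Fin 4) (Fin 4) ℤ :=
  Matrix.of fun i k => phi G (E i) (Pi.single k 1)

lemma nn_pos (hp : PosDefM G) (hE : RootBasis G E) (i : Fin 4) : 0 < nn G E i :=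
  root_pos hp (hE.2 i)

lemma CC_mul (hp : PosDefM G) (hE : RootBasis G E) (i j : Fin 4) :
    CC G E i j * nn G E i = 2 * Bf G (E j) (E i) := phi_mul hp (hE.2 i) _

lemma CC_diag (hp : PosDefM G) (hE : RootBasis G E) (i : Fin 4) : CC G E i i = 2 :=
  phi_self hp (hE.2 i)

lemma CC_sym (hs : G.IsSymm) (hp : PosDefM G) (hE : RootBasis G E) (i j : Fin 4) :
    CC G E i j * nn G E i = CC G E j i * nn G E j := by
  rw [CC_mul hp hE, CC_mul hp hE, Bf_comm hs]

lemma CC_zero_iff (hp : PosDefM G) (hE : RootBasis G E) (i j : Fin 4) :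
    CC G E i j = 0 ↔ Bf G (E j) (E i) = 0 := by
  have h1 := CC_mul hp hE i j
  have h2 := nn_pos hp hE i
  constructor
  · intro h; rw [h] at h1; linarith
  · intro h; rw [h, mul_zero] at h1
    exact (mul_eq_zero.mp h1).resolve_right h2.ne'

lemma CC_zero_symm (hs : G.IsSymm) (hp : PosDefM G) (hE : RootBasis G E) (i j : Fin 4) :
    CC G E i j = 0 ↔ CC G E j i = 0 := by
  rw [CC_zero_iff hp hE, CC_zero_iff hp hE, Bf_comm hs]

lemma YY_mul (hp : PosDefM G) (hE : RootBasis G E) :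
    Matrix.diagonal (nn G E) * YY G E = (2 : ℤ) • (E * Gᵀ) := by
  ext i k
  rw [Matrix.diagonal_mul, mul_comm]
  have := phi_mul hp (hE.2 i) (Pi.single k 1)
  simp only [YY, nn, Matrix.of_apply] at *
  rw [this]
  rw [Bf, single_one_dotProduct]
  simp [Matrix.mul_apply, mulVec, dotProduct, mul_comm]

lemma CC_eq (hp : PosDefM G) (hE : RootBasis G E) : CC G E = YY G E * Eᵀ := by
  ext i j
  apply mul_right_cancel₀ (nn_pos hp hE i).ne'
  rw [CC_mul hp hE, Matrix.mul_apply, Finset.sum_mul]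
  have : ∀ k, YY G E i k * Eᵀ k j * nn G E i = 2 * (E j k * (G.mulVec (E i)) k) := by
    intro k
    have := phi_mul hp (hE.2 i) (Pi.single k 1)
    simp only [YY, nn, Matrix.of_apply, transpose_apply] at *
    rw [mul_right_comm, this]
    simp [Bf]; ring
  rw [Finset.sum_congr rfl (fun k _ => this k), ← Finset.mul_sum]
  rfl

lemma det_YY (hp : PosDefM G) (hE : RootBasis G E) :
    (∏ i, nn G E i) * (YY G E).det = 16 * (E.det * G.det) := by
  have := congrArg Matrix.det (YY_mul hp hE)
  rw [det_mul, det_diagonal, det_smul, det_mul, det_transpose] at this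
  simpa using this

lemma det_CC (hp : PosDefM G) (hE : RootBasis G E) :
    (CC G E).det = (YY G E).det * E.det := by
  rw [CC_eq hp hE, det_mul, det_transpose]

lemma det_CC_mul (hp : PosDefM G) (hE : RootBasis G E) :
    (∏ i, nn G E i) * (CC G E).det = 16 * (E.det ^ 2 * G.det) := by
  rw [det_CC hp hE, ← mul_assoc, det_YY hp hE]; ring

lemma prod_nn_pos (hp : PosDefM G) (hE : RootBasis G E) : 0 < ∏ i, nn G E i :=
  Finset.prod_pos fun i _ => nn_pos hp hE i

lemma det_CC_pos (hp : PosDefM G) (hE : RootBasis G E) (hd : 0 < G.det) : 0 < (CC G E).det := by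
  have h := det_CC_mul hp hE
  have h1 : 0 < 16 * (E.det ^ 2 * G.det) := by
    have := hE.1
    positivity
  rw [← h] at h1
  exact pos_of_mul_pos_right h1 (prod_nn_pos hp hE).le

lemma det_CC_le (hs : G.IsSymm) (hp : PosDefM G) (hE : RootBasis G E) (hd : 0 < G.det) :
    (CC G E).det ≤ 16 := by
  have h := det_CC_mul hp hE
  have hM : ∀ i j, (E * G * Eᵀ) i j = Bf G (E i) (E j) := by
    intro i j
    rw [Bf, Matrix.mul_assoc]
    simp [Matrix.mul_apply, mulVec, dotProduct]
  have hB : ∀ v, Bf (E * G * Eᵀ) v v = Bf G (v ᵥ* E) (v ᵥ* E) := by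
    intro v
    simp only [Bf, ← mulVec_mulVec, dotProduct_mulVec, mulVec_transpose]
  have h1 := hadamard 4 (E * G * Eᵀ) (by
      rw [Matrix.IsSymm]; simp [Matrix.transpose_mul, hs.eq, Matrix.mul_assoc])
    (by
      intro v hv
      rw [hB]
      apply hp
      intro h0
      exact hE.1 (Matrix.exists_vecMul_eq_zero_iff.mp ⟨v, hv, h0⟩))
    (by
      rw [det_mul, det_mul, det_transpose]
      have := hE.1
      have : 0 < E.det ^ 2 * G.det := by positivity
      nlinarith)
  rw [det_mul, det_mul, det_transpose] at h1
  have h2 : ∏ i, (E * G * Eᵀ) i i = ∏ i, nn G E i :=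
    Finset.prod_congr rfl fun i _ => hM i i
  rw [h2] at h1
  have h3 := prod_nn_pos hp hE
  have : (∏ i, nn G E i) * (CC G E).det ≤ (∏ i, nn G E i) * 16 := by rw [h]; nlinarith
  exact le_of_mul_le_mul_left this h3

lemma indep_ne (hE : RootBasis G E) {i j : Fin 4} (hij : i ≠ j) (a b : ℤ) (ha : a ≠ 0) :
    a • E i - b • E j ≠ 0 := by
  intro h
  apply hE.1
  refine Matrix.exists_vecMul_eq_zero_iff.mp ⟨Pi.single i a - Pi.single j b, ?_, ?_⟩
  · intro h0
    have := congrFun h0 i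
    simp [hij] at this
    exact ha this
  · rw [sub_vecMul]
    ext k
    have := congrFun h k
    simpa [Matrix.row] using this

/-- strict Cauchy-Schwarz -/
lemma CC_prod_lt (hs : G.IsSymm) (hp : PosDefM G) (hE : RootBasis G E) {i j : Fin 4} (hij : i ≠ j) :
    0 ≤ CC G E i j * CC G E j i ∧ CC G E i j * CC G E j i ≤ 3 := by
  have h1 := CC_mul hp hE i j
  have h2 := CC_mul hp hE j i
  have hni := nn_pos hp hE i
  have hnj := nn_pos hp hE j
  rw [Bf_comm hs] at h2
  have h3 : 0 < Bf G ((nn G E j) • E i - (Bf G (E j) (E i)) • E j)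
      ((nn G E j) • E i - (Bf G (E j) (E i)) • E j) := hp _ (indep_ne hE hij _ _ hnj.ne')
  simp only [Bf_sub_left, Bf_sub_right, Bf_smul_left, Bf_smul_right, Bf_comm hs (E i) (E j)] at h3
  change 0 < nn G E j * (nn G E j * nn G E i - _) - _ * (_ - _ * nn G E j) at h3
  set b := Bf G (E j) (E i)
  set x := nn G E i
  set y := nn G E j
  have h4 : b * b < x * y := by
    have : 0 < y * (x * y - b * b) := by nlinarith
    have := pos_of_mul_pos_right this hnj.le
    linarith
  have h5 : (CC G E i j * CC G E j i) * (x * y) = 4 * (b * b) := by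
    calc _ = (CC G E i j * x) * (CC G E j i * y) := by ring
      _ = _ := by rw [h1, h2]; ring
  have hxy : 0 < x * y := by positivity
  constructor
  · by_contra hneg
    push Not at hneg
    have := mul_neg_of_neg_of_pos hneg hxy
    nlinarith [mul_self_nonneg b]
  · by_contra hneg
    have : 4 ≤ CC G E i j * CC G E j i := by omega
    nlinarith

lemma abs_le_three {a b : ℤ} (h0 : 0 < a * b) (h : a * b ≤ 3) : a.natAbs ≤ 3 := by
  have h1 : (a * b).natAbs ≤ 3 := by omega
  rw [Int.natAbs_mul] at h1
  have : 0 < b.natAbs := by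
    rcases Nat.eq_zero_or_pos b.natAbs with hb | hb
    · have : b = 0 := by omega
      subst this; simp at h0
    · exact hb
  nlinarith

/-- for a prime at least 5, an edge links norms of equal divisibility -/
lemma edge_dvd (hs : G.IsSymm) (hp : PosDefM G) (hE : RootBasis G E) {p : ℕ} (hpp : p.Prime)
    (h5 : 5 ≤ p) {i j : Fin 4} (hij : CC G E i j ≠ 0) (hd : (p : ℤ) ∣ nn G E i) :
    (p : ℤ) ∣ nn G E j := by
  by_cases hne : i = j
  · rw [← hne]; exact hd
  have hji : CC G E j i ≠ 0 := fun h => hij ((CC_zero_symm hs hp hE i j).mpr h)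
  obtain ⟨h0, h3⟩ := CC_prod_lt hs hp hE hne
  have h0' : 0 < CC G E j i * CC G E i j := by
    rw [mul_comm]; exact lt_of_le_of_ne h0 (mul_ne_zero hij hji).symm
  have hb := abs_le_three h0' (by rw [mul_comm]; exact h3)
  have hd2 : (p : ℤ) ∣ CC G E j i * nn G E j := by
    rw [← CC_sym hs hp hE]; exact hd.mul_left _
  rcases (Nat.prime_iff_prime_int.mp hpp).dvd_or_dvd hd2 with h | h
  · exfalso
    have := Nat.le_of_dvd (Int.natAbs_pos.mpr hji) (Int.natCast_dvd.mp h)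
    omega
  · exact h

lemma cross_zero (hs : G.IsSymm) (hp : PosDefM G) (hE : RootBasis G E) {p : ℕ} (hpp : p.Prime)
    (h5 : 5 ≤ p) {i j : Fin 4} (hij : ¬ ((p : ℤ) ∣ nn G E i ↔ (p : ℤ) ∣ nn G E j)) :
    CC G E i j = 0 := by
  by_contra h
  have hji : CC G E j i ≠ 0 := fun h' => h ((CC_zero_symm hs hp hE i j).mpr h')
  exact hij ⟨edge_dvd hs hp hE hpp h5 h, edge_dvd hs hp hE hpp h5 hji⟩

/-- permuting a root basis -/
lemma RootBasis.perm (hE : RootBasis G E) (σ : Equiv.Perm (Fin 4)) :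
    RootBasis G (E.submatrix σ id) := by
  refine ⟨?_, fun i => hE.2 (σ i)⟩
  rw [Matrix.det_permute]
  exact mul_ne_zero (by simp) hE.1

lemma det_CC_perm (σ : Equiv.Perm (Fin 4)) : (CC G (E.submatrix σ id)).det = (CC G E).det := by
  have : CC G (E.submatrix σ id) = (CC G E).submatrix σ σ := rfl
  rw [this, Matrix.det_submatrix_equiv_self]

lemma nn_perm (σ : Equiv.Perm (Fin 4)) (i : Fin 4) :
    nn G (E.submatrix σ id) i = nn G E (σ i) := rfl

lemma CC_perm (σ : Equiv.Perm (Fin 4)) (i j : Fin 4) :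
    CC G (E.submatrix σ id) i j = CC G E (σ i) (σ j) := rfl

end rootbasis

section smooth
variable {G E : Matrix (Fin 4) (Fin 4) ℤ}

lemma det_four (C : Matrix (Fin 4) (Fin 4) ℤ) : C.det =
    C 0 0 * (C 1 1 * C 2 2 * C 3 3 - C 1 1 * C 2 3 * C 3 2 - C 1 2 * C 2 1 * C 3 3
      + C 1 2 * C 2 3 * C 3 1 + C 1 3 * C 2 1 * C 3 2 - C 1 3 * C 2 2 * C 3 1)
    - C 0 1 * (C 1 0 * C 2 2 * C 3 3 - C 1 0 * C 2 3 * C 3 2 - C 1 2 * C 2 0 * C 3 3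
      + C 1 2 * C 2 3 * C 3 0 + C 1 3 * C 2 0 * C 3 2 - C 1 3 * C 2 2 * C 3 0)
    + C 0 2 * (C 1 0 * C 2 1 * C 3 3 - C 1 0 * C 2 3 * C 3 1 - C 1 1 * C 2 0 * C 3 3
      + C 1 1 * C 2 3 * C 3 0 + C 1 3 * C 2 0 * C 3 1 - C 1 3 * C 2 1 * C 3 0)
    - C 0 3 * (C 1 0 * C 2 1 * C 3 2 - C 1 0 * C 2 2 * C 3 1 - C 1 1 * C 2 0 * C 3 2
      + C 1 1 * C 2 2 * C 3 0 + C 1 2 * C 2 0 * C 3 1 - C 1 2 * C 2 1 * C 3 0) := by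
  simp [Matrix.det_succ_row_zero, Fin.sum_univ_succ, Fin.succAbove]
  ring

lemma small_not_dvd {p : ℕ} (h5 : 5 ≤ p) {x : ℤ} (h0 : 0 < x) (h4 : x ≤ 4) :
    ¬ (p : ℤ) ∣ x := by
  intro h
  have := Int.le_of_dvd h0 h
  omega

lemma split_shape (f : Fin 4 → Bool) (h : ∃ i, f i = true) (h' : ∃ i, f i = false) :
    ∃ σ : Equiv.Perm (Fin 4), (f (σ 0) ≠ f (σ 1) ∧ f (σ 0) ≠ f (σ 2) ∧ f (σ 0) ≠ f (σ 3)) ∨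
      (f (σ 0) ≠ f (σ 2) ∧ f (σ 0) ≠ f (σ 3) ∧ f (σ 1) ≠ f (σ 2) ∧ f (σ 1) ≠ f (σ 3)) := by
  revert f; decide

lemma smooth13 (hs : G.IsSymm) (hp : PosDefM G) (hE : RootBasis G E) (hd : 0 < G.det)
    (h1 : CC G E 0 1 = 0) (h2 : CC G E 0 2 = 0) (h3 : CC G E 0 3 = 0) {p : ℕ} (hpp : p.Prime)
    (h5 : 5 ≤ p) : ¬ (p : ℤ) ∣ (CC G E).det := by
  have hpos := det_CC_pos hp hE hd
  have hle := det_CC_le hs hp hE hd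
  have hcyc : CC G E 1 2 * CC G E 2 3 * CC G E 3 1 = CC G E 1 3 * CC G E 2 1 * CC G E 3 2 := by
    have e12 := CC_sym hs hp hE 1 2
    have e23 := CC_sym hs hp hE 2 3
    have e31 := CC_sym hs hp hE 3 1
    have n1 := (nn_pos hp hE 1).ne'
    have n2 := (nn_pos hp hE 2).ne'
    have n3 := (nn_pos hp hE 3).ne'
    apply mul_right_cancel₀ (mul_ne_zero (mul_ne_zero n1 n2) n3)
    calc _ = (CC G E 1 2 * nn G E 1) * (CC G E 2 3 * nn G E 2) * (CC G E 3 1 * nn G E 3) := by ring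
      _ = _ := by rw [e12, e23, e31]; ring
  have hdet : (CC G E).det = 4 * (4 - CC G E 2 3 * CC G E 3 2 - CC G E 1 2 * CC G E 2 1
    - CC G E 1 3 * CC G E 3 1 + CC G E 1 3 * CC G E 2 1 * CC G E 3 2) := by
    rw [det_four, h1, h2, h3, CC_diag hp hE, CC_diag hp hE, CC_diag hp hE, CC_diag hp hE, hcyc]
    ring
  rw [hdet] at hpos hle ⊢
  intro h
  rcases (Nat.prime_iff_prime_int.mp hpp).dvd_or_dvd h with h | h
  · exact small_not_dvd h5 (by norm_num) (by norm_num) h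
  · exact small_not_dvd h5 (by omega) (by omega) h

lemma smooth22 (hs : G.IsSymm) (hp : PosDefM G) (hE : RootBasis G E)
    (h1 : CC G E 0 2 = 0) (h2 : CC G E 0 3 = 0) (h3 : CC G E 1 2 = 0) (h4 : CC G E 1 3 = 0)
    {p : ℕ} (hpp : p.Prime) (h5 : 5 ≤ p) : ¬ (p : ℤ) ∣ (CC G E).det := by
  have k1 := CC_prod_lt hs hp hE (show (0 : Fin 4) ≠ 1 by decide)
  have k2 := CC_prod_lt hs hp hE (show (2 : Fin 4) ≠ 3 by decide)
  have hdet : (CC G E).det = (4 - CC G E 0 1 * CC G E 1 0) * (4 - CC G E 2 3 * CC G E 3 2) := by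
    rw [det_four, h1, h2, h3, h4, CC_diag hp hE, CC_diag hp hE, CC_diag hp hE, CC_diag hp hE]
    ring
  rw [hdet]
  intro h
  rcases (Nat.prime_iff_prime_int.mp hpp).dvd_or_dvd h with h | h
  · exact small_not_dvd h5 (by omega) (by omega) h
  · exact small_not_dvd h5 (by omega) (by omega) h

lemma dvd_prod_iff (hp : PosDefM G) (hE : RootBasis G E) {p : ℕ} (hpp : p.Prime) (h3 : 3 ≤ p)
    (hC : ¬ (p : ℤ) ∣ (CC G E).det) (k : ℕ) :
    (p : ℤ) ^ k ∣ G.det ↔ (p : ℤ) ^ k ∣ ∏ i, nn G E i := by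
  have hpi := Nat.prime_iff_prime_int.mp hpp
  rw [det_CC hp hE] at hC
  have hY : ¬ (p : ℤ) ∣ (YY G E).det := fun h => hC (h.mul_right _)
  have hEd : ¬ (p : ℤ) ∣ E.det := fun h => hC (h.mul_left _)
  have h16 : ¬ (p : ℤ) ∣ 16 := by
    intro h
    have h' : (p : ℤ) ∣ 2 := hpi.dvd_of_dvd_pow (n := 4) (by simpa using h)
    have := Int.le_of_dvd (by norm_num) h'
    omega
  have hco : ∀ x : ℤ, ¬ (p : ℤ) ∣ x → IsCoprime ((p : ℤ) ^ k) x := fun x hx =>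
    ((Prime.coprime_iff_not_dvd hpi).mpr hx).pow_left
  have h := det_YY hp hE
  constructor
  · intro hd
    exact (hco _ hY).dvd_of_dvd_mul_right (by rw [h]; exact (hd.mul_left _).mul_left _)
  · intro hd
    refine (hco _ hEd).dvd_of_dvd_mul_left ((hco _ h16).dvd_of_dvd_mul_left ?_)
    rw [← h]; exact hd.mul_right _

lemma not_dvd_CC17 (hs : G.IsSymm) (hp : PosDefM G) (hE : RootBasis G E) (hd : 0 < G.det)
    {p : ℕ} (h17 : 17 ≤ p) : ¬ (p : ℤ) ∣ (CC G E).det := by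
  intro h
  have := Int.le_of_dvd (det_CC_pos hp hE hd) h
  have := det_CC_le hs hp hE hd
  omega

lemma split_exists (hs : G.IsSymm) (hp : PosDefM G) (hE : RootBasis G E) (hd : 0 < G.det)
    {p : ℕ} (hpp : p.Prime) (h17 : 17 ≤ p) (hpd : (p : ℤ) ∣ G.det) (h3 : ¬ (p : ℤ) ^ 3 ∣ G.det) :
    (∃ i, (p : ℤ) ∣ nn G E i) ∧ ∃ i, ¬ (p : ℤ) ∣ nn G E i := by
  have hC := not_dvd_CC17 hs hp hE hd h17
  constructor
  · have := (dvd_prod_iff hp hE hpp (by omega) hC 1).mp (by simpa using hpd)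
    rw [pow_one] at this
    obtain ⟨i, -, hi⟩ := (Nat.prime_iff_prime_int.mp hpp).exists_mem_finset_dvd this
    exact ⟨i, hi⟩
  · by_contra hall
    push Not at hall
    apply h3
    rw [dvd_prod_iff hp hE hpp (by omega) hC 3]
    have := Finset.prod_dvd_prod_of_dvd (s := Finset.univ) (fun _ : Fin 4 => (p : ℤ)) (nn G E)
      (fun i _ => hall i)
    simp at this
    exact (pow_dvd_pow _ (by norm_num)).trans this

/-- the determinant of the Cartan-like matrix is `{2,3}`-smooth -/
lemma not_dvd_CC (hs : G.IsSymm) (hp : PosDefM G) (hE : RootBasis G E) (hd : 0 < G.det)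
    {p₀ : ℕ} (hpp : p₀.Prime) (h17 : 17 ≤ p₀) (hpd : (p₀ : ℤ) ∣ G.det)
    (h3 : ¬ (p₀ : ℤ) ^ 3 ∣ G.det) {p : ℕ} (hp1 : p.Prime) (h5 : 5 ≤ p) :
    ¬ (p : ℤ) ∣ (CC G E).det := by
  obtain ⟨⟨i, hi⟩, ⟨j, hj⟩⟩ := split_exists hs hp hE hd hpp h17 hpd h3
  classical
  obtain ⟨σ, hσ⟩ := split_shape (fun i => decide ((p₀ : ℤ) ∣ nn G E i)) ⟨i, by simpa using hi⟩
    ⟨j, by simpa using hj⟩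
  have key : ∀ a b, decide ((p₀ : ℤ) ∣ nn G E (σ a)) ≠ decide ((p₀ : ℤ) ∣ nn G E (σ b)) →
      CC G (E.submatrix σ id) a b = 0 := by
    intro a b h
    rw [CC_perm]
    refine cross_zero hs hp hE hpp (by omega) (fun h' => h ?_)
    simp [h']
  rw [← det_CC_perm σ]
  rcases hσ with ⟨a, b, c⟩ | ⟨a, b, c, d⟩
  · exact smooth13 hs hp (hE.perm σ) hd (key _ _ a) (key _ _ b) (key _ _ c) hp1 h5
  · exact smooth22 hs hp (hE.perm σ) (key _ _ a) (key _ _ b) (key _ _ c) (key _ _ d) hp1 h5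

lemma not_dvd_E (hp : PosDefM G) (hE : RootBasis G E) {p : ℕ}
    (hC : ¬ (p : ℤ) ∣ (CC G E).det) : ¬ (p : ℤ) ∣ E.det := by
  rw [det_CC hp hE] at hC
  exact fun h => hC (h.mul_left _)

lemma count_lemma {p : ℕ} (hpp : p.Prime) (n : Fin 4 → ℤ) (h2 : ∀ i, ¬ (p : ℤ) ^ 2 ∣ n i) (k : ℕ) :
    (p : ℤ) ^ k ∣ ∏ i, n i ↔ k ≤ ∑ i, if (p : ℤ) ∣ n i then 1 else 0 := by
  have hpi := Nat.prime_iff_prime_int.mp hpp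
  have h1 : ∀ i, ∃ m, ¬ (p : ℤ) ∣ m ∧ n i = (p : ℤ) ^ (if (p : ℤ) ∣ n i then 1 else 0) * m := by
    intro i
    by_cases h : (p : ℤ) ∣ n i
    · obtain ⟨m, hm⟩ := h
      refine ⟨m, ?_, by rw [if_pos ⟨m, hm⟩]; simpa using hm⟩
      rintro ⟨c, rfl⟩
      exact h2 i ⟨c, by rw [hm]; ring⟩
    · exact ⟨n i, h, by rw [if_neg h]; simp⟩
  choose m hm hn using h1
  have h3 : ∏ i, n i = (p : ℤ) ^ (∑ i, if (p : ℤ) ∣ n i then 1 else 0) * ∏ i, m i := by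
    rw [← Finset.prod_pow_eq_pow_sum, ← Finset.prod_mul_distrib]
    exact Finset.prod_congr rfl fun i _ => hn i
  have h4 : ¬ (p : ℤ) ∣ ∏ i, m i := by
    rw [hpi.dvd_finsetProd_iff]
    rintro ⟨i, -, hi⟩
    exact hm i hi
  rw [h3]
  constructor
  · intro h
    have hco : IsCoprime ((p : ℤ) ^ k) (∏ i, m i) :=
      ((Prime.coprime_iff_not_dvd hpi).mpr h4).pow_left
    have := hco.dvd_of_dvd_mul_right h
    exact (pow_dvd_pow_iff hpi.ne_zero hpi.not_isUnit).mp this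
  · intro h
    exact (pow_dvd_pow _ h).mul_right _

/-- norms of roots of a square free lattice are not divisible by the square of an odd prime -/
lemma root_sq {m : ℕ} {G : Matrix (Fin m) (Fin m) ℤ} (hp : PosDefM G)
    (hsq : SquareFreeM G) {e : Fin m → ℤ} (he : IsRootM G e) {p : ℕ} (hpp : p.Prime) (h3 : 3 ≤ p) :
    ¬ (p : ℤ) ^ 2 ∣ Bf G e e := by
  have hpi := Nat.prime_iff_prime_int.mp hpp
  intro h
  have h2 : ¬ (p : ℤ) ∣ 2 := by
    intro h
    have := Int.le_of_dvd (by norm_num) h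
    omega
  have hG : ∀ i, (p : ℤ) ^ 2 ∣ (G.mulVec e) i := by
    intro i
    have h4 := h.trans (root_dvd hp he (Pi.single i 1))
    have h5 : (p : ℤ) ^ 2 ∣ Bf G (Pi.single i 1) e :=
      (((Prime.coprime_iff_not_dvd hpi).mpr h2).pow_left).dvd_of_dvd_mul_left h4
    simpa [Bf] using h5
  obtain ⟨S, T, d, hS, hT, hST, hd⟩ := hsq
  have hT' : T * T⁻¹ = 1 := Matrix.mul_nonsing_inv _ hT
  set z := T⁻¹.mulVec e with hz
  have hez : e = T.mulVec z := by
    rw [hz, mulVec_mulVec, hT', one_mulVec]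
  have hdz : ∀ i, (p : ℤ) ^ 2 ∣ d i * z i := by
    intro i
    have h6 : (Matrix.diagonal d).mulVec z = S.mulVec (G.mulVec e) := by
      rw [← hST, ← mulVec_mulVec, ← mulVec_mulVec, ← hez]
    have h7 := congrFun h6 i
    rw [mulVec_diagonal] at h7
    rw [h7, mulVec, dotProduct]
    exact Finset.dvd_sum fun j _ => (hG j).mul_left _
  have hpz : ∀ i, (p : ℤ) ∣ z i := by
    intro i
    by_contra hn
    have h8 := (((Prime.coprime_iff_not_dvd hpi).mpr hn).pow_left (m := 2)).dvd_of_dvd_mul_right (hdz i)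
    exact hpi.not_isUnit (hd i _ (by rw [← pow_two]; exact h8))
  choose w hw using hpz
  refine he.2.1 p (by exact_mod_cast hpp.one_lt) ⟨T.mulVec w, ?_⟩
  rw [hez, ← mulVec_smul]
  congr 1
  ext i
  simp [hw i]

/-- counting lemma: number of root norms divisible by `p` is the valuation of the determinant -/
lemma count_eq (hp : PosDefM G) (hsq : SquareFreeM G) (hE : RootBasis G E)
    {p : ℕ} (hpp : p.Prime) (h3 : 3 ≤ p)
    (hC : ¬ (p : ℤ) ∣ (CC G E).det) (k : ℕ) :
    (p : ℤ) ^ k ∣ G.det ↔ k ≤ ∑ i, if (p : ℤ) ∣ nn G E i then 1 else 0 := by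
  rw [dvd_prod_iff hp hE hpp h3 hC, count_lemma hpp]
  exact fun i => root_sq hp hsq (hE.2 i) hpp h3

end smooth

section neighbor

/-- matrix of the neighbour in terms of entries -/
def nbrMat {R : Type*} [CommRing R] (l a00 b02 b03 : R) (H : Matrix (Fin 4) (Fin 4) R) :
    Matrix (Fin 4) (Fin 4) R :=
  !![a00, H 0 1, b02, b03;
     H 0 1, l ^ 2 * H 1 1, l * H 1 2, l * H 1 3;
     b02, l * H 1 2, H 2 2, H 2 3;
     b03, l * H 1 3, H 2 3, H 3 3]

def dMat {R : Type*} [CommRing R] (l : R) : Matrix (Fin 4) (Fin 4) R :=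
  Matrix.diagonal ![1, l ^ 2, l, l]

lemma nbrMat_eq {R : Type*} [CommRing R] (l a00 b02 b03 : R) (H : Matrix (Fin 4) (Fin 4) R)
    (hs : H.IsSymm) (h00 : H 0 0 = l ^ 2 * a00) (h02 : H 0 2 = l * b02) (h03 : H 0 3 = l * b03) :
    dMat l * H * dMat l = l ^ 2 • nbrMat l a00 b02 b03 H := by
  have h10 : H 1 0 = H 0 1 := hs.apply 0 1
  have h20 : H 2 0 = l * b02 := by rw [hs.apply 0 2, h02]
  have h30 : H 3 0 = l * b03 := by rw [hs.apply 0 3, h03]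
  have h21 : H 2 1 = H 1 2 := hs.apply 1 2
  have h31 : H 3 1 = H 1 3 := hs.apply 1 3
  have h32 : H 3 2 = H 2 3 := hs.apply 2 3
  ext i j
  rw [dMat, Matrix.mul_diagonal, Matrix.diagonal_mul]
  fin_cases i <;> fin_cases j <;>
    simp [nbrMat, h00, h02, h03, h10, h20, h30, h21, h31, h32] <;> ring

lemma local_cong {R : Type*} [CommRing R] [IsDomain R] (l a00 b02 b03 t u c : R) (hl : l ≠ 0)
    (H : Matrix (Fin 4) (Fin 4) R)
    (hs : H.IsSymm) (h00 : H 0 0 = l ^ 2 * a00) (h02 : H 0 2 = l * b02) (h03 : H 0 3 = l * b03)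
    (hc : 2 * c = 1) (hu : u * (H 0 1 + l ^ 2 * t * H 1 1) = 1)
    (hiso : a00 + 2 * t * H 0 1 + l ^ 2 * t ^ 2 * H 1 1 = 0) :
    ∃ S : Matrix (Fin 4) (Fin 4) R, IsUnit S.det ∧ Sᵀ * H * S = nbrMat l a00 b02 b03 H := by
  have hD := nbrMat_eq l a00 b02 b03 H hs h00 h02 h03
  set N := nbrMat l a00 b02 b03 H
  obtain ⟨s2, hs2⟩ : ∃ s2, s2 = (b02 + l * t * H 1 2) * u := ⟨_, rfl⟩
  obtain ⟨s3, hs3⟩ : ∃ s3, s3 = (b03 + l * t * H 1 3) * u := ⟨_, rfl⟩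
  obtain ⟨r1, hr1⟩ : ∃ r1, r1 = -(H 1 1 * c * u) := ⟨_, rfl⟩
  obtain ⟨r2, hr2⟩ : ∃ r2, r2 = -((H 1 2 - l * s2 * H 1 1) * u) := ⟨_, rfl⟩
  obtain ⟨r3, hr3⟩ : ∃ r3, r3 = -((H 1 3 - l * s3 * H 1 1) * u) := ⟨_, rfl⟩
  let W : Matrix (Fin 4) (Fin 4) R :=
    !![1, r1, r2, r3;
       l ^ 2 * t, 1 + r1 * (l ^ 2 * t), r2 * (l ^ 2 * t) - l * s2, r3 * (l ^ 2 * t) - l * s3;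
       0, 0, 1, 0; 0, 0, 0, 1]
  let V : Matrix (Fin 4) (Fin 4) R :=
    !![1, l ^ 2 * r1, l * r2, l * r3;
       t, 1 + r1 * (l ^ 2 * t), r2 * (l * t) - s2, r3 * (l * t) - s3;
       0, 0, 1, 0; 0, 0, 0, 1]
  have hWV : W * dMat l = dMat l * V := by
    ext i j
    rw [dMat, Matrix.mul_diagonal, Matrix.diagonal_mul]
    fin_cases i <;> fin_cases j <;> simp [W, V] <;> ring
  have hVdet : V.det = 1 := by
    simp [V, Matrix.det_succ_row_zero, Fin.sum_univ_succ, Fin.succAbove]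
    ring
  have hWdet : W.det = 1 := by
    simp [W, Matrix.det_succ_row_zero, Fin.sum_univ_succ, Fin.succAbove]
  have h10 : H 1 0 = H 0 1 := hs.apply 0 1
  have h20 : H 2 0 = l * b02 := by rw [hs.apply 0 2, h02]
  have h30 : H 3 0 = l * b03 := by rw [hs.apply 0 3, h03]
  have h21 : H 2 1 = H 1 2 := hs.apply 1 2
  have h31 : H 3 1 = H 1 3 := hs.apply 1 3
  have h32 : H 3 2 = H 2 3 := hs.apply 2 3
  set M := Wᵀ * H * W with hM
  have hMs : M.IsSymm := by
    rw [Matrix.IsSymm, hM]; simp [Matrix.transpose_mul, hs.eq, Matrix.mul_assoc]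
  have m00 : M 0 0 = 0 := by
    simp [hM, W, Matrix.mul_apply, Fin.sum_univ_four, h00, h10]
    linear_combination l ^ 2 * hiso
  have m01 : M 0 1 = (H 0 1 + l ^ 2 * t * H 1 1) := by
    simp [hM, W, Matrix.mul_apply, Fin.sum_univ_four, h00, h10]
    linear_combination r1 * l ^ 2 * hiso
  have m02 : M 0 2 = 0 := by
    simp [hM, W, Matrix.mul_apply, Fin.sum_univ_four, h00, h10, h02]
    linear_combination r2 * l ^ 2 * hiso - l * (H 0 1 + l ^ 2 * t * H 1 1) * hs2
      - l * (b02 + l * t * H 1 2) * hu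
  have m03 : M 0 3 = 0 := by
    simp [hM, W, Matrix.mul_apply, Fin.sum_univ_four, h00, h10, h03]
    linear_combination r3 * l ^ 2 * hiso - l * (H 0 1 + l ^ 2 * t * H 1 1) * hs3
      - l * (b03 + l * t * H 1 3) * hu
  have m11 : M 1 1 = 0 := by
    simp [hM, W, Matrix.mul_apply, Fin.sum_univ_four, h00, h10]
    linear_combination r1 ^ 2 * l ^ 2 * hiso + 2 * (H 0 1 + l ^ 2 * t * H 1 1) * hr1
      - H 1 1 * hu * 2 * c - H 1 1 * hc
  have m12 : M 1 2 = 0 := by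
    simp [hM, W, Matrix.mul_apply, Fin.sum_univ_four, h00, h10, h02]
    linear_combination r1 * (r2 * l ^ 2 * hiso - l * (H 0 1 + l ^ 2 * t * H 1 1) * hs2
      - l * (b02 + l * t * H 1 2) * hu) + (H 0 1 + l ^ 2 * t * H 1 1) * hr2
      - (H 1 2 - l * s2 * H 1 1) * hu
  have m13 : M 1 3 = 0 := by
    simp [hM, W, Matrix.mul_apply, Fin.sum_univ_four, h00, h10, h03]
    linear_combination r1 * (r3 * l ^ 2 * hiso - l * (H 0 1 + l ^ 2 * t * H 1 1) * hs3
      - l * (b03 + l * t * H 1 3) * hu) + (H 0 1 + l ^ 2 * t * H 1 1) * hr3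
      - (H 1 3 - l * s3 * H 1 1) * hu
  have hDM : dMat l * M * dMat l = l ^ 2 • M := by
    have m10 : M 1 0 = M 0 1 := hMs.apply 0 1
    have m20 : M 2 0 = 0 := by rw [hMs.apply 0 2, m02]
    have m30 : M 3 0 = 0 := by rw [hMs.apply 0 3, m03]
    have m21 : M 2 1 = 0 := by rw [hMs.apply 1 2, m12]
    have m31 : M 3 1 = 0 := by rw [hMs.apply 1 3, m13]
    clear_value M
    ext i j
    rw [dMat, Matrix.mul_diagonal, Matrix.diagonal_mul]
    fin_cases i <;> fin_cases j <;>
      simp [m00, m02, m03, m10, m20, m30, m11, m12, m13, m21, m31] <;> ring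
  have hDt : (dMat l)ᵀ = dMat l := by rw [dMat, Matrix.diagonal_transpose]
  have hkey : Vᵀ * N * V = M := by
    have h1 : l ^ 2 • (Vᵀ * N * V) = l ^ 2 • M := by
      calc l ^ 2 • (Vᵀ * N * V) = Vᵀ * (l ^ 2 • N) * V := by
            rw [Matrix.mul_smul, Matrix.smul_mul]
        _ = (dMat l * V)ᵀ * H * (dMat l * V) := by
            rw [← hD, Matrix.transpose_mul, hDt]; simp only [Matrix.mul_assoc]
        _ = dMat l * M * dMat l := by
            rw [← hWV, Matrix.transpose_mul, hDt, hM]; simp only [Matrix.mul_assoc]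
        _ = _ := hDM
    exact smul_right_injective _ (pow_ne_zero 2 hl) h1
  have hVu : IsUnit V.det := by rw [hVdet]; exact isUnit_one
  have hVV : V * V⁻¹ = 1 := Matrix.mul_nonsing_inv _ hVu
  refine ⟨W * V⁻¹, ?_, ?_⟩
  · rw [det_mul, hWdet, one_mul]
    exact Matrix.isUnit_nonsing_inv_det V hVu
  · calc (W * V⁻¹)ᵀ * H * (W * V⁻¹) = V⁻¹ᵀ * M * V⁻¹ := by
          rw [Matrix.transpose_mul, hM]; simp only [Matrix.mul_assoc]
      _ = (V * V⁻¹)ᵀ * N * (V * V⁻¹) := by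
          rw [← hkey, Matrix.transpose_mul]; simp only [Matrix.mul_assoc]
      _ = N := by rw [hVV]; simp

end neighbor

section neighbor2

lemma padic_unit_iff {p : ℕ} [Fact p.Prime] (z : ℤ_[p]) : IsUnit z ↔ ¬ (p : ℤ_[p]) ∣ z := by
  rw [← PadicInt.norm_lt_one_iff_dvd, ← PadicInt.not_isUnit_iff, not_not]

lemma padic_unit_cast {p : ℕ} [Fact p.Prime] (k : ℤ) (h : ¬ (p : ℤ) ∣ k) :
    IsUnit (k : ℤ_[p]) := by
  rw [padic_unit_iff, ← PadicInt.norm_lt_one_iff_dvd, PadicInt.norm_int_lt_one_iff_dvd]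
  exact h

lemma hensel_quad {p : ℕ} [Fact p.Prime] (h2 : p ≠ 2) (a h01 h11 : ℤ_[p]) (hu : IsUnit h01) :
    ∃ t : ℤ_[p], a + 2 * t * h01 + (p : ℤ_[p]) ^ 2 * t ^ 2 * h11 = 0 := by
  have h2u : IsUnit (2 : ℤ_[p]) := by
    have := padic_unit_cast (p := p) 2 (by
      intro h
      have h' : p ∣ 2 := by exact_mod_cast h
      exact h2 ((Nat.prime_dvd_prime_iff_eq (Fact.out) Nat.prime_two).mp h'))
    simpa using this
  obtain ⟨w, hw⟩ := (h2u.mul hu).exists_right_inv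
  obtain ⟨k, hk⟩ : ∃ k, k = (p : ℤ_[p]) ^ 2 * h11 := ⟨_, rfl⟩
  let F : Polynomial ℤ_[p] := Polynomial.C a + Polynomial.C (2 * h01) * Polynomial.X
    + Polynomial.C k * Polynomial.X ^ 2
  have hF : ∀ z, F.aeval z = a + 2 * h01 * z + (p : ℤ_[p]) ^ 2 * h11 * z ^ 2 := by
    intro z; rw [← hk]; simp [F]
  have hF' : ∀ z, F.derivative.aeval z = 2 * h01 + (p : ℤ_[p]) ^ 2 * h11 * (2 * z) := by
    intro z; rw [← hk]; simp [F]; norm_num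
  have hFn : ‖F.aeval (-a * w)‖ < 1 := by
    rw [PadicInt.norm_lt_one_iff_dvd, hF]
    refine ⟨p * h11 * (-a * w) ^ 2, ?_⟩
    linear_combination -a * hw
  have hF'n : ‖F.derivative.aeval (-a * w)‖ = 1 := by
    rw [← PadicInt.isUnit_iff, padic_unit_iff, hF']
    intro h
    have h3 : (p : ℤ_[p]) ∣ (p : ℤ_[p]) ^ 2 * h11 * (2 * (-a * w)) :=
      ⟨p * h11 * (2 * (-a * w)), by ring⟩
    exact (padic_unit_iff _).mp (h2u.mul hu) ((dvd_add_left h3).mp h)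
  obtain ⟨z, hz, -⟩ := hensels_lemma (F := F) (a := -a * w) (by rw [hF'n]; simpa using hFn)
  refine ⟨z, ?_⟩
  rw [hF] at hz
  linear_combination hz

lemma nbr_genus (H : Matrix (Fin 4) (Fin 4) ℤ) (hs : H.IsSymm) {l : ℕ} (hl : l.Prime) (hl2 : l ≠ 2)
    (a00 b02 b03 : ℤ) (h00 : H 0 0 = (l : ℤ) ^ 2 * a00) (h02 : H 0 2 = l * b02)
    (h03 : H 0 3 = l * b03) (h01 : ¬ (l : ℤ) ∣ H 0 1) :
    SameGenusM H (nbrMat (l : ℤ) a00 b02 b03 H) := by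
  intro p hpf
  set Hp := H.map (Int.cast : ℤ → ℤ_[p]) with hHp
  have hsp : Hp.IsSymm := hs.map _
  have hmap : (nbrMat (l : ℤ) a00 b02 b03 H).map (Int.cast : ℤ → ℤ_[p]) =
      nbrMat (l : ℤ_[p]) a00 b02 b03 Hp := by
    ext i j
    fin_cases i <;> fin_cases j <;> simp [nbrMat, hHp]
  have hp00 : Hp 0 0 = (l : ℤ_[p]) ^ 2 * a00 := by simp [hHp, h00]
  have hp02 : Hp 0 2 = (l : ℤ_[p]) * b02 := by simp [hHp, h02]
  have hp03 : Hp 0 3 = (l : ℤ_[p]) * b03 := by simp [hHp, h03]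
  rw [hmap]
  by_cases hpl : p = l
  · subst hpl
    have hu : IsUnit (Hp 0 1) := padic_unit_cast _ h01
    obtain ⟨t, ht⟩ := hensel_quad hl2 (a00 : ℤ_[p]) (Hp 0 1) (Hp 1 1) hu
    have h2u : IsUnit (2 : ℤ_[p]) := by
      have := padic_unit_cast (p := p) 2 (by
        intro h
        have h' : p ∣ 2 := by exact_mod_cast h
        exact hl2 ((Nat.prime_dvd_prime_iff_eq hl Nat.prime_two).mp h'))
      simpa using this
    obtain ⟨c, hc⟩ := h2u.exists_right_inv
    have hh : IsUnit (Hp 0 1 + (p : ℤ_[p]) ^ 2 * t * Hp 1 1) := by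
      rw [padic_unit_iff]
      intro h
      have h3 : (p : ℤ_[p]) ∣ (p : ℤ_[p]) ^ 2 * t * Hp 1 1 := ⟨p * t * Hp 1 1, by ring⟩
      exact (padic_unit_iff _).mp hu ((dvd_add_left h3).mp h)
    obtain ⟨u, huu⟩ := hh.exists_left_inv
    exact local_cong (p : ℤ_[p]) a00 b02 b03 t u c (by exact_mod_cast hl.ne_zero) Hp hsp
      hp00 hp02 hp03 hc huu (by linear_combination ht)
  · have hlu : IsUnit ((l : ℤ) : ℤ_[p]) := by
      apply padic_unit_cast
      intro h
      have h' : p ∣ l := by exact_mod_cast h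
      exact hpl ((Nat.prime_dvd_prime_iff_eq Fact.out hl).mp h')
    obtain ⟨w, hw⟩ := hlu.exists_left_inv
    rw [Int.cast_natCast] at hw
    refine ⟨w • dMat (l : ℤ_[p]), ?_, ?_⟩
    · have : (w • dMat (l : ℤ_[p])).det = 1 := by
        rw [det_smul, dMat, det_diagonal]
        simp [Fin.prod_univ_four]
        calc w ^ 4 * ((l : ℤ_[p]) ^ 2 * l * l) = (w * l) ^ 4 := by ring
          _ = 1 := by rw [hw, one_pow]
      rw [this]; exact isUnit_one
    · have hDt : (dMat (l : ℤ_[p]))ᵀ = dMat (l : ℤ_[p]) := by rw [dMat, Matrix.diagonal_transpose]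
      rw [Matrix.transpose_smul, hDt, Matrix.smul_mul, Matrix.smul_mul, Matrix.mul_smul,
        nbrMat_eq _ _ _ _ _ hsp hp00 hp02 hp03, smul_smul, smul_smul]
      have : w * w * (l : ℤ_[p]) ^ 2 = 1 := by
        calc _ = (w * l) ^ 2 := by ring
          _ = 1 := by rw [hw, one_pow]
      rw [this, one_smul]

/-- existence of a suitable neighbour in direction `x` -/
def Nbr (G : Matrix (Fin 4) (Fin 4) ℤ) (l : ℕ) (x : Fin 4 → ℤ) : Prop :=
  ∃ (G' A A' : Matrix (Fin 4) (Fin 4) ℤ) (a : ℤ), G'.IsSymm ∧ PosDefM G' ∧ SameGenusM G G' ∧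
    G'.det = G.det ∧ A * A' = ((l : ℤ) ^ 2) • 1 ∧ Aᵀ * G * A = ((l : ℤ) ^ 2) • G' ∧
    ¬ (l : ℤ) ∣ a ∧ ∀ v i, (l : ℤ) ∣ (A.mulVec v) i - a * v 0 * x i

lemma nbr_base (H : Matrix (Fin 4) (Fin 4) ℤ) (hs : H.IsSymm) (hp : PosDefM H) {l : ℕ}
    (hl : l.Prime) (hl2 : l ≠ 2)
    (h00 : (l : ℤ) ^ 2 ∣ H 0 0) (h02 : (l : ℤ) ∣ H 0 2)
    (h03 : (l : ℤ) ∣ H 0 3) (h01 : ¬ (l : ℤ) ∣ H 0 1) : Nbr H l (Pi.single 0 1) := by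
  obtain ⟨a, ha⟩ := h00
  obtain ⟨b, hb⟩ := h02
  obtain ⟨c, hc⟩ := h03
  have hl0 : (l : ℤ) ≠ 0 := by exact_mod_cast hl.ne_zero
  have hD := nbrMat_eq (l : ℤ) a b c H hs ha hb hc
  have hDt : (dMat (l : ℤ))ᵀ = dMat (l : ℤ) := by rw [dMat, Matrix.diagonal_transpose]
  have hDdet : (dMat (l : ℤ)).det = (l : ℤ) ^ 4 := by
    rw [dMat, det_diagonal]; simp [Fin.prod_univ_four]; ring
  refine ⟨nbrMat (l : ℤ) a b c H, dMat (l : ℤ), Matrix.diagonal ![(l : ℤ) ^ 2, 1, l, l], 1,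
    ?_, ?_, nbr_genus H hs hl hl2 a b c ha hb hc h01, ?_, ?_, ?_, ?_, ?_⟩
  · ext i j
    fin_cases i <;> fin_cases j <;> simp [nbrMat]
  · intro v hv
    have h1 : (l : ℤ) ^ 2 * Bf (nbrMat (l : ℤ) a b c H) v v =
        Bf H ((dMat (l : ℤ)).mulVec v) ((dMat (l : ℤ)).mulVec v) := by
      have : (l : ℤ) ^ 2 * Bf (nbrMat (l : ℤ) a b c H) v v
          = Bf ((l : ℤ) ^ 2 • nbrMat (l : ℤ) a b c H) v v := by
        rw [Bf, Bf, smul_mulVec, dotProduct_smul, smul_eq_mul]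
      rw [this, ← hD]
      simp only [Bf, ← mulVec_mulVec]
      rw [dotProduct_mulVec, ← mulVec_transpose, hDt]
    have h2 : (dMat (l : ℤ)).mulVec v ≠ 0 := by
      intro h
      have := Matrix.exists_mulVec_eq_zero_iff.mp ⟨v, hv, h⟩
      rw [hDdet] at this
      exact pow_ne_zero 4 hl0 this
    have h3 := hp _ h2
    rw [← h1] at h3
    exact pos_of_mul_pos_right h3 (by positivity)
  · have := congrArg Matrix.det hD
    rw [det_mul, det_mul, hDdet, det_smul] at this
    have h8 : (l : ℤ) ^ 8 ≠ 0 := pow_ne_zero 8 hl0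
    apply mul_left_cancel₀ h8
    simp at this
    linear_combination -this
  · ext i j
    rw [dMat, Matrix.diagonal_mul_diagonal]
    fin_cases i <;> fin_cases j <;> simp <;> ring
  · rw [hDt, hD]
  · intro h
    have := Int.le_of_dvd one_pos h
    have := hl.two_le
    omega
  · intro v i
    rw [dMat, mulVec_diagonal]
    fin_cases i
    · simp
    · exact ⟨l * v 1, by simp; ring⟩
    · exact ⟨v 2, by simp⟩
    · exact ⟨v 3, by simp⟩

lemma nbr_transfer {G : Matrix (Fin 4) (Fin 4) ℤ} {l : ℕ} {x : Fin 4 → ℤ}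
    (U U' : Matrix (Fin 4) (Fin 4) ℤ) (hU : U * U' = 1)
    (h : Nbr (Uᵀ * G * U) l (U'.mulVec x)) : Nbr G l x := by
  obtain ⟨G', A, A', a, h1, h2, h3, h4, h5, h6, h7, h8⟩ := h
  have hdU : U.det * U'.det = 1 := by rw [← det_mul, hU, det_one]
  refine ⟨G', U * A, A' * U', a, h1, h2, ?_, ?_, ?_, ?_, h7, ?_⟩
  · intro p hpf
    obtain ⟨S, hS, hS2⟩ := h3 p
    have hmul : ∀ X Y : Matrix (Fin 4) (Fin 4) ℤ, (X * Y).map (Int.cast : ℤ → ℤ_[p]) =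
        X.map (Int.cast : ℤ → ℤ_[p]) * Y.map (Int.cast : ℤ → ℤ_[p]) := fun X Y =>
      Matrix.map_mul (f := Int.castRingHom ℤ_[p])
    have hdet : (U.map (Int.cast : ℤ → ℤ_[p])).det = (U.det : ℤ_[p]) :=
      ((Int.castRingHom ℤ_[p]).map_det U).symm
    refine ⟨U.map (Int.cast : ℤ → ℤ_[p]) * S, ?_, ?_⟩
    · rw [det_mul, hdet]
      refine IsUnit.mul ?_ hS
      have : IsUnit U.det := IsUnit.of_mul_eq_one _ hdU
      exact this.map (Int.castRingHom ℤ_[p])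
    · rw [← hS2, hmul, hmul, Matrix.transpose_mul, Matrix.transpose_map]
      simp only [Matrix.mul_assoc]
  · rw [h4, det_mul, det_mul, det_transpose]
    have h9 : U.det * U.det = 1 := by
      rcases Int.isUnit_iff.mp (IsUnit.of_mul_eq_one _ hdU) with h | h <;> rw [h] <;> norm_num
    linear_combination G.det * h9
  · calc U * A * (A' * U') = U * (A * A') * U' := by simp only [Matrix.mul_assoc]
      _ = _ := by rw [h5, Matrix.mul_smul, Matrix.mul_one, Matrix.smul_mul, hU]
  · rw [← h6, Matrix.transpose_mul]; simp only [Matrix.mul_assoc]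
  · intro v i
    have h9 : ∀ j, (l : ℤ) ∣ (A.mulVec v) j - (((a * v 0) • U'.mulVec x)) j := fun j => by
      simpa using h8 v j
    have h10 : (U * A).mulVec v = U.mulVec (A.mulVec v) := by rw [mulVec_mulVec]
    have h11 : x = U.mulVec (U'.mulVec x) := by rw [mulVec_mulVec, hU, one_mulVec]
    have h12 : (a * v 0) * x i = U.mulVec ((a * v 0) • U'.mulVec x) i := by
      rw [mulVec_smul, ← h11]; simp
    rw [h12, h10]
    have : (U *ᵥ A *ᵥ v) i - (U *ᵥ ((a * v 0) • U' *ᵥ x)) i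
        = ∑ j, U i j * ((A.mulVec v) j - (((a * v 0) • U'.mulVec x)) j) := by
      simp only [mulVec, dotProduct, ← Finset.sum_sub_distrib, mul_sub]
    rw [this]
    exact Finset.dvd_sum fun j _ => (h9 j).mul_left _

lemma nbr_congr {G : Matrix (Fin 4) (Fin 4) ℤ} {l : ℕ} (hl : l.Prime) {x x' : Fin 4 → ℤ}
    (c : ℤ) (hc : ¬ (l : ℤ) ∣ c)
    (hx : ∀ i, (l : ℤ) ∣ x' i - c * x i) (h : Nbr G l x') : Nbr G l x := by
  obtain ⟨G', A, A', a, h1, h2, h3, h4, h5, h6, h7, h8⟩ := h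
  refine ⟨G', A, A', a * c, h1, h2, h3, h4, h5, h6, ?_, ?_⟩
  · intro h
    rcases (Nat.prime_iff_prime_int.mp hl).dvd_or_dvd h with h | h
    · exact h7 h
    · exact hc h
  · intro v i
    have h9 := dvd_add (h8 v i) ((hx i).mul_left (a * v 0))
    have h10 : (A.mulVec v) i - a * c * v 0 * x i =
      (A.mulVec v) i - a * v 0 * x' i + a * v 0 * (x' i - c * x i) := by ring
    rw [h10]; exact h9

end neighbor2

section neighbor3
variable {G : Matrix (Fin 4) (Fin 4) ℤ}

lemma Bf_transform (G U : Matrix (Fin 4) (Fin 4) ℤ) (v w : Fin 4 → ℤ) :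
    Bf (Uᵀ * G * U) v w = Bf G (U.mulVec v) (U.mulVec w) := by
  simp only [Bf, ← mulVec_mulVec]
  rw [dotProduct_mulVec, vecMul_transpose]

lemma transform_symm (hs : G.IsSymm) (U : Matrix (Fin 4) (Fin 4) ℤ) : (Uᵀ * G * U).IsSymm := by
  rw [Matrix.IsSymm]; simp [Matrix.transpose_mul, hs.eq, Matrix.mul_assoc]

lemma transform_pos (hp : PosDefM G) {U U' : Matrix (Fin 4) (Fin 4) ℤ} (hU : U' * U = 1) :
    PosDefM (Uᵀ * G * U) := by
  intro v hv
  rw [Bf_transform]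
  apply hp
  intro h
  apply hv
  have : v = U'.mulVec (U.mulVec v) := by rw [mulVec_mulVec, hU, one_mulVec]
  rw [this, h, mulVec_zero]

lemma entry_eq_Bf (G : Matrix (Fin 4) (Fin 4) ℤ) (i j : Fin 4) :
    G i j = Bf G (Pi.single i 1) (Pi.single j 1) := by
  simp [Bf]

lemma nbr_perm {l : ℕ} {x : Fin 4 → ℤ} (σ : Equiv.Perm (Fin 4))
    (h : Nbr (G.submatrix σ σ) l (x ∘ σ)) : Nbr G l x := by
  refine nbr_transfer ((1 : Matrix (Fin 4) (Fin 4) ℤ).submatrix id σ)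
    ((1 : Matrix (Fin 4) (Fin 4) ℤ).submatrix σ id) ?_ ?_
  · rw [Matrix.submatrix_mul_equiv, Matrix.one_mul, Matrix.submatrix_id_id]
  · convert h using 1
    · ext i j
      simp [Matrix.mul_apply, Matrix.one_apply]
    · ext i
      simp [mulVec, dotProduct, Matrix.one_apply]

lemma nbr_e0' (H : Matrix (Fin 4) (Fin 4) ℤ) (hs : H.IsSymm) (hp : PosDefM H) {l : ℕ}
    (hl : l.Prime) (hl2 : l ≠ 2)
    (h00 : (l : ℤ) ^ 2 ∣ H 0 0) (h01 : ¬ (l : ℤ) ∣ H 0 1) : Nbr H l (Pi.single 0 1) := by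
  have hli := Nat.prime_iff_prime_int.mp hl
  obtain ⟨u, w, huw⟩ := (Prime.coprime_iff_not_dvd hli).mpr h01
  obtain ⟨c2, hc2⟩ : ∃ c2, c2 = w * H 0 2 := ⟨_, rfl⟩
  obtain ⟨c3, hc3⟩ : ∃ c3, c3 = w * H 0 3 := ⟨_, rfl⟩
  let U : Matrix (Fin 4) (Fin 4) ℤ := !![1,0,0,0;0,1,-c2,-c3;0,0,1,0;0,0,0,1]
  let U' : Matrix (Fin 4) (Fin 4) ℤ := !![1,0,0,0;0,1,c2,c3;0,0,1,0;0,0,0,1]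
  have hU : U * U' = 1 := by
    ext i j; fin_cases i <;> fin_cases j <;> simp [U, U', Matrix.mul_apply, Fin.sum_univ_four]
  have hU' : U' * U = 1 := by
    ext i j; fin_cases i <;> fin_cases j <;> simp [U, U', Matrix.mul_apply, Fin.sum_univ_four]
  apply nbr_transfer U U' hU
  have hx : U'.mulVec (Pi.single 0 1) = Pi.single 0 1 := by
    ext i; fin_cases i <;> simp [U']
  rw [hx]
  have e00 : (Uᵀ * H * U) 0 0 = H 0 0 := by
    simp [U, Matrix.mul_apply, Fin.sum_univ_four]
  have e01 : (Uᵀ * H * U) 0 1 = H 0 1 := by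
    simp [U, Matrix.mul_apply, Fin.sum_univ_four]
  have e02 : (Uᵀ * H * U) 0 2 = H 0 2 - c2 * H 0 1 := by
    simp [U, Matrix.mul_apply, Fin.sum_univ_four]; ring
  have e03 : (Uᵀ * H * U) 0 3 = H 0 3 - c3 * H 0 1 := by
    simp [U, Matrix.mul_apply, Fin.sum_univ_four]; ring
  refine nbr_base _ (transform_symm hs U) (transform_pos hp hU') hl hl2 ?_ ?_ ?_ ?_
  · rw [e00]; exact h00
  · rw [e02, hc2]; exact ⟨u * H 0 2, by linear_combination (-H 0 2) * huw⟩
  · rw [e03, hc3]; exact ⟨u * H 0 3, by linear_combination (-H 0 3) * huw⟩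
  · rw [e01]; exact h01

lemma submatrix_pos (hp : PosDefM G) (σ : Equiv.Perm (Fin 4)) : PosDefM (G.submatrix σ σ) := by
  have : G.submatrix σ σ = ((1 : Matrix (Fin 4) (Fin 4) ℤ).submatrix id σ)ᵀ * G *
      ((1 : Matrix (Fin 4) (Fin 4) ℤ).submatrix id σ) := by
    ext i j
    simp [Matrix.mul_apply, Matrix.one_apply]
  rw [this]
  apply transform_pos hp (U' := (1 : Matrix (Fin 4) (Fin 4) ℤ).submatrix σ id)
  ext i j
  simp [Matrix.mul_apply, Matrix.one_apply]

lemma nbr_e0 (H : Matrix (Fin 4) (Fin 4) ℤ) (hs : H.IsSymm) (hp : PosDefM H) {l : ℕ}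
    (hl : l.Prime) (hl2 : l ≠ 2) (h00 : (l : ℤ) ^ 2 ∣ H 0 0) (j : Fin 4) (hj : j ≠ 0)
    (h0j : ¬ (l : ℤ) ∣ H 0 j) : Nbr H l (Pi.single 0 1) := by
  have hσ : Equiv.swap 1 j 0 = 0 := Equiv.swap_apply_of_ne_of_ne (by decide) hj.symm
  apply nbr_perm (Equiv.swap 1 j)
  have hx : (Pi.single 0 1 : Fin 4 → ℤ) ∘ (Equiv.swap 1 j) = Pi.single 0 1 := by
    ext i
    simp only [Function.comp, Pi.single_apply]
    have : Equiv.swap 1 j i = 0 ↔ i = 0 := by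
      rw [← hσ, Equiv.apply_eq_iff_eq, hσ]
    simp [this]
  rw [hx]
  apply nbr_e0' _ (hs.submatrix _) (submatrix_pos hp _) hl hl2
  · simpa [hσ] using h00
  · simpa [hσ] using h0j

lemma nbr_x1 (hs : G.IsSymm) (hp : PosDefM G) {l : ℕ}
    (hl : l.Prime) (hl2 : l ≠ 2) (x y : Fin 4 → ℤ) (hx0 : x 0 = 1)
    (hxx : (l : ℤ) ^ 2 ∣ Bf G x x) (hxy : ¬ (l : ℤ) ∣ Bf G x y) : Nbr G l x := by
  let U : Matrix (Fin 4) (Fin 4) ℤ := !![1,0,0,0;x 1,1,0,0;x 2,0,1,0;x 3,0,0,1]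
  let U' : Matrix (Fin 4) (Fin 4) ℤ := !![1,0,0,0;-x 1,1,0,0;-x 2,0,1,0;-x 3,0,0,1]
  have hU : U * U' = 1 := by
    ext i j; fin_cases i <;> fin_cases j <;> simp [U, U', Matrix.mul_apply, Fin.sum_univ_four]
  have hU' : U' * U = 1 := by
    ext i j; fin_cases i <;> fin_cases j <;> simp [U, U', Matrix.mul_apply, Fin.sum_univ_four]
  have hUe : U.mulVec (Pi.single 0 1) = x := by
    ext i; fin_cases i <;> simp [U, hx0]
  have hU'x : U'.mulVec x = Pi.single 0 1 := by
    rw [← hUe, mulVec_mulVec, hU', one_mulVec]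
  apply nbr_transfer U U' hU
  rw [hU'x]
  have hent : ∀ j, (Uᵀ * G * U) 0 j = Bf G x (U.mulVec (Pi.single j 1)) := by
    intro j
    rw [entry_eq_Bf (Uᵀ * G * U) 0 j, Bf_transform, hUe]
  have h00 : (l : ℤ) ^ 2 ∣ (Uᵀ * G * U) 0 0 := by rw [hent, hUe]; exact hxx
  by_contra hcon
  apply hxy
  have hall : ∀ j, (l : ℤ) ∣ (Uᵀ * G * U) 0 j := by
    intro j
    by_contra hj
    by_cases hj0 : j = 0
    · subst hj0; exact hj ((dvd_pow_self _ (by norm_num)).trans h00)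
    · exact hcon (nbr_e0 _ (transform_symm hs U) (transform_pos hp hU') hl hl2 h00 j hj0 hj)
  have : Bf G x y = ((Uᵀ * G * U).mulVec (U'.mulVec y)) 0 := by
    have h1 := Bf_transform G U (Pi.single 0 1) (U'.mulVec y)
    rw [hUe, mulVec_mulVec y U U', hU, one_mulVec] at h1
    rw [← h1]; simp [Bf]
  rw [this, mulVec, dotProduct]
  exact Finset.dvd_sum fun j _ => (hall j).mul_right _

/-- neighbours exist -/
lemma nbr_exists (hs : G.IsSymm) (hp : PosDefM G) {l : ℕ}
    (hl : l.Prime) (hl2 : l ≠ 2) (x y : Fin 4 → ℤ)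
    (hxx : (l : ℤ) ∣ Bf G x x) (hxy : ¬ (l : ℤ) ∣ Bf G x y) : Nbr G l x := by
  have hli := Nat.prime_iff_prime_int.mp hl
  have h2 : ¬ (l : ℤ) ∣ 2 := by
    intro h
    have h' : l ∣ 2 := by exact_mod_cast h
    exact hl2 ((Nat.prime_dvd_prime_iff_eq hl Nat.prime_two).mp h')
  obtain ⟨k, hk⟩ := hxx
  have h2b : ¬ (l : ℤ) ∣ 2 * Bf G x y := by
    intro h; rcases hli.dvd_or_dvd h with h | h
    · exact h2 h
    · exact hxy h
  obtain ⟨u, w, huw⟩ := (Prime.coprime_iff_not_dvd hli).mpr h2b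
  set x1 : Fin 4 → ℤ := x + (l * (-w * k)) • y with hx1
  have hx1x : ∀ i, (l : ℤ) ∣ x1 i - 1 * x i := by
    intro i; simp only [hx1, Pi.add_apply, Pi.smul_apply, smul_eq_mul]
    exact ⟨-w * k * y i, by ring⟩
  have hx1n : (l : ℤ) ^ 2 ∣ Bf G x1 x1 := by
    simp only [hx1, Bf_add_left, Bf_add_right, Bf_smul_left, Bf_smul_right, Bf_comm hs y x, hk]
    exact ⟨k * u + (w * k) ^ 2 * Bf G y y, by linear_combination (-(l * k)) * huw⟩
  have hx1y : ¬ (l : ℤ) ∣ Bf G x1 y := by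
    intro h
    have := Bf_congr_left G l x1 x y (fun i => by simpa using hx1x i)
    exact hxy ((dvd_sub_right h).mp this)
  clear_value x1
  refine nbr_congr hl 1 (by
    intro h; have := Int.le_of_dvd one_pos h; have := hl.two_le; omega) hx1x ?_
  have hi0 : ∃ i, ¬ (l : ℤ) ∣ x1 i := by
    by_contra hall
    push Not at hall
    apply hx1y
    rw [Bf, dotProduct]
    exact Finset.dvd_sum fun j _ => (hall j).mul_right _
  obtain ⟨i0, hi0⟩ := hi0
  apply nbr_perm (Equiv.swap 0 i0)
  set σ : Equiv.Perm (Fin 4) := Equiv.swap 0 i0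
  set H := G.submatrix σ σ
  have hHs : H.IsSymm := hs.submatrix σ
  have hHp : PosDefM H := submatrix_pos hp σ
  have hB : ∀ v z : Fin 4 → ℤ, Bf H (v ∘ σ) (z ∘ σ) = Bf G v z := by
    intro v z
    simp only [Bf, dotProduct, mulVec, H, submatrix_apply, Function.comp]
    rw [Equiv.sum_comp σ (fun i => v i * ∑ j, G i (σ j) * z (σ j))]
    refine Finset.sum_congr rfl fun i _ => ?_
    rw [Equiv.sum_comp σ (fun j => G i j * z j)]
  set x2 := x1 ∘ σ with hx2
  have hx20 : ¬ (l : ℤ) ∣ x2 0 := by simpa [hx2, σ] using hi0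
  have hx2n : (l : ℤ) ^ 2 ∣ Bf H x2 x2 := by rw [hB]; exact hx1n
  have hx2y : ¬ (l : ℤ) ∣ Bf H x2 (y ∘ σ) := by rw [hB]; exact hx1y
  clear_value x2
  obtain ⟨c', c, hcc⟩ := ((Prime.coprime_iff_not_dvd hli).mpr hx20).pow_left (m := 2)
  set x3 : Fin 4 → ℤ := c • x2 + (1 - c * x2 0) • Pi.single 0 1 with hx3
  have hx3' : x3 = c • x2 + ((l : ℤ) ^ 2 * c') • Pi.single 0 1 := by
    rw [hx3]; congr 2; linear_combination -hcc
  have hcl : ¬ (l : ℤ) ∣ c := by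
    intro h
    have h1 : (l : ℤ) ∣ c' * l ^ 2 + c * x2 0 :=
      dvd_add ((dvd_pow_self _ (by norm_num)).mul_left _) (h.mul_right _)
    rw [hcc] at h1
    have := Int.le_of_dvd one_pos h1; have := hl.two_le; omega
  refine nbr_congr hl c hcl (x' := x3) ?_ ?_
  · intro i
    rw [hx3']
    simp only [Pi.add_apply, Pi.smul_apply, smul_eq_mul]
    exact ⟨l * c' * (Pi.single 0 1 : Fin 4 → ℤ) i, by ring⟩
  · refine nbr_x1 hHs hHp hl hl2 x3 (y ∘ σ) ?_ ?_ ?_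
    · rw [hx3]; simp
    · rw [hx3']
      simp only [Bf_add_left, Bf_add_right, Bf_smul_left, Bf_smul_right]
      refine dvd_add (Dvd.dvd.mul_left (dvd_add (hx2n.mul_left _) ?_) _) ?_
      · rw [mul_assoc]; exact dvd_mul_right _ _
      · rw [mul_assoc]; exact dvd_mul_right _ _
    · rw [hx3']
      simp only [Bf_add_left, Bf_smul_left]
      intro h
      have h1 : (l : ℤ) ∣ (l : ℤ) ^ 2 * c' * Bf H (Pi.single 0 1) (y ∘ σ) :=
        ⟨l * c' * Bf H (Pi.single 0 1) (y ∘ σ), by ring⟩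
      rcases hli.dvd_or_dvd ((dvd_add_left h1).mp h) with h | h
      · exact hcl h
      · exact hx2y h

end neighbor3

section sevenA

/-- the coprime product attached to two norms -/
def cc (n m : ℤ) : ℕ := (n.natAbs / Int.gcd n m) * (m.natAbs / Int.gcd n m)

lemma cc_pos {n m : ℤ} (hn : 0 < n) (hm : 0 < m) : 0 < cc n m := by
  have hg : 0 < Int.gcd n m := Int.gcd_pos_of_ne_zero_left _ hn.ne'
  have h1 : Int.gcd n m ∣ n.natAbs := Nat.gcd_dvd_left _ _
  have h2 : Int.gcd n m ∣ m.natAbs := Nat.gcd_dvd_right _ _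
  exact Nat.mul_pos (Nat.div_pos (Nat.le_of_dvd (by omega) h1) hg)
    (Nat.div_pos (Nat.le_of_dvd (by omega) h2) hg)

lemma cc_dvd {n m : ℤ} {p : ℕ} (hp : p.Prime) (h : ¬ ((p : ℤ) ∣ n ↔ (p : ℤ) ∣ m)) : p ∣ cc n m := by
  have h1 : Int.gcd n m ∣ n.natAbs := Nat.gcd_dvd_left _ _
  have h2 : Int.gcd n m ∣ m.natAbs := Nat.gcd_dvd_right _ _
  rw [Int.natCast_dvd, Int.natCast_dvd] at h
  unfold cc
  generalize Int.gcd n m = g at *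
  obtain ⟨a, ha⟩ := h1
  obtain ⟨b, hb⟩ := h2
  rcases Nat.eq_zero_or_pos g with hg | hg
  · subst hg; simp at ha hb; simp [ha, hb] at h
  rw [ha, hb] at h ⊢
  rw [Nat.mul_div_cancel_left _ hg, Nat.mul_div_cancel_left _ hg]
  rw [hp.dvd_mul, hp.dvd_mul] at h
  rw [hp.dvd_mul]; tauto

lemma cc_le {n m t : ℤ} (hn : 0 < n) (hm : 0 < m) (h1 : n ∣ 2 * t) (h2 : m ∣ 2 * t) (ht : t ≠ 0) :
    n * m * cc n m ≤ 4 * t ^ 2 := by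
  have hg : 0 < Int.gcd n m := Int.gcd_pos_of_ne_zero_left _ hn.ne'
  have h3 : Int.lcm n m ∣ (2 * t).natAbs := Int.lcm_dvd (Int.dvd_natAbs.mpr h1) (Int.dvd_natAbs.mpr h2)
  have h3' := Nat.le_of_dvd (by omega) h3
  have h4 : Int.gcd n m * Int.lcm n m = n.natAbs * m.natAbs := Nat.gcd_mul_lcm _ _
  have h5 : n.natAbs * m.natAbs * cc n m = Int.lcm n m ^ 2 := by
    obtain ⟨a, ha⟩ : Int.gcd n m ∣ n.natAbs := Nat.gcd_dvd_left _ _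
    obtain ⟨b, hb⟩ : Int.gcd n m ∣ m.natAbs := Nat.gcd_dvd_right _ _
    unfold cc
    generalize Int.gcd n m = g at *
    rw [ha, hb] at h4 ⊢
    rw [Nat.mul_div_cancel_left _ hg, Nat.mul_div_cancel_left _ hg]
    have : Int.lcm n m = g * a * b := Nat.eq_of_mul_eq_mul_left hg (by rw [h4]; ring)
    rw [this]; ring
  have h6 : n.natAbs * m.natAbs * cc n m ≤ (2 * t).natAbs ^ 2 := by
    rw [h5]; exact Nat.pow_le_pow_left h3' 2
  have h7 : ((n.natAbs * m.natAbs * cc n m : ℕ) : ℤ) ≤ (((2 * t).natAbs ^ 2 : ℕ) : ℤ) := by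
    exact_mod_cast h6
  push_cast at h7
  rw [abs_of_pos hn, abs_of_pos hm, sq_abs] at h7
  linarith

variable {G : Matrix (Fin 4) (Fin 4) ℤ}

/-- a vector of the lattice coming from a root of a neighbour -/
def NV (G : Matrix (Fin 4) (Fin 4) ℤ) (l : ℕ) (x w : Fin 4 → ℤ) (m : ℤ) : Prop :=
  0 < m ∧ Bf G w w = (l : ℤ) ^ 2 * m ∧ (∀ e, IsRootM G e → m ∣ 2 * Bf G w e) ∧
    ∀ e, IsRootM G e → ¬ (l : ℤ) ∣ phi G e x → ∀ k : ℤ, w ≠ k • e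

lemma NV.cc_le (hs : G.IsSymm) (hp : PosDefM G) {l : ℕ} {x w : Fin 4 → ℤ} {m : ℤ}
    (h : NV G l x w m) {e : Fin 4 → ℤ} (he : IsRootM G e) (ht : Bf G w e ≠ 0) :
    cc (Bf G e e) m ≤ 4 * l ^ 2 := by
  obtain ⟨hm, hw, hd, _⟩ := h
  have hn := root_pos hp he
  have h1 := _root_.cc_le hn hm (root_dvd hp he w) (hd e he) ht
  have h2 := Bf_cs hs hp w e
  rw [hw] at h2
  have h3 : (Bf G e e * m) * (cc (Bf G e e) m : ℤ) ≤ (Bf G e e * m) * (4 * l ^ 2) := by nlinarith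
  have h4 := le_of_mul_le_mul_left h3 (mul_pos hn hm)
  exact_mod_cast h4

lemma nbr_NV (hs : G.IsSymm) (hp : PosDefM G) (hsq : SquareFreeM G) (htr : TotallyReflectiveM G)
    (hd : 0 < G.det) {l : ℕ}
    (hl : l.Prime) (hl2 : l ≠ 2) (x y : Fin 4 → ℤ)
    (hxx : (l : ℤ) ∣ Bf G x x) (hxy : ¬ (l : ℤ) ∣ Bf G x y)
    {p₀ : ℕ} (hp0 : p₀.Prime) (h17 : 17 ≤ p₀) (hpd : (p₀ : ℤ) ∣ G.det)
    (h3 : ¬ (p₀ : ℤ) ^ 3 ∣ G.det) :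
    (∃ w m, NV G l x w m ∧ (p₀ : ℤ) ∣ m) ∧
    (5 ≤ l → ∃ w m, NV G l x w m ∧
      ∀ e, IsRootM G e → ¬ (l : ℤ) ∣ phi G e x → Bf G w e ≠ 0) := by
  have hli := Nat.prime_iff_prime_int.mp hl
  have hl3 : 3 ≤ l := by have := hl.two_le; omega
  have hl0 : (l : ℤ) ≠ 0 := by positivity
  obtain ⟨G', A, A', a, hs', hp', hgen, hdet, hAA, hAG, ha, hA⟩ :=
    nbr_exists hs hp hl hl2 x y hxx hxy
  obtain ⟨E', hE'⟩ := exists_rootBasis (htr G' hs' hp' hgen)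
  have hB : ∀ v z, Bf G (A.mulVec v) (A.mulVec z) = (l : ℤ) ^ 2 * Bf G' v z := by
    intro v z
    rw [← Bf_transform, hAG, Bf, smul_mulVec, dotProduct_smul]; rfl
  have hphi : ∀ e, IsRootM G e → ∀ v, (l : ℤ) ∣ phi G e (A.mulVec v) - a * v 0 * phi G e x := by
    intro e he v
    have := phi_congr hp he l (A.mulVec v) ((a * v 0) • x) (fun i => by simpa using hA v i)
    rwa [phi_smul hp he] at this
  have key : ∀ v, IsRootM G' v → NV G l x (A.mulVec v) (Bf G' v v) := by
    intro v hv
    refine ⟨root_pos hp' hv, hB v v, ?_, ?_⟩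
    · intro e he
      have h1 := hB v (A'.mulVec e)
      rw [mulVec_mulVec, hAA, smul_mulVec, one_mulVec, Bf_smul_right] at h1
      rw [mul_left_cancel₀ (pow_ne_zero 2 hl0) h1, Bf_comm hs' v (A'.mulVec e)]
      exact root_dvd hp' hv _
    · intro e he hphe k hk
      have h1 := hB v v
      rw [hk, Bf_smul_left, Bf_smul_right] at h1
      have hne := root_pos hp he
      have hlk : (l : ℤ) ∣ k := by
        by_contra hlk
        apply root_sq hp hsq he hl hl3
        have hco : IsCoprime ((l : ℤ) ^ 2) (k * k) :=
          (((Prime.coprime_iff_not_dvd hli).mpr hlk).mul_right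
            ((Prime.coprime_iff_not_dvd hli).mpr hlk)).pow_left
        exact hco.dvd_of_dvd_mul_left ⟨Bf G' v v, by rw [← h1]; ring⟩
      obtain ⟨k', rfl⟩ := hlk
      have hnv : Bf G' v v = k' ^ 2 * Bf G e e := by
        apply mul_left_cancel₀ (pow_ne_zero 2 hl0); rw [← h1]; ring
      have hk' : k' ≠ 0 := by
        rintro rfl
        have := root_pos hp' hv; simp [hnv] at this
      have h2 := hB (Pi.single 0 1) v
      rw [hk, Bf_smul_right] at h2
      have h4 := phi_mul hp he (A.mulVec (Pi.single 0 1))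
      have h5 := phi_mul hp' hv (Pi.single 0 1)
      rw [hnv] at h5
      have h6 : phi G e (A.mulVec (Pi.single 0 1)) = l * (phi G' v (Pi.single 0 1) * k') := by
        have hz : (l : ℤ) * k' * Bf G e e ≠ 0 := by positivity
        apply mul_left_cancel₀ hz
        linear_combination (l * k') * h4 + 2 * h2 - l ^ 2 * h5
      have h7 := hphi e he (Pi.single 0 1)
      rw [h6] at h7
      have h8 := (dvd_sub_right (dvd_mul_right (l : ℤ) _)).mp h7
      simp only [Pi.single_eq_same, mul_one] at h8
      rcases hli.dvd_or_dvd h8 with h | h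
      · exact ha h
      · exact hphe h
  constructor
  · obtain ⟨⟨i, hi⟩, -⟩ := split_exists hs' hp' hE' (hdet ▸ hd) hp0 h17 (hdet ▸ hpd) (hdet ▸ h3)
    exact ⟨_, _, key _ (hE'.2 i), hi⟩
  · intro hl5
    have hC := not_dvd_CC hs' hp' hE' (hdet ▸ hd) hp0 h17 (hdet ▸ hpd) (hdet ▸ h3) hl hl5
    have hEd := not_dvd_E hp' hE' hC
    have : ∃ i, ¬ (l : ℤ) ∣ E' i 0 := by
      by_contra hall
      push Not at hall
      apply hEd
      rw [det_succ_column_zero]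
      exact Finset.dvd_sum fun i _ => ((hall i).mul_left _).mul_right _
    obtain ⟨i, hi⟩ := this
    refine ⟨_, _, key _ (hE'.2 i), ?_⟩
    intro e he hphe h0
    have h1 := phi_mul hp he (A.mulVec (E' i))
    rw [h0, mul_zero] at h1
    have h2 : phi G e (A.mulVec (E' i)) = 0 := by
      rcases mul_eq_zero.mp h1 with h | h
      · exact h
      · exact absurd h (root_pos hp he).ne'
    have h3 := hphi e he (E' i)
    rw [h2, zero_sub, dvd_neg] at h3
    rcases hli.dvd_or_dvd h3 with h | h
    · rcases hli.dvd_or_dvd h with h | h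
      · exact ha h
      · exact hi h
    · exact hphe h

end sevenA

section eightA
variable {G : Matrix (Fin 4) (Fin 4) ℤ}

lemma binlem {l : ℕ} (hl : l.Prime) (hl2 : l ≠ 2) (a b c : ℤ) (ha : ¬ (l : ℤ) ∣ a)
    (hb : ¬ (l : ℤ) ∣ b) : ∃ s t : ℤ, (l : ℤ) ∣ a * s ^ 2 + b * t ^ 2 - c := by
  have := Fact.mk hl
  have ha' : (a : ZMod l) ≠ 0 := fun h => ha ((ZMod.intCast_zmod_eq_zero_iff_dvd _ _).mp h)
  have hb' : (b : ZMod l) ≠ 0 := fun h => hb ((ZMod.intCast_zmod_eq_zero_iff_dvd _ _).mp h)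
  have hodd : Fintype.card (ZMod l) % 2 = 1 := by
    rw [ZMod.card]; exact (Nat.Prime.eq_two_or_odd hl).resolve_left hl2
  obtain ⟨s, t, hst⟩ := FiniteField.exists_root_sum_quadratic
    (f := Polynomial.C (a : ZMod l) * Polynomial.X ^ 2 + Polynomial.C 0 * Polynomial.X + Polynomial.C 0)
    (g := Polynomial.C (b : ZMod l) * Polynomial.X ^ 2 + Polynomial.C 0 * Polynomial.X +
      Polynomial.C (-(c : ZMod l)))
    (Polynomial.degree_quadratic ha') (Polynomial.degree_quadratic hb') hodd
  obtain ⟨s, rfl⟩ := ZMod.intCast_surjective s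
  obtain ⟨t, rfl⟩ := ZMod.intCast_surjective t
  refine ⟨s, t, (ZMod.intCast_zmod_eq_zero_iff_dvd _ _).mp ?_⟩
  simp at hst
  push_cast
  linear_combination hst

lemma orth_basis (hs : G.IsSymm) (hp : PosDefM G) {l : ℕ} (hl : l.Prime) (hl2 : l ≠ 2)
    {e : Fin 4 → ℤ} (he : IsRootM G e) :
    ∃ M : Matrix (Fin 4) (Fin 4) ℤ, M 0 = e ∧ ¬ (l : ℤ) ∣ M.det ∧
      (∀ i, i ≠ 0 → (l : ℤ) ∣ phi G e (M i)) ∧ ∀ i j, i ≠ j → (l : ℤ) ∣ Bf G (M i) (M j) := by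
  have := Fact.mk hl
  have h2 : (2 : ZMod l) ≠ 0 := by
    intro h
    have h' : l ∣ 2 := (ZMod.natCast_eq_zero_iff 2 l).mp (by exact_mod_cast h)
    exact hl2 ((Nat.prime_dvd_prime_iff_eq hl Nat.prime_two).mp h')
  have : Invertible (2 : ZMod l) := invertibleOfNonzero h2
  let Gb : Matrix (Fin 4) (Fin 4) (ZMod l) := G.map (Int.cast : ℤ → ZMod l)
  let B : LinearMap.BilinForm (ZMod l) (Fin 4 → ZMod l) := Matrix.toBilin' Gb
  let cst : (Fin 4 → ℤ) → (Fin 4 → ZMod l) := fun v i => (v i : ZMod l)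
  have hB : ∀ v z : Fin 4 → ℤ, B (cst v) (cst z) = (Bf G v z : ZMod l) := by
    intro v z
    simp only [B, Matrix.toBilin'_apply', Bf, dotProduct, mulVec, Gb, cst, map_apply]
    push_cast; rfl
  have hcs : ∀ v : Fin 4 → ZMod l, ∃ z, cst z = v := by
    intro v
    choose z hz using fun i => ZMod.intCast_surjective (v i)
    exact ⟨z, funext hz⟩
  have hBs : B.IsSymm := by
    constructor
    intro v z
    obtain ⟨v, rfl⟩ := hcs v
    obtain ⟨z, rfl⟩ := hcs z
    simp only [hB, RingHom.id_apply]; rw [Bf_comm hs]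
  let f : (Fin 4 → ZMod l) →ₗ[ZMod l] ZMod l :=
    ∑ i, (phi G e (Pi.single i 1) : ZMod l) • LinearMap.proj i
  have hphi : ∀ v : Fin 4 → ℤ, phi G e v = ∑ i, phi G e (Pi.single i 1) * v i := by
    intro v
    apply mul_right_cancel₀ (root_pos hp he).ne'
    rw [phi_mul hp he, Finset.sum_mul]
    have : ∀ i, phi G e (Pi.single i 1) * v i * Bf G e e = 2 * (v i * (G.mulVec e) i) := by
      intro i
      have := phi_mul hp he (Pi.single i 1)
      have h3 : Bf G (Pi.single i 1) e = (G.mulVec e) i := by simp [Bf]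
      rw [h3] at this
      linear_combination v i * this
    rw [Finset.sum_congr rfl fun i _ => this i, ← Finset.mul_sum]; rfl
  have hf : ∀ v : Fin 4 → ℤ, f (cst v) = (phi G e v : ZMod l) := by
    intro v
    rw [hphi v]
    simp [f, cst]
  have hfe : f (cst e) = 2 := by rw [hf, phi_self hp he]; norm_num
  let W := LinearMap.ker f
  have hW : Module.finrank (ZMod l) W = 3 := by
    have h1 := LinearMap.finrank_range_add_finrank_ker f
    have h3 : LinearMap.range f = ⊤ := by
      rw [LinearMap.range_eq_top]
      intro c
      exact ⟨(c * (2 : ZMod l)⁻¹) • cst e, by rw [map_smul, hfe, smul_eq_mul]; field_simp⟩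
    rw [h3, finrank_top] at h1
    simp at h1
    show Module.finrank (ZMod l) (LinearMap.ker f) = 3
    omega
  obtain ⟨b, hb⟩ := LinearMap.BilinForm.exists_orthogonal_basis (B := B.restrict W)
    ⟨fun v z => hBs.eq v z⟩
  let w : Fin 3 → (Fin 4 → ZMod l) := fun i => (b (finCongr hW.symm i) : Fin 4 → ZMod l)
  have hwW : ∀ i, f (w i) = 0 := fun i => LinearMap.mem_ker.mp (b (finCongr hW.symm i)).2
  have hwo : ∀ i j, i ≠ j → B (w i) (w j) = 0 := by
    intro i j hij
    exact hb (fun h => hij ((finCongr hW.symm).injective h))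
  have hwli : LinearIndependent (ZMod l) w := by
    have h1 := (b.linearIndependent.map' W.subtype (Submodule.ker_subtype W)).comp _
      (finCongr hW.symm).injective
    exact h1
  choose wz hwz using fun i => hcs (w i)
  let M : Matrix (Fin 4) (Fin 4) ℤ := Matrix.of (Fin.cons e wz : Fin 4 → Fin 4 → ℤ)
  have hM0 : M 0 = e := rfl
  have hMs : ∀ i : Fin 3, M i.succ = wz i := fun i => rfl
  have hperp : ∀ i, B (cst e) (w i) = 0 := by
    intro i
    have h1 := phi_mul hp he (wz i)
    have h3 : ((phi G e (wz i) * Bf G e e : ℤ) : ZMod l) = ((2 * Bf G (wz i) e : ℤ) : ZMod l) := by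
      rw [h1]
    push_cast at h3
    rw [← hf, hwz, hwW, zero_mul] at h3
    rw [← hwz, hB, Bf_comm hs]
    rcases mul_eq_zero.mp h3.symm with h | h
    · exact absurd h h2
    · exact h
  refine ⟨M, hM0, ?_, ?_, ?_⟩
  · intro hdv
    have h1 : LinearIndependent (ZMod l) (Fin.cons (cst e) w : Fin 4 → Fin 4 → ZMod l) := by
      rw [linearIndependent_finCons]
      refine ⟨hwli, fun hmem => ?_⟩
      have h3 : Submodule.span (ZMod l) (Set.range w) ≤ LinearMap.ker f := by
        rw [Submodule.span_le]
        rintro _ ⟨i, rfl⟩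
        exact hwW i
      have h4 := LinearMap.mem_ker.mp (h3 hmem)
      rw [hfe] at h4
      exact h2 h4
    have h3 : (Fin.cons (cst e) w : Fin 4 → Fin 4 → ZMod l) = (M.map (Int.cast : ℤ → ZMod l)).row := by
      funext i
      refine Fin.cases ?_ (fun j => ?_) i
      · rfl
      · simp only [Fin.cons_succ]
        rw [← hwz]; rfl
    rw [h3, Matrix.linearIndependent_rows_iff_isUnit, Matrix.isUnit_iff_isUnit_det] at h1
    apply h1.ne_zero
    have h5 : (M.map (Int.cast : ℤ → ZMod l)).det = ((M.det : ℤ) : ZMod l) :=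
      ((Int.castRingHom (ZMod l)).map_det M).symm
    rw [h5]
    exact (ZMod.intCast_zmod_eq_zero_iff_dvd _ _).mpr hdv
  · intro i
    refine Fin.cases ?_ (fun j => ?_) i
    · intro h; exact absurd rfl h
    · intro _
      rw [← ZMod.intCast_zmod_eq_zero_iff_dvd, ← hf, hMs, hwz, hwW]
  · intro i j
    refine Fin.cases ?_ (fun i => ?_) i <;> refine Fin.cases ?_ (fun j => ?_) j
    · intro h; exact absurd rfl h
    · intro _
      rw [← ZMod.intCast_zmod_eq_zero_iff_dvd, ← hB, hMs, hwz, hM0, hperp]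
    · intro _
      rw [← ZMod.intCast_zmod_eq_zero_iff_dvd, Bf_comm hs, ← hB, hMs, hwz, hM0, hperp]
    · intro h
      rw [← ZMod.intCast_zmod_eq_zero_iff_dvd, ← hB, hMs, hMs, hwz, hwz]
      exact hwo i j (fun h' => h (by rw [h']))

end eightA

section nineA
variable {G : Matrix (Fin 4) (Fin 4) ℤ}

lemma gram_entry (M : Matrix (Fin 4) (Fin 4) ℤ) (i j : Fin 4) :
    (M * G * Mᵀ) i j = Bf G (M i) (M j) := by
  rw [mul_assoc, mul_apply]; simp only [Bf, dotProduct, mulVec, mul_apply, transpose_apply]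

lemma two_rows {l : ℕ} (hl : l.Prime) (hld : ¬ (l : ℤ) ^ 2 ∣ G.det)
    {M : Matrix (Fin 4) (Fin 4) ℤ} (hM : ¬ (l : ℤ) ∣ M.det)
    (ho : ∀ i j, i ≠ j → (l : ℤ) ∣ Bf G (M i) (M j)) {i j : Fin 4} (hij : i ≠ j)
    (hi : (l : ℤ) ∣ Bf G (M i) (M i)) : ¬ (l : ℤ) ∣ Bf G (M j) (M j) := by
  intro hj
  have hli := Nat.prime_iff_prime_int.mp hl
  have hrow : ∀ a b, (if a = i ∨ a = j then (l : ℤ) else 1) ∣ (M * G * Mᵀ) a b := by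
    intro a b
    split_ifs with h
    · rw [gram_entry]
      by_cases hab : a = b
      · subst hab
        rcases h with rfl | rfl
        · exact hi
        · exact hj
      · exact ho a b hab
    · exact one_dvd _
  choose N hN using hrow
  have h1 : M * G * Mᵀ = Matrix.diagonal (fun a => if a = i ∨ a = j then (l : ℤ) else 1) *
      Matrix.of N := by
    ext a b; rw [diagonal_mul, hN]; rfl
  have h2 := congrArg Matrix.det h1
  have h3 : ∏ a, (if a = i ∨ a = j then (l : ℤ) else 1) = (l : ℤ) ^ 2 := by
    rw [Fin.prod_univ_four]
    revert hij
    clear * -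
    revert i j
    intro i j
    fin_cases i <;> fin_cases j <;> simp [sq]
  rw [det_mul, det_mul, det_mul, det_transpose, det_diagonal, h3] at h2
  apply hld
  have hco : IsCoprime ((l : ℤ) ^ 2) (M.det * M.det) :=
    (((Prime.coprime_iff_not_dvd hli).mpr hM).mul_right
      ((Prime.coprime_iff_not_dvd hli).mpr hM)).pow_left
  exact hco.dvd_of_dvd_mul_left ⟨(Matrix.of N).det, by rw [← h2]; ring⟩

lemma X_Q (hs : G.IsSymm) (hp : PosDefM G) {l : ℕ} (hl : l.Prime) (hl2 : l ≠ 2)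
    (hld : ¬ (l : ℤ) ^ 2 ∣ G.det) {e : Fin 4 → ℤ} (he : IsRootM G e) :
    ∃ x y, (l : ℤ) ∣ Bf G x x ∧ ¬ (l : ℤ) ∣ Bf G x y ∧ ¬ (l : ℤ) ∣ phi G e x := by
  obtain ⟨M, hM0, hM, hMp, ho⟩ := orth_basis hs hp hl hl2 he
  have hli := Nat.prime_iff_prime_int.mp hl
  have h2 : ¬ (l : ℤ) ∣ 2 := by
    intro h
    have h' : l ∣ 2 := by exact_mod_cast h
    exact hl2 ((Nat.prime_dvd_prime_iff_eq hl Nat.prime_two).mp h')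
  have htr := fun {i j : Fin 4} (hij : i ≠ j) => two_rows hl hld hM ho hij
  have hz : ∀ i j, i ≠ j → ((Bf G (M i) (M j) : ℤ) : ZMod l) = 0 := fun i j h =>
    (ZMod.intCast_zmod_eq_zero_iff_dvd _ _).mpr (ho i j h)
  have hpe : phi G e (M 0) = 2 := by rw [hM0, phi_self hp he]
  by_cases h0 : (l : ℤ) ∣ Bf G (M 0) (M 0)
  · obtain ⟨s, t, hst⟩ := binlem hl hl2 _ _ (- Bf G (M 1) (M 1))
      (htr (show (0 : Fin 4) ≠ 2 by decide) h0) (htr (show (0 : Fin 4) ≠ 3 by decide) h0)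
    have h1 := htr (show (0 : Fin 4) ≠ 1 by decide) h0
    refine ⟨M 0 + M 1 + s • M 2 + t • M 3, M 1, ?_, ?_, ?_⟩
    · rw [← ZMod.intCast_zmod_eq_zero_iff_dvd] at hst h0 ⊢
      simp only [Bf_add_left, Bf_add_right, Bf_smul_left, Bf_smul_right]
      push_cast at hst ⊢
      simp only [h0, hz, ne_eq, Fin.reduceEq, not_false_eq_true]
      linear_combination hst
    · rw [← ZMod.intCast_zmod_eq_zero_iff_dvd] at h1 ⊢
      simp only [Bf_add_left, Bf_smul_left]
      push_cast
      simp only [hz, ne_eq, Fin.reduceEq, not_false_eq_true]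
      simpa using h1
    · simp only [phi_add hp he, phi_smul hp he, hpe]
      intro h
      apply h2
      have h3 : (l : ℤ) ∣ phi G e (M 1) + s * phi G e (M 2) + t * phi G e (M 3) :=
        dvd_add (dvd_add (hMp 1 (by decide)) ((hMp 2 (by decide)).mul_left _))
          ((hMp 3 (by decide)).mul_left _)
      have h4 := dvd_sub h h3
      ring_nf at h4
      exact h4
  · obtain ⟨i, j, hi, hj, hij, hni, hnj⟩ : ∃ i j : Fin 4, i ≠ 0 ∧ j ≠ 0 ∧ i ≠ j ∧
        ¬ (l : ℤ) ∣ Bf G (M i) (M i) ∧ ¬ (l : ℤ) ∣ Bf G (M j) (M j) := by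
      by_cases h1 : (l : ℤ) ∣ Bf G (M 1) (M 1)
      · exact ⟨2, 3, by decide, by decide, by decide, htr (by decide) h1, htr (by decide) h1⟩
      · by_cases h3 : (l : ℤ) ∣ Bf G (M 2) (M 2)
        · exact ⟨1, 3, by decide, by decide, by decide, h1, htr (by decide) h3⟩
        · exact ⟨1, 2, by decide, by decide, by decide, h1, h3⟩
    obtain ⟨s, t, hst⟩ := binlem hl hl2 _ _ (- Bf G (M 0) (M 0)) hni hnj
    refine ⟨M 0 + s • M i + t • M j, M 0, ?_, ?_, ?_⟩
    · rw [← ZMod.intCast_zmod_eq_zero_iff_dvd] at hst ⊢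
      simp only [Bf_add_left, Bf_add_right, Bf_smul_left, Bf_smul_right]
      push_cast at hst ⊢
      rw [hz 0 i hi.symm, hz 0 j hj.symm, hz i 0 hi, hz j 0 hj, hz i j hij, hz j i hij.symm]
      linear_combination hst
    · rw [← ZMod.intCast_zmod_eq_zero_iff_dvd] at h0 ⊢
      simp only [Bf_add_left, Bf_smul_left]
      push_cast
      rw [hz i 0 hi, hz j 0 hj]
      simpa using h0
    · simp only [phi_add hp he, phi_smul hp he, hpe]
      intro h
      apply h2
      have h3 : (l : ℤ) ∣ s * phi G e (M i) + t * phi G e (M j) :=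
        dvd_add ((hMp i hi).mul_left _) ((hMp j hj).mul_left _)
      have h4 := dvd_sub h h3
      ring_nf at h4
      exact h4

end nineA

section tenA
variable {G E : Matrix (Fin 4) (Fin 4) ℤ}

/-- standing hypotheses on the lattice -/
structure Ctx (G : Matrix (Fin 4) (Fin 4) ℤ) : Prop where
  hs : G.IsSymm
  hp : PosDefM G
  hsq : SquareFreeM G
  htr : TotallyReflectiveM G
  hd : 0 < G.det
  h3 : ∀ p : ℕ, p.Prime → ¬ (p : ℤ) ^ 3 ∣ G.det

lemma Ctx.basis (c : Ctx G) : ∃ E, RootBasis G E := by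
  apply exists_rootBasis
  apply c.htr G c.hs c.hp
  intro p _
  exact ⟨1, by simp, by simp⟩

lemma orth_all (hp : PosDefM G) (hE : RootBasis G E) (hs : G.IsSymm) {z : Fin 4 → ℤ}
    (h : ∀ i, Bf G z (E i) = 0) : z = 0 := by
  by_contra hz
  have h1 : E.mulVec (G.mulVec z) = 0 := by
    ext i
    have := h i
    rw [Bf_comm hs] at this
    exact this
  have h2 : G.mulVec z = 0 := by
    by_contra h3
    exact hE.1 (Matrix.exists_mulVec_eq_zero_iff.mp ⟨_, h3, h1⟩)
  have h3 := hp z hz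
  rw [Bf, h2] at h3
  simp at h3

lemma NV.other (hs : G.IsSymm) (hp : PosDefM G) (hE : RootBasis G E) {l : ℕ} {x w : Fin 4 → ℤ} {m : ℤ}
    (h : NV G l x w m) (k : Fin 4) (hk : ∀ i, i ≠ k → CC G E i k = 0)
    (hx : ¬ (l : ℤ) ∣ phi G (E k) x) : ∃ i, i ≠ k ∧ Bf G w (E i) ≠ 0 := by
  by_contra hcon
  push Not at hcon
  obtain ⟨hm, hw, hd, hQ⟩ := h
  have hn := nn_pos hp hE k
  have hz : (nn G E k) • w - (Bf G w (E k)) • E k = 0 := by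
    apply orth_all hp hE hs
    intro i
    rw [Bf_sub_left, Bf_smul_left, Bf_smul_left]
    by_cases hi : i = k
    · subst hi; rw [nn]; ring
    · rw [hcon i hi, (CC_zero_iff hp hE i k).mp (hk i hi)]; ring
  have h1 := sub_eq_zero.mp hz
  obtain ⟨s, hs'⟩ := prim_dvd (hE.2 k).2.1 hn.ne' h1
  apply hQ (E k) (hE.2 k) hx s
  rw [hs', mul_smul] at h1
  exact smul_right_injective _ hn.ne' h1

lemma exists_unique_of_count {P : Fin 4 → Prop} [DecidablePred P]
    (h1 : 1 ≤ ∑ i, if P i then 1 else 0) (h2 : ¬ 2 ≤ ∑ i, if P i then 1 else 0) :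
    ∃ k, P k ∧ ∀ i, i ≠ k → ¬ P i := by
  rw [Fin.sum_univ_four] at h1 h2
  by_cases h0 : P 0 <;> by_cases h1' : P 1 <;> by_cases h2' : P 2 <;> by_cases h3 : P 3 <;>
    simp [h0, h1', h2', h3] at h1 h2
  · exact ⟨0, h0, fun i hi => by fin_cases i <;> simp_all⟩
  · exact ⟨1, h1', fun i hi => by fin_cases i <;> simp_all⟩
  · exact ⟨2, h2', fun i hi => by fin_cases i <;> simp_all⟩
  · exact ⟨3, h3, fun i hi => by fin_cases i <;> simp_all⟩

lemma le_of_cc {n m : ℤ} (hn : 0 < n) (hm : 0 < m) {p b : ℕ} (hp : p.Prime)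
    (h : ¬ ((p : ℤ) ∣ n ↔ (p : ℤ) ∣ m)) (hb : cc n m ≤ b) : p ≤ b :=
  (Nat.le_of_dvd (cc_pos hn hm) (cc_dvd hp h)).trans hb

/-- primes dividing the determinant exactly once -/
lemma Ctx.lemQ (c : Ctx G) {l q : ℕ} (hl : l.Prime) (hl2 : l ≠ 2) (hld : ¬ (l : ℤ) ^ 2 ∣ G.det)
    (hq : q.Prime) (h17 : 17 ≤ q) (hqd : (q : ℤ) ∣ G.det) (hq2 : ¬ (q : ℤ) ^ 2 ∣ G.det) :
    q ≤ 4 * l ^ 2 := by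
  obtain ⟨hs, hp, hsq, htr, hd, h3⟩ := c
  obtain ⟨E, hE⟩ := Ctx.basis ⟨hs, hp, hsq, htr, hd, h3⟩
  have hC := not_dvd_CC17 hs hp hE hd h17
  have hce := count_eq hp hsq hE hq (by omega) hC
  obtain ⟨k, hk, hko⟩ := exists_unique_of_count ((hce 1).mp (by simpa using hqd))
    (fun h => hq2 ((hce 2).mpr h))
  have hcz : ∀ i, i ≠ k → CC G E i k = 0 := fun i hi =>
    cross_zero hs hp hE hq (by omega) (by simp [hk, hko i hi])
  obtain ⟨x, y, hxx, hxy, hxe⟩ := X_Q hs hp hl hl2 hld (hE.2 k)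
  obtain ⟨⟨w, m, hN, hqm⟩, -⟩ := nbr_NV hs hp hsq htr hd hl hl2 x y hxx hxy hq h17 hqd (h3 q hq)
  obtain ⟨i, hi, hti⟩ := hN.other hs hp hE k hcz hxe
  exact le_of_cc (nn_pos hp hE i) hN.1 hq (by simp [hko i hi, hqm]) (hN.cc_le hs hp (hE.2 i) hti)

/-- pair construction -/
lemma Ctx.pair (c : Ctx G) (hE : RootBasis G E) {l : ℕ} (hl : l.Prime) (hl5 : 5 ≤ l)
    {p₀ : ℕ} (hp0 : p₀.Prime) (h17 : 17 ≤ p₀) (hpd : (p₀ : ℤ) ∣ G.det)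
    (h02 : CC G E 0 2 = 0) (h03 : CC G E 0 3 = 0) (h12 : CC G E 1 2 = 0) (h13 : CC G E 1 3 = 0)
    (hn0 : ¬ (l : ℤ) ∣ nn G E 0) (hn1 : ¬ (l : ℤ) ∣ nn G E 1) (a b : ℤ)
    (hw : ¬ (l : ℤ) ∣ Bf G (a • E 2 + b • E 3) (a • E 2 + b • E 3)) :
    ∃ m : ℤ, 0 < m ∧ (cc (nn G E 0) m ≤ 4 * l ^ 2 ∨ cc (nn G E 1) m ≤ 4 * l ^ 2) ∧
      (¬ (l : ℤ) ∣ phi G (E 2) (a • E 2 + b • E 3) → cc (nn G E 2) m ≤ 4 * l ^ 2) ∧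
      (¬ (l : ℤ) ∣ phi G (E 3) (a • E 2 + b • E 3) → cc (nn G E 3) m ≤ 4 * l ^ 2) := by
  obtain ⟨hs, hp, hsq, htr, hd, h3⟩ := c
  have hli := Nat.prime_iff_prime_int.mp hl
  have hl2 : l ≠ 2 := by omega
  set w := a • E 2 + b • E 3 with hwdef
  have k02 := (CC_zero_iff hp hE 0 2).mp h02
  have k03 := (CC_zero_iff hp hE 0 3).mp h03
  have k12 := (CC_zero_iff hp hE 1 2).mp h12
  have k13 := (CC_zero_iff hp hE 1 3).mp h13
  have hw0 : Bf G w (E 0) = 0 := by rw [hwdef, Bf_add_left, Bf_smul_left, Bf_smul_left, k02, k03]; ring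
  have hw1 : Bf G w (E 1) = 0 := by rw [hwdef, Bf_add_left, Bf_smul_left, Bf_smul_left, k12, k13]; ring
  clear_value w
  have hw0' : Bf G (E 0) w = 0 := by rw [Bf_comm hs, hw0]
  have hw1' : Bf G (E 1) w = 0 := by rw [Bf_comm hs, hw1]
  set β := Bf G (E 0) (E 1) with hβ
  have hβ' : Bf G (E 1) (E 0) = β := Bf_comm hs _ _
  have c01 := CC_mul hp hE 0 1
  have c10 := CC_mul hp hE 1 0
  have hk := CC_prod_lt hs hp hE (show (0 : Fin 4) ≠ 1 by decide)
  have hdisc : ¬ (l : ℤ) ∣ nn G E 0 * nn G E 1 - β ^ 2 := by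
    intro h
    have h4 : (l : ℤ) ∣ (4 - CC G E 0 1 * CC G E 1 0) * (nn G E 0 * nn G E 1) := by
      have : (4 - CC G E 0 1 * CC G E 1 0) * (nn G E 0 * nn G E 1) =
          4 * (nn G E 0 * nn G E 1 - β ^ 2) := by
        rw [hβ'] at c01
        rw [← hβ] at c10
        linear_combination (-CC G E 1 0 * nn G E 1) * c01 - (2 * β) * c10
      rw [this]; exact h.mul_left _
    rcases hli.dvd_or_dvd h4 with h | h
    · exact small_not_dvd hl5 (by linarith) (by linarith) h
    · rcases hli.dvd_or_dvd h with h | h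
      · exact hn0 h
      · exact hn1 h
  have h1l : ¬ (l : ℤ) ∣ 1 := small_not_dvd hl5 (by norm_num) (by norm_num)
  obtain ⟨X, t, hXt⟩ := binlem hl hl2 1 _ (- (nn G E 0 * Bf G w w)) h1l hdisc
  obtain ⟨u0, v0, huv⟩ := (Prime.coprime_iff_not_dvd hli).mpr hn0
  set s := v0 * (X - β * t) with hsdef
  set u := s • E 0 + t • E 1 with hu
  clear_value u
  have hns : nn G E 0 * s + β * t = X + l * (-u0 * (X - β * t)) := by
    rw [hsdef]; linear_combination (X - β * t) * huv
  have huu : Bf G u u = nn G E 0 * s ^ 2 + 2 * β * s * t + nn G E 1 * t ^ 2 := by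
    rw [hu]
    simp only [Bf_add_left, Bf_add_right, Bf_smul_left, Bf_smul_right, hβ', nn, ← hβ]; ring
  have hsum : (l : ℤ) ∣ Bf G u u + Bf G w w := by
    have h4 : (l : ℤ) ∣ nn G E 0 * (Bf G u u + Bf G w w) := by
      have : nn G E 0 * (Bf G u u + Bf G w w) = (nn G E 0 * s + β * t) ^ 2 +
          (nn G E 0 * nn G E 1 - β ^ 2) * t ^ 2 + nn G E 0 * Bf G w w := by rw [huu]; ring
      rw [this, hns]
      obtain ⟨r, hr⟩ := hXt
      exact ⟨r + 2 * X * (-u0 * (X - β * t)) + l * (-u0 * (X - β * t)) ^ 2, by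
        linear_combination hr⟩
    exact (hli.dvd_or_dvd h4).resolve_left hn0
  have hb0 : Bf G (w + u) (E 0) = s * nn G E 0 + t * β := by
    rw [Bf_add_left, hw0, hu, Bf_add_left, Bf_smul_left, Bf_smul_left, hβ', nn]; ring
  have hb1 : Bf G (w + u) (E 1) = s * β + t * nn G E 1 := by
    rw [Bf_add_left, hw1, hu, Bf_add_left, Bf_smul_left, Bf_smul_left, nn]; ring
  have hwu : Bf G w u = 0 := by
    rw [hu, Bf_add_right, Bf_smul_right, Bf_smul_right, hw0, hw1]; ring
  have huw : Bf G u w = 0 := by rw [Bf_comm hs, hwu]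
  have hxx : (l : ℤ) ∣ Bf G (w + u) (w + u) := by
    rw [Bf_add_left, Bf_add_right, Bf_add_right, hwu, huw]
    convert hsum using 1; ring
  have hor : ¬ (l : ℤ) ∣ Bf G (w + u) (E 0) ∨ ¬ (l : ℤ) ∣ Bf G (w + u) (E 1) := by
    by_contra hcon
    push Not at hcon
    rw [hb0, hb1] at hcon
    apply hw
    have h4 : (l : ℤ) ∣ Bf G u u := by
      have : Bf G u u = s * (s * nn G E 0 + t * β) + t * (s * β + t * nn G E 1) := by rw [huu]; ring
      rw [this]
      exact dvd_add (hcon.1.mul_left _) (hcon.2.mul_left _)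
    exact (dvd_add_right h4).mp hsum
  have hphib : ∀ i, ¬ (l : ℤ) ∣ Bf G (w + u) (E i) → ¬ (l : ℤ) ∣ phi G (E i) (w + u) := by
    intro i hi h
    have h4 : (l : ℤ) ∣ 2 * Bf G (w + u) (E i) := by
      rw [← phi_mul hp (hE.2 i)]; exact h.mul_right _
    rcases hli.dvd_or_dvd h4 with h | h
    · exact small_not_dvd hl5 (by norm_num) (by norm_num) h
    · exact hi h
  have hphi2 : ∀ i, CC G E i 0 = 0 → CC G E i 1 = 0 → phi G (E i) (w + u) = phi G (E i) w := by
    intro i h0 h1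
    have h0' : phi G (E i) (E 0) = 0 := h0
    have h1' : phi G (E i) (E 1) = 0 := h1
    rw [phi_add hp (hE.2 i), hu, phi_add hp (hE.2 i), phi_smul hp (hE.2 i), phi_smul hp (hE.2 i),
      h0', h1']; ring
  obtain ⟨y, hy⟩ : ∃ y, ¬ (l : ℤ) ∣ Bf G (w + u) y := by
    rcases hor with h | h
    · exact ⟨_, h⟩
    · exact ⟨_, h⟩
  obtain ⟨-, hN⟩ := nbr_NV hs hp hsq htr hd hl hl2 (w + u) y hxx hy hp0 h17 hpd (h3 p₀ hp0)
  obtain ⟨w', m, hN, hNe⟩ := hN hl5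
  have fin : ∀ i, ¬ (l : ℤ) ∣ phi G (E i) (w + u) → cc (nn G E i) m ≤ 4 * l ^ 2 := fun i hi =>
    hN.cc_le hs hp (hE.2 i) (hNe _ (hE.2 i) hi)
  refine ⟨m, hN.1, ?_, ?_, ?_⟩
  · rcases hor with h | h
    · exact Or.inl (fin 0 (hphib 0 h))
    · exact Or.inr (fin 1 (hphib 1 h))
  · intro h
    apply fin 2
    rwa [hphi2 2 ((CC_zero_symm hs hp hE _ _).mp h02) ((CC_zero_symm hs hp hE _ _).mp h12)]
  · intro h
    apply fin 3
    rwa [hphi2 3 ((CC_zero_symm hs hp hE _ _).mp h03) ((CC_zero_symm hs hp hE _ _).mp h13)]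

end tenA

section elevenA
variable {G E : Matrix (Fin 4) (Fin 4) ℤ}

lemma perm_two_bool : ∀ f : Fin 4 → Bool, (∑ i, if f i = true then 1 else 0) = 2 →
    ∃ σ : Equiv.Perm (Fin 4), f (σ 0) = true ∧ f (σ 1) = true ∧ f (σ 2) = false ∧ f (σ 3) = false := by
  decide

lemma perm_two {P : Fin 4 → Prop} [DecidablePred P]
    (h1 : 2 ≤ ∑ i, if P i then 1 else 0) (h2 : ¬ 3 ≤ ∑ i, if P i then 1 else 0) :
    ∃ σ : Equiv.Perm (Fin 4), P (σ 0) ∧ P (σ 1) ∧ ¬ P (σ 2) ∧ ¬ P (σ 3) := by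
  obtain ⟨σ, h⟩ := perm_two_bool (fun i => decide (P i)) (by
    simp only [decide_eq_true_eq]; omega)
  exact ⟨σ, by simpa using h⟩

lemma at_most_one {P : Fin 4 → Prop} [DecidablePred P]
    (h2 : ¬ 2 ≤ ∑ i, if P i then 1 else 0) {i j : Fin 4} (hij : i ≠ j) (hi : P i) : ¬ P j := by
  intro hj
  apply h2
  rw [← Finset.sum_filter]
  have : ({i, j} : Finset (Fin 4)) ⊆ Finset.univ.filter P := by
    intro k hk
    simp only [Finset.mem_insert, Finset.mem_singleton] at hk
    rcases hk with rfl | rfl <;> simp [hi, hj]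
  have h3 := Finset.card_le_card this
  rw [Finset.card_pair hij] at h3
  simpa using h3

lemma phi_two (hp : PosDefM G) (hE : RootBasis G E) (i j : Fin 4) (a b : ℤ) :
    phi G (E i) (a • E i + b • E j) = 2 * a + b * CC G E i j := by
  rw [phi_add hp (hE.2 i), phi_smul hp (hE.2 i), phi_smul hp (hE.2 i), phi_self hp (hE.2 i)]
  simp only [CC, of_apply]; ring

lemma Bf_single2 (i j : Fin 4) : Bf G ((1 : ℤ) • E i + (0 : ℤ) • E j) ((1 : ℤ) • E i + (0 : ℤ) • E j)
    = nn G E i := by simp [nn]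

lemma Bf_single3 (i j : Fin 4) : Bf G ((0 : ℤ) • E i + (1 : ℤ) • E j) ((0 : ℤ) • E i + (1 : ℤ) • E j)
    = nn G E j := by simp [nn]

lemma Ctx.lem5 (c : Ctx G) {l p : ℕ} (hl : l.Prime) (hl5 : 5 ≤ l) (hld : ¬ (l : ℤ) ^ 2 ∣ G.det)
    (hpp : p.Prime) (h17 : 17 ≤ p) (hpd : (p : ℤ) ^ 2 ∣ G.det) : p ≤ 4 * l ^ 2 := by
  have hpd1 : (p : ℤ) ∣ G.det := (dvd_pow_self _ (by norm_num)).trans hpd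
  have hkey : ∀ E, RootBasis G E → ¬ (l : ℤ) ∣ nn G E 0 → ¬ (l : ℤ) ∣ nn G E 1 →
      (¬ (l : ℤ) ∣ nn G E 2 ∨ ¬ (l : ℤ) ∣ nn G E 3) →
      ((p : ℤ) ∣ nn G E 0 ↔ (p : ℤ) ∣ nn G E 1) → ((p : ℤ) ∣ nn G E 2 ↔ (p : ℤ) ∣ nn G E 3) →
      ¬ ((p : ℤ) ∣ nn G E 0 ↔ (p : ℤ) ∣ nn G E 2) → p ≤ 4 * l ^ 2 := by
    intro E hE h0 h1 h23 e01 e23 e02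
    have cz : ∀ i j, ¬ ((p : ℤ) ∣ nn G E i ↔ (p : ℤ) ∣ nn G E j) → CC G E i j = 0 := fun i j h =>
      cross_zero c.hs c.hp hE hpp (by omega) h
    have e03 : ¬ ((p : ℤ) ∣ nn G E 0 ↔ (p : ℤ) ∣ nn G E 3) := by rw [← e23]; exact e02
    have e12 : ¬ ((p : ℤ) ∣ nn G E 1 ↔ (p : ℤ) ∣ nn G E 2) := by rw [← e01]; exact e02
    have e13 : ¬ ((p : ℤ) ∣ nn G E 1 ↔ (p : ℤ) ∣ nn G E 3) := by rw [← e01]; exact e03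
    have hpair := c.pair hE hl hl5 hpp h17 hpd1 (cz _ _ e02) (cz _ _ e03) (cz _ _ e12) (cz _ _ e13) h0 h1
    have h2l : ¬ (l : ℤ) ∣ 2 := small_not_dvd hl5 (by norm_num) (by norm_num)
    have fin : ∀ (m : ℤ) (i j : Fin 4), 0 < m → ¬ ((p : ℤ) ∣ nn G E i ↔ (p : ℤ) ∣ nn G E j) →
        cc (nn G E i) m ≤ 4 * l ^ 2 → cc (nn G E j) m ≤ 4 * l ^ 2 → p ≤ 4 * l ^ 2 := by
      intro m i j hm hij hi hj
      by_cases h : (p : ℤ) ∣ nn G E i ↔ (p : ℤ) ∣ m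
      · exact le_of_cc (nn_pos c.hp hE j) hm hpp (fun h' => hij (h.trans h'.symm)) hj
      · exact le_of_cc (nn_pos c.hp hE i) hm hpp h hi
    rcases h23 with h2 | h3
    · obtain ⟨m, hm, h01, hc2, -⟩ := hpair 1 0 (by rw [Bf_single2]; exact h2)
      have hc2' := hc2 (by rw [phi_two c.hp hE]; simpa using h2l)
      rcases h01 with h | h
      · exact fin m 0 2 hm e02 h hc2'
      · exact fin m 1 2 hm e12 h hc2'
    · obtain ⟨m, hm, h01, -, hc3⟩ := hpair 0 1 (by rw [Bf_single3]; exact h3)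
      have hc3' := hc3 (by rw [add_comm, phi_two c.hp hE]; simpa using h2l)
      rcases h01 with h | h
      · exact fin m 0 3 hm e03 h hc3'
      · exact fin m 1 3 hm e13 h hc3'
  obtain ⟨E, hE⟩ := c.basis
  have hC := not_dvd_CC17 c.hs c.hp hE c.hd h17
  have hce := count_eq c.hp c.hsq hE hpp (by omega) hC
  obtain ⟨σ, h0, h1, h2, h3⟩ := perm_two ((hce 2).mp hpd) (fun h => c.h3 p hpp ((hce 3).mpr h))
  have hCl := not_dvd_CC c.hs c.hp hE c.hd hpp h17 hpd1 (c.h3 p hpp) hl hl5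
  have hcl := count_eq c.hp c.hsq hE hl (by omega) hCl
  have hone : ∀ i j, i ≠ j → (l : ℤ) ∣ nn G E (σ i) → ¬ (l : ℤ) ∣ nn G E (σ j) := fun i j hij =>
    at_most_one (fun h => hld ((hcl 2).mpr h)) (fun h => hij (σ.injective h))
  by_cases hcase : (l : ℤ) ∣ nn G E (σ 0) ∨ (l : ℤ) ∣ nn G E (σ 1)
  · have hall : ¬ (l : ℤ) ∣ nn G E (σ 2) ∧ ¬ (l : ℤ) ∣ nn G E (σ 3) := by
      rcases hcase with h | h
      · exact ⟨hone 0 2 (by decide) h, hone 0 3 (by decide) h⟩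
      · exact ⟨hone 1 2 (by decide) h, hone 1 3 (by decide) h⟩
    let τ : Equiv.Perm (Fin 4) := Equiv.addRight 2
    refine hkey (E.submatrix (τ.trans σ) id) (hE.perm _) ?_ ?_ ?_ ?_ ?_ ?_
    · exact hall.1
    · exact hall.2
    · show ¬ (l : ℤ) ∣ nn G E (σ 0) ∨ ¬ (l : ℤ) ∣ nn G E (σ 1)
      by_contra h; push Not at h
      exact hone 0 1 (by decide) h.1 h.2
    · show (p : ℤ) ∣ nn G E (σ 2) ↔ (p : ℤ) ∣ nn G E (σ 3)
      exact iff_of_false h2 h3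
    · show (p : ℤ) ∣ nn G E (σ 0) ↔ (p : ℤ) ∣ nn G E (σ 1)
      exact iff_of_true h0 h1
    · show ¬ ((p : ℤ) ∣ nn G E (σ 2) ↔ (p : ℤ) ∣ nn G E (σ 0))
      exact fun h => h2 (h.mpr h0)
  · push Not at hcase
    refine hkey (E.submatrix σ id) (hE.perm _) hcase.1 hcase.2 ?_ ?_ ?_ ?_
    · show ¬ (l : ℤ) ∣ nn G E (σ 2) ∨ ¬ (l : ℤ) ∣ nn G E (σ 3)
      by_contra h; push Not at h
      exact hone 2 3 (by decide) h.1 h.2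
    · show (p : ℤ) ∣ nn G E (σ 0) ↔ (p : ℤ) ∣ nn G E (σ 1)
      exact iff_of_true h0 h1
    · show (p : ℤ) ∣ nn G E (σ 2) ↔ (p : ℤ) ∣ nn G E (σ 3)
      exact iff_of_false h2 h3
    · show ¬ ((p : ℤ) ∣ nn G E (σ 0) ↔ (p : ℤ) ∣ nn G E (σ 2))
      exact fun h => h2 (h.mp h0)

/-- graph classification -/
def adj6 (a b c d e f : Bool) : Fin 4 → Fin 4 → Bool := ![![false, a, b, c], ![a, false, d, e],
  ![b, d, false, f], ![c, e, f, false]]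

def shapeB (g : Fin 4 → Fin 4 → Bool) : Bool :=
  (!g 0 1 && !g 0 2 && !g 0 3 && !g 1 2 && !g 1 3 && !g 2 3) ||
  (g 0 1 && !g 0 2 && !g 0 3 && !g 1 2 && !g 1 3 && !g 2 3) ||
  (g 0 1 && !g 0 2 && !g 0 3 && !g 1 2 && !g 1 3 && g 2 3) ||
  (g 0 1 && g 1 2 && !g 0 3 && !g 1 3 && !g 2 3)

lemma shape1 : ∀ d e f : Bool, ∃ σ : Equiv.Perm (Fin 4),
    shapeB (fun i j => adj6 false false false d e f (σ i) (σ j)) = true := by decide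

lemma shape2 : ∀ a f : Bool, ∃ σ : Equiv.Perm (Fin 4),
    shapeB (fun i j => adj6 a false false false false f (σ i) (σ j)) = true := by decide

lemma Ctx.classify (c : Ctx G) {p₀ : ℕ} (hp0 : p₀.Prime) (h17 : 17 ≤ p₀) (hpd : (p₀ : ℤ) ∣ G.det) :
    ∃ E, RootBasis G E ∧ ∀ g : Fin 4 → Fin 4 → Prop, g = (fun i j => CC G E i j ≠ 0) →
      ((¬ g 0 1 ∧ ¬ g 0 2 ∧ ¬ g 0 3 ∧ ¬ g 1 2 ∧ ¬ g 1 3 ∧ ¬ g 2 3) ∨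
       (g 0 1 ∧ ¬ g 0 2 ∧ ¬ g 0 3 ∧ ¬ g 1 2 ∧ ¬ g 1 3 ∧ ¬ g 2 3) ∨
       (g 0 1 ∧ ¬ g 0 2 ∧ ¬ g 0 3 ∧ ¬ g 1 2 ∧ ¬ g 1 3 ∧ g 2 3) ∨
       (g 0 1 ∧ g 1 2 ∧ ¬ g 0 3 ∧ ¬ g 1 3 ∧ ¬ g 2 3)) := by
  obtain ⟨E, hE⟩ := c.basis
  have hsp := split_exists c.hs c.hp hE c.hd hp0 h17 hpd (c.h3 _ hp0)
  obtain ⟨σ, hσ⟩ := split_shape (fun i => decide ((p₀ : ℤ) ∣ nn G E i))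
    (by simpa using hsp.1) (by simpa using hsp.2)
  have cz : ∀ i j, decide ((p₀ : ℤ) ∣ nn G E (σ i)) ≠ decide ((p₀ : ℤ) ∣ nn G E (σ j)) →
      CC G E (σ i) (σ j) = 0 := fun i j h =>
    cross_zero c.hs c.hp hE hp0 (by omega) (fun h' => h (by simp [h']))
  have hE1 := hE.perm σ
  set E1 := E.submatrix σ id
  have key : ∃ τ : Equiv.Perm (Fin 4), shapeB (fun i j => decide (CC G E1 (τ i) (τ j) ≠ 0)) = true := by
    have hdiag : ∀ τ : Equiv.Perm (Fin 4), ∀ g : Fin 4 → Fin 4 → Bool,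
        (∀ i j, i ≠ j → g i j = decide (CC G E1 i j ≠ 0)) →
        shapeB (fun i j => g (τ i) (τ j)) = true →
        shapeB (fun i j => decide (CC G E1 (τ i) (τ j) ≠ 0)) = true := by
      intro τ g hg h
      have hh : ∀ i j, i ≠ j → g (τ i) (τ j) = decide (CC G E1 (τ i) (τ j) ≠ 0) := fun i j hij =>
        hg _ _ (fun h => hij (τ.injective h))
      unfold shapeB at h ⊢
      beta_reduce at h ⊢
      rw [hh 0 1 (by decide), hh 0 2 (by decide), hh 0 3 (by decide), hh 1 2 (by decide),
        hh 1 3 (by decide), hh 2 3 (by decide)] at h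
      exact h
    have hsy : ∀ i j, CC G E1 i j = 0 ↔ CC G E1 j i = 0 := CC_zero_symm c.hs c.hp hE1
    rcases hσ with ⟨h1, h2, h3⟩ | ⟨h1, h2, h3, h4⟩
    · have z1 : CC G E1 0 1 = 0 := cz 0 1 h1
      have z2 : CC G E1 0 2 = 0 := cz 0 2 h2
      have z3 : CC G E1 0 3 = 0 := cz 0 3 h3
      obtain ⟨τ, hτ⟩ := shape1 (decide (CC G E1 1 2 ≠ 0)) (decide (CC G E1 1 3 ≠ 0))
        (decide (CC G E1 2 3 ≠ 0))
      refine ⟨τ, hdiag τ _ ?_ hτ⟩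
      intro i j hij
      have y1 := (hsy 0 1).mp z1
      have y2 := (hsy 0 2).mp z2
      have y3 := (hsy 0 3).mp z3
      fin_cases i <;> fin_cases j <;> simp [adj6, z1, z2, z3, y1, y2, y3] at hij ⊢
      · rw [hsy 1 2]
      · rw [hsy 1 3]
      · rw [hsy 2 3]
    · have z1 : CC G E1 0 2 = 0 := cz 0 2 h1
      have z2 : CC G E1 0 3 = 0 := cz 0 3 h2
      have z3 : CC G E1 1 2 = 0 := cz 1 2 h3
      have z4 : CC G E1 1 3 = 0 := cz 1 3 h4
      obtain ⟨τ, hτ⟩ := shape2 (decide (CC G E1 0 1 ≠ 0)) (decide (CC G E1 2 3 ≠ 0))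
      refine ⟨τ, hdiag τ _ ?_ hτ⟩
      intro i j hij
      have y1 := (hsy 0 2).mp z1
      have y2 := (hsy 0 3).mp z2
      have y3 := (hsy 1 2).mp z3
      have y4 := (hsy 1 3).mp z4
      fin_cases i <;> fin_cases j <;> simp [adj6, z1, z2, z3, z4, y1, y2, y3, y4] at hij ⊢
      · rw [hsy 0 1]
      · rw [hsy 2 3]
  obtain ⟨τ, hτ⟩ := key
  refine ⟨E1.submatrix τ id, hE1.perm τ, ?_⟩
  intro g hg
  have hgg : ∀ i j, g i j ↔ CC G E1 (τ i) (τ j) ≠ 0 := by intro i j; rw [hg]; rfl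
  simp only [hgg]
  simp only [shapeB, Bool.or_eq_true, Bool.and_eq_true, Bool.not_eq_true', decide_eq_true_eq,
    decide_eq_false_iff_not, and_assoc, or_assoc] at hτ
  exact hτ

end elevenA

section twelveA
variable {G E : Matrix (Fin 4) (Fin 4) ℤ}

lemma logic_two {a : Fin 4 → Prop} [DecidablePred a] {M d1 d3 d4 : Prop}
    (h2 : 2 ≤ ∑ i, if a i then 1 else 0) (h3 : ¬ 3 ≤ ∑ i, if a i then 1 else 0)
    (e : a 0 ↔ a 1) (k1 : ¬ (a 0 ↔ M) → d1) (k3 : ¬ (a 2 ↔ M) → d3) (k4 : ¬ (a 3 ↔ M) → d4) :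
    d1 ∨ (d3 ∧ d4) := by
  rw [Fin.sum_univ_four] at h2 h3
  by_cases h0 : a 0 <;> by_cases h2' : a 2 <;> by_cases h3' : a 3 <;>
    simp [h0, h2', h3', e.symm] at h2 h3 <;> by_cases hM : M <;> simp_all

lemma logic_two' {a : Fin 4 → Prop} [DecidablePred a] {M d1 d3 : Prop}
    (h2 : 2 ≤ ∑ i, if a i then 1 else 0) (h3 : ¬ 3 ≤ ∑ i, if a i then 1 else 0)
    (e : a 0 ↔ a 1) (e' : a 2 ↔ a 3) (k1 : ¬ (a 0 ↔ M) → d1) (k3 : ¬ (a 2 ↔ M) → d3) :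
    d1 ∨ d3 := by
  rw [Fin.sum_univ_four] at h2 h3
  by_cases h0 : a 0 <;> by_cases h2' : a 2 <;>
    simp [h0, h2', e.symm, e'.symm] at h2 h3 <;> by_cases hM : M <;> simp_all

lemma logic_one {a : Fin 4 → Prop} [DecidablePred a] {M d3 d4 : Prop}
    (h1 : 1 ≤ ∑ i, if a i then 1 else 0) (h2 : ¬ 2 ≤ ∑ i, if a i then 1 else 0)
    (e : a 0 ↔ a 1) (k3 : ¬ (a 2 ↔ M) → d3) (k4 : ¬ (a 3 ↔ M) → d4) :
    d3 ∨ d4 := by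
  rw [Fin.sum_univ_four] at h1 h2
  by_cases h0 : a 0 <;> by_cases h2' : a 2 <;> by_cases h3' : a 3 <;>
    simp [h0, h2', h3', e.symm] at h1 h2 <;> by_cases hM : M <;> simp_all

lemma logic_one' {a : Fin 4 → Prop} [DecidablePred a]
    (h1 : 1 ≤ ∑ i, if a i then 1 else 0) (h2 : ¬ 2 ≤ ∑ i, if a i then 1 else 0)
    (e : a 0 ↔ a 1) (e' : a 2 ↔ a 3) : False := by
  rw [Fin.sum_univ_four] at h1 h2
  by_cases h0 : a 0 <;> by_cases h2' : a 2 <;>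
    simp [h0, h2', e.symm, e'.symm] at h1 h2

lemma logic_three {a : Fin 4 → Prop} [DecidablePred a]
    (h2 : 2 ≤ ∑ i, if a i then 1 else 0) (h3 : ¬ 3 ≤ ∑ i, if a i then 1 else 0)
    (e : a 0 ↔ a 1) (e' : a 1 ↔ a 2) : False := by
  rw [Fin.sum_univ_four] at h2 h3
  by_cases h0 : a 0 <;> by_cases h3' : a 3 <;>
    simp [h0, h3', e.symm, (e.trans e').symm] at h2 h3

lemma logic_three' {a : Fin 4 → Prop} [DecidablePred a]
    (h1 : 1 ≤ ∑ i, if a i then 1 else 0) (h2 : ¬ 2 ≤ ∑ i, if a i then 1 else 0)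
    (e : a 0 ↔ a 1) (e' : a 1 ↔ a 2) : a 3 ∧ ¬ a 0 ∧ ¬ a 1 ∧ ¬ a 2 := by
  rw [Fin.sum_univ_four] at h1 h2
  by_cases h0 : a 0 <;> by_cases h3' : a 3 <;>
    simp [h0, h3', e.symm, (e.trans e').symm] at h1 h2 ⊢

/-- output in the non diagonal case -/
def TB (G : Matrix (Fin 4) (Fin 4) ℤ) (l : ℕ) : Prop :=
  ∃ c1 c3 c4 : ℕ, (0 < c1 ∧ c1 ≤ 4 * l ^ 2) ∧ (0 < c3 ∧ c3 ≤ 4 * l ^ 2) ∧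
    (0 < c4 ∧ c4 ≤ 4 * l ^ 2) ∧
    (∀ p : ℕ, p.Prime → 5 ≤ p → (p : ℤ) ^ 2 ∣ G.det → p ∣ c1 ∨ (p ∣ c3 ∧ p ∣ c4)) ∧
    (∀ q : ℕ, q.Prime → 5 ≤ q → (q : ℤ) ∣ G.det → ¬ (q : ℤ) ^ 2 ∣ G.det → q ∣ c3 ∨ q ∣ c4)

lemma edge_iff (hs : G.IsSymm) (hp : PosDefM G) (hE : RootBasis G E) {p : ℕ} (hpp : p.Prime)
    (h5 : 5 ≤ p) {i j : Fin 4} (hij : CC G E i j ≠ 0) : (p : ℤ) ∣ nn G E i ↔ (p : ℤ) ∣ nn G E j :=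
  ⟨edge_dvd hs hp hE hpp h5 hij,
    edge_dvd hs hp hE hpp h5 (fun h => hij ((CC_zero_symm hs hp hE i j).mpr h))⟩

lemma Ctx.tb1 (c : Ctx G) (hE : RootBasis G E) {l : ℕ} (hl : l.Prime) (hl5 : 5 ≤ l)
    (hld : ¬ (l : ℤ) ^ 2 ∣ G.det)
    {p₀ : ℕ} (hp0 : p₀.Prime) (h17 : 17 ≤ p₀) (hpd : (p₀ : ℤ) ∣ G.det) (h01 : CC G E 0 1 ≠ 0)
    (h02 : CC G E 0 2 = 0) (h03 : CC G E 0 3 = 0) (h12 : CC G E 1 2 = 0) (h13 : CC G E 1 3 = 0) :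
    TB G l := by
  obtain ⟨hs, hp, hsq, htr, hd, h3⟩ := id c
  have hC : ∀ p : ℕ, p.Prime → 5 ≤ p → ∀ k, (p : ℤ) ^ k ∣ G.det ↔
      k ≤ ∑ i, if (p : ℤ) ∣ nn G E i then 1 else 0 := fun p hpp h5 =>
    count_eq hp hsq hE hpp (by omega) (not_dvd_CC hs hp hE hd hp0 h17 hpd (h3 _ hp0) hpp h5)
  have hli := Nat.prime_iff_prime_int.mp hl
  have hone : ∀ i j, i ≠ j → (l : ℤ) ∣ nn G E i → ¬ (l : ℤ) ∣ nn G E j := fun i j hij =>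
    at_most_one (fun h => hld ((hC l hl hl5 2).mpr h)) hij
  have e01 : ∀ p : ℕ, p.Prime → 5 ≤ p → ((p : ℤ) ∣ nn G E 0 ↔ (p : ℤ) ∣ nn G E 1) :=
    fun p hpp h5 => edge_iff hs hp hE hpp h5 h01
  have hn0 : ¬ (l : ℤ) ∣ nn G E 0 := fun h => hone 0 1 (by decide) h ((e01 l hl hl5).mp h)
  have hn1 : ¬ (l : ℤ) ∣ nn G E 1 := fun h => hn0 ((e01 l hl hl5).mpr h)
  have hpair := c.pair hE hl hl5 hp0 h17 hpd h02 h03 h12 h13 hn0 hn1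
  have hsm : ∀ x : ℤ, 0 < x → x ≤ 4 → ¬ (l : ℤ) ∣ x := fun x h h' => small_not_dvd hl5 h h'
  have hsel : ∀ m : ℤ, 0 < m → (cc (nn G E 0) m ≤ 4 * l ^ 2 ∨ cc (nn G E 1) m ≤ 4 * l ^ 2) →
      ∃ c1, (0 < c1 ∧ c1 ≤ 4 * l ^ 2) ∧ ∀ p : ℕ, p.Prime → 5 ≤ p →
        ¬ ((p : ℤ) ∣ nn G E 0 ↔ (p : ℤ) ∣ m) → p ∣ c1 := by
    intro m hm h
    rcases h with h | h
    · exact ⟨_, ⟨cc_pos (nn_pos hp hE 0) hm, h⟩, fun p hpp h5 hh => cc_dvd hpp hh⟩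
    · exact ⟨_, ⟨cc_pos (nn_pos hp hE 1) hm, h⟩, fun p hpp h5 hh =>
        cc_dvd hpp (by rw [← e01 p hpp h5]; exact hh)⟩
  by_cases h23 : CC G E 2 3 = 0
  · have k23 := (CC_zero_iff hp hE 2 3).mp h23
    have k32 : Bf G (E 2) (E 3) = 0 := by rw [Bf_comm hs]; exact k23
    obtain ⟨b, hb, hb2, hw⟩ : ∃ b : ℤ, 0 < b ∧ b ≤ 2 ∧
        ¬ (l : ℤ) ∣ Bf G ((1 : ℤ) • E 2 + b • E 3) ((1 : ℤ) • E 2 + b • E 3) := by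
      have hval : ∀ b : ℤ, Bf G ((1 : ℤ) • E 2 + b • E 3) ((1 : ℤ) • E 2 + b • E 3) =
          nn G E 2 + b ^ 2 * nn G E 3 := by
        intro b
        simp only [Bf_add_left, Bf_add_right, Bf_smul_left, Bf_smul_right, k23, k32, nn]; ring
      simp only [hval]
      by_contra hcon
      push Not at hcon
      have q1 := hcon 1 (by norm_num) (by norm_num)
      have q2 := hcon 2 (by norm_num) (by norm_num)
      have q3 : (l : ℤ) ∣ 3 * nn G E 3 := by
        have := dvd_sub q2 q1
        ring_nf at this ⊢; exact this
      have q4 := (hli.dvd_or_dvd q3).resolve_left (hsm 3 (by norm_num) (by norm_num))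
      exact hone 3 2 (by decide) q4 ((dvd_add_left (q4.mul_left _)).mp q1)
    obtain ⟨m, hm, hc01, hc2, hc3⟩ := hpair 1 b hw
    have hc2 := hc2 (by rw [phi_two hp hE, h23]; exact hsm _ (by norm_num) (by norm_num))
    have hc3 := hc3 (by
      rw [add_comm, phi_two hp hE, (CC_zero_symm hs hp hE 2 3).mp h23]
      exact hsm _ (by linarith) (by linarith))
    obtain ⟨c1, hc1, hd1⟩ := hsel m hm hc01
    refine ⟨c1, _, _, hc1, ⟨cc_pos (nn_pos hp hE 2) hm, hc2⟩, ⟨cc_pos (nn_pos hp hE 3) hm, hc3⟩, ?_, ?_⟩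
    · intro p hpp h5 hpd2
      exact logic_two (a := fun i => (p : ℤ) ∣ nn G E i) ((hC p hpp h5 2).mp hpd2)
        (fun h => h3 p hpp ((hC p hpp h5 3).mpr h)) (e01 p hpp h5) (hd1 p hpp h5)
        (cc_dvd hpp) (cc_dvd hpp)
    · intro p hpp h5 hpd1 hpd2
      exact logic_one (a := fun i => (p : ℤ) ∣ nn G E i) ((hC p hpp h5 1).mp (by simpa using hpd1))
        (fun h => hpd2 ((hC p hpp h5 2).mpr h)) (e01 p hpp h5) (cc_dvd hpp) (cc_dvd hpp)
  · have e23 : ∀ p : ℕ, p.Prime → 5 ≤ p → ((p : ℤ) ∣ nn G E 2 ↔ (p : ℤ) ∣ nn G E 3) :=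
      fun p hpp h5 => edge_iff hs hp hE hpp h5 h23
    have hn2 : ¬ (l : ℤ) ∣ nn G E 2 := fun h => hone 2 3 (by decide) h ((e23 l hl hl5).mp h)
    obtain ⟨m, hm, hc01, hc2, -⟩ := hpair 1 0 (by rw [Bf_single2]; exact hn2)
    have hc2 := hc2 (by rw [phi_two hp hE]; exact hsm _ (by norm_num) (by norm_num))
    obtain ⟨c1, hc1, hd1⟩ := hsel m hm hc01
    have hc2' := cc_pos (nn_pos hp hE 2) hm
    refine ⟨c1, _, _, hc1, ⟨hc2', hc2⟩, ⟨hc2', hc2⟩, ?_, ?_⟩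
    · intro p hpp h5 hpd2
      have := logic_two' (a := fun i => (p : ℤ) ∣ nn G E i) ((hC p hpp h5 2).mp hpd2)
        (fun h => h3 p hpp ((hC p hpp h5 3).mpr h)) (e01 p hpp h5) (e23 p hpp h5) (hd1 p hpp h5)
        (cc_dvd hpp)
      simpa using this
    · intro p hpp h5 hpd1 hpd2
      exact (logic_one' (a := fun i => (p : ℤ) ∣ nn G E i) ((hC p hpp h5 1).mp (by simpa using hpd1))
        (fun h => hpd2 ((hC p hpp h5 2).mpr h)) (e01 p hpp h5) (e23 p hpp h5)).elim

lemma Ctx.tb3 (c : Ctx G) (hE : RootBasis G E) {l : ℕ} (hl : l.Prime) (hl5 : 5 ≤ l)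
    (hld : ¬ (l : ℤ) ^ 2 ∣ G.det)
    {p₀ : ℕ} (hp0 : p₀.Prime) (h17 : 17 ≤ p₀) (hpd : (p₀ : ℤ) ∣ G.det) (h01 : CC G E 0 1 ≠ 0)
    (h12 : CC G E 1 2 ≠ 0) (h03 : CC G E 0 3 = 0) (h13 : CC G E 1 3 = 0) (h23 : CC G E 2 3 = 0) :
    TB G l := by
  obtain ⟨hs, hp, hsq, htr, hd, h3⟩ := id c
  have hC : ∀ p : ℕ, p.Prime → 5 ≤ p → ∀ k, (p : ℤ) ^ k ∣ G.det ↔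
      k ≤ ∑ i, if (p : ℤ) ∣ nn G E i then 1 else 0 := fun p hpp h5 =>
    count_eq hp hsq hE hpp (by omega) (not_dvd_CC hs hp hE hd hp0 h17 hpd (h3 _ hp0) hpp h5)
  have e01 : ∀ p : ℕ, p.Prime → 5 ≤ p → ((p : ℤ) ∣ nn G E 0 ↔ (p : ℤ) ∣ nn G E 1) :=
    fun p hpp h5 => edge_iff hs hp hE hpp h5 h01
  have e12 : ∀ p : ℕ, p.Prime → 5 ≤ p → ((p : ℤ) ∣ nn G E 1 ↔ (p : ℤ) ∣ nn G E 2) :=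
    fun p hpp h5 => edge_iff hs hp hE hpp h5 h12
  have hcz : ∀ i, i ≠ 3 → CC G E i 3 = 0 := by
    intro i hi
    fin_cases i
    · exact h03
    · exact h13
    · exact h23
    · exact absurd rfl hi
  obtain ⟨x, y, hxx, hxy, hxe⟩ := X_Q hs hp hl (by omega) hld (hE.2 3)
  obtain ⟨-, hN⟩ := nbr_NV hs hp hsq htr hd hl (by omega) x y hxx hxy hp0 h17 hpd (h3 p₀ hp0)
  obtain ⟨w, m, hN, hNe⟩ := hN hl5
  obtain ⟨i, hi, hti⟩ := hN.other hs hp hE 3 hcz hxe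
  refine ⟨1, cc (nn G E 3) m, cc (nn G E i) m, ⟨one_pos, ?_⟩, ⟨cc_pos (nn_pos hp hE 3) hN.1, ?_⟩,
    ⟨cc_pos (nn_pos hp hE i) hN.1, ?_⟩, ?_, ?_⟩
  · have : 0 < l ^ 2 := by positivity
    omega
  · exact hN.cc_le hs hp (hE.2 3) (hNe _ (hE.2 3) hxe)
  · exact hN.cc_le hs hp (hE.2 i) hti
  · intro p hpp h5 hpd2
    exact (logic_three (a := fun i => (p : ℤ) ∣ nn G E i) ((hC p hpp h5 2).mp hpd2)
        (fun h => h3 p hpp ((hC p hpp h5 3).mpr h)) (e01 p hpp h5) (e12 p hpp h5)).elim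
  · intro p hpp h5 hpd1 hpd2
    obtain ⟨a3, a0, a1, a2⟩ := logic_three' (a := fun i => (p : ℤ) ∣ nn G E i)
      ((hC p hpp h5 1).mp (by simpa using hpd1))
      (fun h => hpd2 ((hC p hpp h5 2).mpr h)) (e01 p hpp h5) (e12 p hpp h5)
    have hni : ¬ (p : ℤ) ∣ nn G E i := by
      fin_cases i
      · exact a0
      · exact a1
      · exact a2
      · exact absurd rfl hi
    by_cases hm : (p : ℤ) ∣ m
    · exact Or.inr (cc_dvd hpp (fun h => hni (h.mpr hm)))
    · exact Or.inl (cc_dvd hpp (fun h => hm (h.mp a3)))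

end twelveA

section thirteenA

lemma both_ne_aux {K : Type*} [Field K] (h2 : (2 : K) ≠ 0) (h3 : (3 : K) ≠ 0) (h5 : (5 : K) ≠ 0)
    {α β γ x : K} (hα : α ≠ 0) (hβ : β ≠ 0) (hγ : γ ≠ 0) (h : α * x ^ 2 = γ) :
    ∃ X Y : K, X ≠ 0 ∧ Y ≠ 0 ∧ α * X ^ 2 + β * Y ^ 2 = γ := by
  have hx : x ≠ 0 := by rintro rfl; apply hγ; rw [← h]; ring
  obtain ⟨k, hk, h1, h4⟩ : ∃ k : K, k ≠ 0 ∧ α - β * k ^ 2 ≠ 0 ∧ α + β * k ^ 2 ≠ 0 := by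
    by_contra hcon
    push Not at hcon
    have e1 := hcon 1 one_ne_zero
    have e2 := hcon 2 h2
    have e3 := hcon 3 h3
    have d21 : β * 3 = 0 → False := fun h => by
      rcases mul_eq_zero.mp h with h | h
      · exact hβ h
      · exact h3 h
    have d32 : β * 5 = 0 → False := fun h => by
      rcases mul_eq_zero.mp h with h | h
      · exact hβ h
      · exact h5 h
    have d31 : β * 8 = 0 → False := fun h => by
      have : (8 : K) = 2 * 2 * 2 := by norm_num
      rw [this] at h
      simp [hβ, h2] at h
    by_cases a1 : α - β * 1 ^ 2 = 0
    · by_cases a2 : α - β * 2 ^ 2 = 0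
      · exact d21 (by linear_combination a1 - a2)
      · by_cases a3 : α - β * 3 ^ 2 = 0
        · exact d31 (by linear_combination a1 - a3)
        · exact d32 (by linear_combination e3 a3 - e2 a2)
    · have b1 := e1 a1
      by_cases a2 : α - β * 2 ^ 2 = 0
      · by_cases a3 : α - β * 3 ^ 2 = 0
        · exact d32 (by linear_combination a2 - a3)
        · exact d31 (by linear_combination e3 a3 - b1)
      · exact d21 (by linear_combination e2 a2 - b1)
  refine ⟨(α - β * k ^ 2) / (α + β * k ^ 2) * x, 2 * α * k / (α + β * k ^ 2) * x, ?_, ?_, ?_⟩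
  · exact mul_ne_zero (div_ne_zero h1 h4) hx
  · exact mul_ne_zero (div_ne_zero (mul_ne_zero (mul_ne_zero h2 hα) hk) h4) hx
  · rw [← h]; field_simp; ring

lemma both_ne {l : ℕ} (hl : l.Prime) (h7 : 7 ≤ l) (a b c : ℤ) (ha : ¬ (l : ℤ) ∣ a)
    (hb : ¬ (l : ℤ) ∣ b) (hc : ¬ (l : ℤ) ∣ c) :
    ∃ s t : ℤ, ¬ (l : ℤ) ∣ s ∧ ¬ (l : ℤ) ∣ t ∧ (l : ℤ) ∣ a * s ^ 2 + b * t ^ 2 - c := by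
  have := Fact.mk hl
  have key : ∀ z : ℤ, (z : ZMod l) = 0 ↔ (l : ℤ) ∣ z := fun z => ZMod.intCast_zmod_eq_zero_iff_dvd _ _
  have hsm : ∀ n : ℕ, 0 < n → n < 7 → (n : ZMod l) ≠ 0 := by
    intro n h0 hn h
    rw [ZMod.natCast_eq_zero_iff] at h
    exact absurd (Nat.le_of_dvd h0 h) (by omega)
  have h2 : (2 : ZMod l) ≠ 0 := by exact_mod_cast hsm 2 (by norm_num) (by norm_num)
  have h3 : (3 : ZMod l) ≠ 0 := by exact_mod_cast hsm 3 (by norm_num) (by norm_num)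
  have h5 : (5 : ZMod l) ≠ 0 := by exact_mod_cast hsm 5 (by norm_num) (by norm_num)
  have ha' : (a : ZMod l) ≠ 0 := fun h => ha ((key a).mp h)
  have hb' : (b : ZMod l) ≠ 0 := fun h => hb ((key b).mp h)
  have hc' : (c : ZMod l) ≠ 0 := fun h => hc ((key c).mp h)
  obtain ⟨X, Y, hX, hY, hXY⟩ : ∃ X Y : ZMod l, X ≠ 0 ∧ Y ≠ 0 ∧ (a : ZMod l) * X ^ 2 + b * Y ^ 2 = c := by
    obtain ⟨s, t, hst⟩ := binlem hl (by omega) a b c ha hb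
    rw [← key] at hst
    push_cast at hst
    by_cases hs : (s : ZMod l) = 0
    · obtain ⟨X, Y, hX, hY, h⟩ := both_ne_aux h2 h3 h5 hb' ha' hc' (x := (t : ZMod l)) (by
        rw [hs] at hst; linear_combination hst)
      exact ⟨Y, X, hY, hX, by rw [← h]; ring⟩
    · by_cases ht : (t : ZMod l) = 0
      · exact both_ne_aux h2 h3 h5 ha' hb' hc' (x := (s : ZMod l)) (by
          rw [ht] at hst; linear_combination hst)
      · exact ⟨s, t, hs, ht, by linear_combination hst⟩
  obtain ⟨s, rfl⟩ := ZMod.intCast_surjective X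
  obtain ⟨t, rfl⟩ := ZMod.intCast_surjective Y
  refine ⟨s, t, fun h => hX ((key s).mpr h), fun h => hY ((key t).mpr h), ?_⟩
  rw [← key]
  push_cast
  rw [hXY]; ring

lemma amgm4 {a b c d L : ℕ} (h : a + b + c + d ≤ 4 * L) : a * b * c * d ≤ L ^ 4 := by
  zify at h ⊢
  have ha : (0 : ℤ) ≤ a := by positivity
  have hb : (0 : ℤ) ≤ b := by positivity
  have hc : (0 : ℤ) ≤ c := by positivity
  have hd : (0 : ℤ) ≤ d := by positivity
  have hL : (0 : ℤ) ≤ L := by positivity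
  generalize (a : ℤ) = a at *
  generalize (b : ℤ) = b at *
  generalize (c : ℤ) = c at *
  generalize (d : ℤ) = d at *
  generalize (L : ℤ) = L at *
  have h1 : 4 * (a * b) ≤ (a + b) ^ 2 := by nlinarith [sq_nonneg (a - b)]
  have h2 : 4 * (c * d) ≤ (c + d) ^ 2 := by nlinarith [sq_nonneg (c - d)]
  have h3 : (a + b) * (c + d) ≤ 4 * L ^ 2 := by
    have : (a + b + c + d) ^ 2 ≤ (4 * L) ^ 2 := pow_le_pow_left₀ (by positivity) h 2
    nlinarith [sq_nonneg (a + b - c - d)]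
  have h4 : (4 * (a * b)) * (4 * (c * d)) ≤ (a + b) ^ 2 * (c + d) ^ 2 :=
    mul_le_mul h1 h2 (by positivity) (by positivity)
  have h5 : ((a + b) * (c + d)) ^ 2 ≤ (4 * L ^ 2) ^ 2 := pow_le_pow_left₀ (by positivity) h3 2
  nlinarith

variable {G E : Matrix (Fin 4) (Fin 4) ℤ}

/-- output in the diagonal case -/
def TA (G : Matrix (Fin 4) (Fin 4) ℤ) (l : ℕ) : Prop :=
  ∃ c : ℕ, 0 < c ∧ c ≤ l ^ 8 ∧
    (∀ p : ℕ, p.Prime → 3 ≤ p → (p : ℤ) ^ 2 ∣ G.det → p ^ 2 ∣ c) ∧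
    (∀ q : ℕ, q.Prime → 3 ≤ q → (q : ℤ) ∣ G.det → q ∣ c)

lemma logicA {a : Fin 4 → Prop} [DecidablePred a] {M : Prop} {p : ℕ} {c : Fin 4 → ℕ}
    (h2 : 2 ≤ ∑ i, if a i then 1 else 0) (h3 : ¬ 3 ≤ ∑ i, if a i then 1 else 0)
    (k : ∀ i, ¬ (a i ↔ M) → p ∣ c i) : p ^ 2 ∣ c 0 * c 1 * c 2 * c 3 := by
  have key : ∀ i j, i < j → p ∣ c i → p ∣ c j → p ^ 2 ∣ c 0 * c 1 * c 2 * c 3 := by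
    intro i j hij hi hj
    have h := mul_dvd_mul hi hj
    rw [← sq] at h
    refine h.trans ?_
    have h01 : c 0 * c 1 * c 2 * c 3 = ∏ i, c i := by rw [Fin.prod_univ_four]
    have : c i * c j = ∏ x ∈ ({i, j} : Finset (Fin 4)), c x := by rw [Finset.prod_pair hij.ne]
    rw [h01, this]
    exact Finset.prod_dvd_prod_of_subset _ _ _ (Finset.subset_univ _)
  obtain ⟨σ, s0, s1, s2, s3⟩ := perm_two h2 h3
  have hne : ∀ i j, i ≠ j → p ∣ c (σ i) → p ∣ c (σ j) → p ^ 2 ∣ c 0 * c 1 * c 2 * c 3 := by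
    intro i j hij hi hj
    rcases lt_or_gt_of_ne (σ.injective.ne hij) with h | h
    · exact key _ _ h hi hj
    · exact key _ _ h hj hi
  by_cases hM : M
  · exact hne 2 3 (by decide) (k _ (by simp [s2, hM])) (k _ (by simp [s3, hM]))
  · exact hne 0 1 (by decide) (k _ (by simp [s0, hM])) (k _ (by simp [s1, hM]))

lemma logicA' {a : Fin 4 → Prop} [DecidablePred a] {M : Prop} {p : ℕ} {c : Fin 4 → ℕ}
    (h1 : 1 ≤ ∑ i, if a i then 1 else 0) (h3 : ¬ 3 ≤ ∑ i, if a i then 1 else 0)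
    (k : ∀ i, ¬ (a i ↔ M) → p ∣ c i) : p ∣ c 0 * c 1 * c 2 * c 3 := by
  have key : ∀ i, p ∣ c i → p ∣ c 0 * c 1 * c 2 * c 3 := by
    intro i hi
    have h01 : c 0 * c 1 * c 2 * c 3 = ∏ i, c i := by rw [Fin.prod_univ_four]
    rw [h01]
    exact hi.trans (Finset.dvd_prod_of_mem _ (Finset.mem_univ _))
  by_contra hcon
  have hall : ∀ i, a i ↔ M := fun i => by
    by_contra h
    exact hcon (key i (k i h))
  rw [Fin.sum_univ_four] at h1 h3
  by_cases hM : M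
  · have h : ∀ i, a i := fun i => (hall i).mpr hM
    simp [h] at h3
  · have h : ∀ i, ¬ a i := fun i hi => hM ((hall i).mp hi)
    simp [h] at h1

lemma dn_perm (P : Fin 4 → Prop) [DecidablePred P] (h2 : ∀ i j, i ≠ j → P i → ¬ P j) :
    ∃ σ : Equiv.Perm (Fin 4), ¬ P (σ 0) ∧ ¬ P (σ 1) := by
  by_cases h : ¬ P 0 ∧ ¬ P 1
  · exact ⟨1, h⟩
  · refine ⟨Equiv.swap 0 2 * Equiv.swap 1 3, ?_⟩
    have e0 : (Equiv.swap (0 : Fin 4) 2 * Equiv.swap (1 : Fin 4) 3 : Equiv.Perm (Fin 4)) 0 = 2 := by decide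
    have e1 : (Equiv.swap (0 : Fin 4) 2 * Equiv.swap (1 : Fin 4) 3 : Equiv.Perm (Fin 4)) 1 = 3 := by decide
    rw [e0, e1]
    rw [not_and_or, not_not, not_not] at h
    rcases h with h | h
    · exact ⟨h2 0 2 (by decide) h, h2 0 3 (by decide) h⟩
    · exact ⟨h2 1 2 (by decide) h, h2 1 3 (by decide) h⟩

lemma bessel (hs : G.IsSymm) (hp : PosDefM G) (hE : RootBasis G E)
    (ho : ∀ i j, i ≠ j → Bf G (E i) (E j) = 0) (w : Fin 4 → ℤ) :
    Bf G w (E 0) ^ 2 * (nn G E 1 * nn G E 2 * nn G E 3) + Bf G w (E 1) ^ 2 * (nn G E 0 * nn G E 2 * nn G E 3)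
     + Bf G w (E 2) ^ 2 * (nn G E 0 * nn G E 1 * nn G E 3) + Bf G w (E 3) ^ 2 * (nn G E 0 * nn G E 1 * nn G E 2)
     ≤ (nn G E 0 * nn G E 1 * nn G E 2 * nn G E 3) * Bf G w w := by
  have h0 := nn_pos hp hE 0
  have h1 := nn_pos hp hE 1
  have h2 := nn_pos hp hE 2
  have h3 := nn_pos hp hE 3
  have hn : ∀ i, Bf G (E i) (E i) = nn G E i := fun i => rfl
  generalize nn G E = n at *
  have key := Bf_pos_nonneg hp ((n 0 * n 1 * n 2 * n 3) • w + (-(Bf G w (E 0) * (n 1 * n 2 * n 3))) • E 0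
    + (-(Bf G w (E 1) * (n 0 * n 2 * n 3))) • E 1 + (-(Bf G w (E 2) * (n 0 * n 1 * n 3))) • E 2
    + (-(Bf G w (E 3) * (n 0 * n 1 * n 2))) • E 3)
  simp only [Bf_add_left, Bf_add_right, Bf_smul_left, Bf_smul_right, hn, Bf_comm hs (E _) w] at key
  rw [ho 0 1 (by decide), ho 0 2 (by decide), ho 0 3 (by decide), ho 1 0 (by decide), ho 1 2 (by decide),
    ho 1 3 (by decide), ho 2 0 (by decide), ho 2 1 (by decide), ho 2 3 (by decide), ho 3 0 (by decide),
    ho 3 1 (by decide), ho 3 2 (by decide)] at key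
  have hN : 0 < n 0 * n 1 * n 2 * n 3 := by positivity
  refine le_of_mul_le_mul_left (a := n 0 * n 1 * n 2 * n 3) ?_ hN
  linarith

lemma Ctx.ta (c : Ctx G) (hE : RootBasis G E) {l : ℕ} (hl : l.Prime) (hl7 : 7 ≤ l)
    (hld : ¬ (l : ℤ) ^ 2 ∣ G.det)
    {p₀ : ℕ} (hp0 : p₀.Prime) (h17 : 17 ≤ p₀) (hpd : (p₀ : ℤ) ∣ G.det)
    (hz : ∀ i j, i ≠ j → CC G E i j = 0) : TA G l := by
  obtain ⟨hs, hp, hsq, htr, hd, h3⟩ := id c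
  have hli := Nat.prime_iff_prime_int.mp hl
  have hdet : (CC G E).det = 2 ^ 4 := by
    have : CC G E = Matrix.diagonal (fun _ => (2 : ℤ)) := by
      ext i j
      by_cases hij : i = j
      · subst hij; rw [CC_diag hp hE]; simp
      · rw [hz i j hij, Matrix.diagonal_apply_ne _ hij]
    rw [this, Matrix.det_diagonal]; simp
  have hsm : ∀ x : ℤ, 0 < x → x ≤ 4 → ¬ (l : ℤ) ∣ x := fun x h h' => small_not_dvd (by omega) h h'
  have hC0 : ∀ p : ℕ, p.Prime → 3 ≤ p → ∀ k, (p : ℤ) ^ k ∣ G.det ↔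
      k ≤ ∑ i, if (p : ℤ) ∣ nn G E i then 1 else 0 := fun p hpp h5 =>
    count_eq hp hsq hE hpp (by omega) (by
      rw [hdet]
      intro h
      have h2 := (Nat.prime_iff_prime_int.mp hpp).dvd_of_dvd_pow h
      have := Int.le_of_dvd (by norm_num) h2
      omega)
  have hone0 : ∀ i j, i ≠ j → (l : ℤ) ∣ nn G E i → ¬ (l : ℤ) ∣ nn G E j := fun i j hij =>
    at_most_one (fun h => hld ((hC0 l hl (by omega) 2).mpr h)) hij
  have hcount : ∀ (p : ℕ) (σ : Equiv.Perm (Fin 4)), (∑ i, if (p : ℤ) ∣ nn G (E.submatrix σ id) i then 1 else 0)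
      = ∑ i, if (p : ℤ) ∣ nn G E i then 1 else 0 := by
    intro p σ
    exact Equiv.sum_comp σ (fun i => if (p : ℤ) ∣ nn G E i then 1 else 0)
  obtain ⟨σ, hσ0, hσ1⟩ := dn_perm (fun i => (l : ℤ) ∣ nn G E i) hone0
  have hz' : ∀ i j, i ≠ j → CC G (E.submatrix σ id) i j = 0 := fun i j hij =>
    hz (σ i) (σ j) (σ.injective.ne hij)
  have hone : ∀ i j, i ≠ j → (l : ℤ) ∣ nn G (E.submatrix σ id) i → ¬ (l : ℤ) ∣ nn G (E.submatrix σ id) j :=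
    fun i j hij => hone0 _ _ (σ.injective.ne hij)
  have hC : ∀ p : ℕ, p.Prime → 3 ≤ p → ∀ k, (p : ℤ) ^ k ∣ G.det ↔
      k ≤ ∑ i, if (p : ℤ) ∣ nn G (E.submatrix σ id) i then 1 else 0 := by
    intro p hpp h5 k
    rw [hcount]; exact hC0 p hpp h5 k
  have hE' := hE.perm σ
  have hn0 : ¬ (l : ℤ) ∣ nn G (E.submatrix σ id) 0 := hσ0
  have hn1 : ¬ (l : ℤ) ∣ nn G (E.submatrix σ id) 1 := hσ1
  clear hσ0 hσ1 hcount hone0 hC0 hdet hz hE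
  generalize E.submatrix σ id = E at *
  have hE := hE'
  have ho : ∀ i j, i ≠ j → Bf G (E i) (E j) = 0 := fun i j hij =>
    (CC_zero_iff hp hE j i).mp (hz' j i hij.symm)
  obtain ⟨b, hb, hb2, hw⟩ : ∃ b : ℤ, 0 < b ∧ b ≤ 2 ∧ ¬ (l : ℤ) ∣ -(nn G E 2 + b ^ 2 * nn G E 3) := by
    by_contra hcon
    push Not at hcon
    have q1 := hcon 1 (by norm_num) (by norm_num)
    have q2 := hcon 2 (by norm_num) (by norm_num)
    rw [dvd_neg] at q1 q2
    have q3 : (l : ℤ) ∣ 3 * nn G E 3 := by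
      have := dvd_sub q2 q1
      ring_nf at this ⊢; exact this
    have q4 := (hli.dvd_or_dvd q3).resolve_left (hsm 3 (by norm_num) (by norm_num))
    exact hone 3 2 (by decide) q4 ((dvd_add_left (q4.mul_left _)).mp q1)
  obtain ⟨s, t, hs0, ht0, hst⟩ := both_ne hl hl7 _ _ _ hn0 hn1 hw
  obtain ⟨x, hx⟩ : ∃ x, x = s • E 0 + t • E 1 + (1 : ℤ) • E 2 + b • E 3 := ⟨_, rfl⟩
  have hxx : (l : ℤ) ∣ Bf G x x := by
    convert hst using 1
    rw [hx]
    simp only [Bf_add_left, Bf_add_right, Bf_smul_left, Bf_smul_right, nn]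
    rw [ho 0 1 (by decide), ho 0 2 (by decide), ho 0 3 (by decide), ho 1 0 (by decide), ho 1 2 (by decide),
    ho 1 3 (by decide), ho 2 0 (by decide), ho 2 1 (by decide), ho 2 3 (by decide), ho 3 0 (by decide),
    ho 3 1 (by decide), ho 3 2 (by decide)]
    ring
  have hbx : ∀ y, Bf G x y = s * Bf G (E 0) y + t * Bf G (E 1) y + Bf G (E 2) y + b * Bf G (E 3) y := by
    intro y
    rw [hx]
    simp only [Bf_add_left, Bf_smul_left]; ring
  have hxy : ¬ (l : ℤ) ∣ Bf G x (E 0) := by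
    rw [hbx, ho 1 0 (by decide), ho 2 0 (by decide), ho 3 0 (by decide)]
    intro h
    have : (l : ℤ) ∣ s * nn G E 0 := by simpa [nn] using h
    rcases hli.dvd_or_dvd this with h | h
    · exact hs0 h
    · exact hn0 h
  have h2l : ¬ (l : ℤ) ∣ 2 := hsm 2 (by norm_num) (by norm_num)
  have hphi : ∀ i, ∃ k : ℤ, ¬ (l : ℤ) ∣ k ∧ Bf G x (E i) = k * nn G E i := by
    intro i
    fin_cases i
    · refine ⟨s, hs0, ?_⟩
      show Bf G x (E 0) = s * nn G E 0
      rw [hbx, ho 1 0 (by decide), ho 2 0 (by decide), ho 3 0 (by decide), nn]; ring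
    · refine ⟨t, ht0, ?_⟩
      show Bf G x (E 1) = t * nn G E 1
      rw [hbx, ho 0 1 (by decide), ho 2 1 (by decide), ho 3 1 (by decide), nn]; ring
    · refine ⟨1, hsm 1 (by norm_num) (by norm_num), ?_⟩
      show Bf G x (E 2) = 1 * nn G E 2
      rw [hbx, ho 0 2 (by decide), ho 1 2 (by decide), ho 3 2 (by decide), nn]; ring
    · refine ⟨b, hsm b hb (by linarith), ?_⟩
      show Bf G x (E 3) = b * nn G E 3
      rw [hbx, ho 0 3 (by decide), ho 1 3 (by decide), ho 2 3 (by decide), nn]; ring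
  have hphi' : ∀ i, ¬ (l : ℤ) ∣ phi G (E i) x := by
    intro i h
    obtain ⟨k, hk, hk'⟩ := hphi i
    have h1 := phi_mul hp (hE.2 i) x
    rw [hk', ← mul_assoc] at h1
    have h2 := mul_right_cancel₀ (nn_pos hp hE i).ne' h1
    rw [h2] at h
    rcases hli.dvd_or_dvd h with h | h
    · exact h2l h
    · exact hk h
  obtain ⟨-, hN⟩ := nbr_NV hs hp hsq htr hd hl (by omega) x _ hxx hxy hp0 h17 hpd (h3 p₀ hp0)
  obtain ⟨w, m, hN, hNe⟩ := hN (by omega)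
  have hm := hN.1
  have ht : ∀ i, Bf G w (E i) ≠ 0 := fun i => hNe _ (hE.2 i) (hphi' i)
  have hcc : ∀ i, nn G E i * m * (cc (nn G E i) m : ℤ) ≤ 4 * Bf G w (E i) ^ 2 := fun i =>
    cc_le (nn_pos hp hE i) hm (root_dvd hp (hE.2 i) w) (hN.2.2.1 _ (hE.2 i)) (ht i)
  have hbes := bessel hs hp hE ho w
  rw [hN.2.1] at hbes
  have hn := nn_pos hp hE
  have hsum : cc (nn G E 0) m + cc (nn G E 1) m + cc (nn G E 2) m + cc (nn G E 3) m ≤ 4 * l ^ 2 := by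
    have c0 := hcc 0
    have c1 := hcc 1
    have c2 := hcc 2
    have c3 := hcc 3
    have n0 := hn 0
    have n1 := hn 1
    have n2 := hn 2
    have n3 := hn 3
    zify
    generalize nn G E 0 = a0 at *
    generalize nn G E 1 = a1 at *
    generalize nn G E 2 = a2 at *
    generalize nn G E 3 = a3 at *
    have k0 := mul_le_mul_of_nonneg_right c0 (show 0 ≤ a1 * a2 * a3 by positivity)
    have k1 := mul_le_mul_of_nonneg_right c1 (show 0 ≤ a0 * a2 * a3 by positivity)
    have k2 := mul_le_mul_of_nonneg_right c2 (show 0 ≤ a0 * a1 * a3 by positivity)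
    have k3 := mul_le_mul_of_nonneg_right c3 (show 0 ≤ a0 * a1 * a2 by positivity)
    refine le_of_mul_le_mul_left (a := a0 * a1 * a2 * a3 * m) ?_ (by positivity)
    linarith
  have hprod := amgm4 hsum
  refine ⟨cc (nn G E 0) m * cc (nn G E 1) m * cc (nn G E 2) m * cc (nn G E 3) m, ?_, by rw [show 8 = 2 * 4 from rfl, pow_mul]; exact hprod, ?_, ?_⟩
  · have := fun i => cc_pos (hn i) hm
    have h0 := this 0
    have h1 := this 1
    have h2 := this 2
    have h3 := this 3
    positivity
  · intro p hpp h5 hpd2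
    exact logicA (a := fun i => (p : ℤ) ∣ nn G E i) (M := (p : ℤ) ∣ m) (c := fun i => cc (nn G E i) m)
      ((hC p hpp h5 2).mp hpd2)
      (fun h => h3 p hpp ((hC p hpp h5 3).mpr h)) (fun i hi => cc_dvd hpp hi)
  · intro p hpp h5 hpd1
    exact logicA' (a := fun i => (p : ℤ) ∣ nn G E i) (M := (p : ℤ) ∣ m) (c := fun i => cc (nn G E i) m)
      ((hC p hpp h5 1).mp (by simpa using hpd1))
      (fun h => h3 p hpp ((hC p hpp h5 3).mpr h)) (fun i hi => cc_dvd hpp hi)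

lemma Ctx.tab (c : Ctx G) {l : ℕ} (hl : l.Prime) (hl7 : 7 ≤ l) (hld : ¬ (l : ℤ) ^ 2 ∣ G.det)
    {p₀ : ℕ} (hp0 : p₀.Prime) (h17 : 17 ≤ p₀) (hpd : (p₀ : ℤ) ∣ G.det) : TA G l ∨ TB G l := by
  obtain ⟨E, hE, h⟩ := c.classify hp0 h17 hpd
  have h := h _ rfl
  simp only [not_not] at h
  rcases h with h | h | h | h
  · obtain ⟨h01, h02, h03, h12, h13, h23⟩ := h
    left
    have hsym := fun i j => (CC_zero_symm c.hs c.hp hE i j).mp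
    refine c.ta hE hl hl7 hld hp0 h17 hpd ?_
    intro i j hij
    fin_cases i <;> fin_cases j
    · exact absurd rfl hij
    · exact h01
    · exact h02
    · exact h03
    · exact hsym _ _ h01
    · exact absurd rfl hij
    · exact h12
    · exact h13
    · exact hsym _ _ h02
    · exact hsym _ _ h12
    · exact absurd rfl hij
    · exact h23
    · exact hsym _ _ h03
    · exact hsym _ _ h13
    · exact hsym _ _ h23
    · exact absurd rfl hij
  · obtain ⟨h01, h02, h03, h12, h13, h23⟩ := h
    exact Or.inr (c.tb1 hE hl (by omega) hld hp0 h17 hpd h01 h02 h03 h12 h13)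
  · right
    have h01 : CC G E 0 1 ≠ 0 := by simp_all
    have h02 : CC G E 0 2 = 0 := by simp_all
    have h03 : CC G E 0 3 = 0 := by simp_all
    have h12 : CC G E 1 2 = 0 := by simp_all
    have h13 : CC G E 1 3 = 0 := by simp_all
    exact c.tb1 hE hl (by omega) hld hp0 h17 hpd h01 h02 h03 h12 h13
  · right
    have h01 : CC G E 0 1 ≠ 0 := by simp_all
    have h12 : CC G E 1 2 ≠ 0 := by simp_all
    have h03 : CC G E 0 3 = 0 := by simp_all
    have h13 : CC G E 1 3 = 0 := by simp_all
    have h23 : CC G E 2 3 = 0 := by simp_all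
    exact c.tb3 hE hl (by omega) hld hp0 h17 hpd h01 h12 h03 h13 h23

end thirteenA

section fourteenA

lemma list_coprime {a : ℕ} (ha : a.Prime) {L : List ℕ} (hL : ∀ x ∈ L, x.Prime) (hn : ∀ x ∈ L, x ≠ a) :
    Nat.Coprime a L.prod := by
  rw [Nat.coprime_list_prod_right_iff]
  intro x hx
  exact (Nat.coprime_primes ha (hL x hx)).mpr (fun h => hn x hx h.symm)

lemma list_dvd {k c : ℕ} (L : List ℕ) (hL : ∀ x ∈ L, x.Prime) (hs : L.Pairwise (· < ·))
    (hd : ∀ x ∈ L, x ^ k ∣ c) : L.prod ^ k ∣ c := by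
  induction L with
  | nil => simp
  | cons a L ih =>
    rw [List.prod_cons, mul_pow]
    rw [List.pairwise_cons] at hs
    apply Nat.Coprime.mul_dvd_of_dvd_of_dvd
    · apply Nat.Coprime.pow
      apply list_coprime (hL a (by simp)) (fun x hx => hL x (by simp [hx]))
      intro x hx
      exact (hs.1 x hx).ne'
    · exact hd a (by simp)
    · exact ih (fun x hx => hL x (by simp [hx])) hs.2 (fun x hx => hd x (by simp [hx]))

lemma list_dvd2 {c : ℕ} (L M : List ℕ) (hL : ∀ x ∈ L, x.Prime) (hM : ∀ x ∈ M, x.Prime)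
    (hs : L.Pairwise (· < ·)) (ht : M.Pairwise (· < ·)) (hne : ∀ x ∈ L, x ∉ M)
    (hd : ∀ x ∈ L, x ^ 2 ∣ c) (he : ∀ x ∈ M, x ∣ c) : L.prod ^ 2 * M.prod ∣ c := by
  apply Nat.Coprime.mul_dvd_of_dvd_of_dvd
  · apply Nat.Coprime.pow_left
    rw [Nat.coprime_list_prod_left_iff]
    intro x hx
    exact list_coprime (hL x hx) hM (fun y hy h => hne x hx (h ▸ hy))
  · exact list_dvd L hL hs hd
  · have := list_dvd (k := 1) M hM ht (by simpa using he)
    simpa using this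

/-- product bounds -/
def FT (P Q : ℕ → Prop) (l : ℕ) : Prop :=
  (∀ L : List ℕ, L.Pairwise (· < ·) → (∀ x ∈ L, P x ∧ 5 ≤ x) → L.prod ≤ 16 * l ^ 4) ∧
  ((∀ L M : List ℕ, L.Pairwise (· < ·) → M.Pairwise (· < ·) → (∀ x ∈ L, P x ∧ 3 ≤ x) →
      (∀ x ∈ M, Q x ∧ 3 ≤ x) → L.prod ^ 2 * M.prod ≤ 1 * l ^ 8) ∨
   ((∀ L M : List ℕ, L.Pairwise (· < ·) → M.Pairwise (· < ·) → (∀ x ∈ L, P x ∧ 5 ≤ x) →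
      (∀ x ∈ M, Q x ∧ 5 ≤ x) → L.prod ^ 2 * M.prod ≤ 256 * l ^ 8) ∧
    (∀ M : List ℕ, M.Pairwise (· < ·) → (∀ x ∈ M, Q x ∧ 5 ≤ x) → M.prod ≤ 16 * l ^ 4)))

/-- arithmetic data extracted from the lattice -/
structure Dat (P Q : ℕ → Prop) : Prop where
  pp : ∀ x, P x → x.Prime
  qp : ∀ x, Q x → x.Prime
  pq : ∀ x, P x → ¬ Q x
  bd : ∃ N, ∀ x, P x → x ≤ N
  f3 : ¬ P 3 → ∀ x, Q x → 17 ≤ x → x ≤ 36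
  f5 : ¬ P 5 → ∀ x, (P x ∨ Q x) → 17 ≤ x → x ≤ 100
  fl : ∀ l, l.Prime → 7 ≤ l → ¬ P l → ∀ x, (P x ∨ Q x) → 17 ≤ x → x ≤ 4 * l ^ 2
  ft : ∀ l, l.Prime → 7 ≤ l → ¬ P l → ∀ x, (P x ∨ Q x) → 17 ≤ x → FT P Q l

variable {G : Matrix (Fin 4) (Fin 4) ℤ}

lemma Ctx.dat (c : Ctx G) : Dat (fun p => p.Prime ∧ (p : ℤ) ^ 2 ∣ G.det)
    (fun q => q.Prime ∧ (q : ℤ) ∣ G.det ∧ ¬ (q : ℤ) ^ 2 ∣ G.det) := by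
  have hboth : ∀ l : ℕ, l.Prime → 5 ≤ l → ¬ (l.Prime ∧ (l : ℤ) ^ 2 ∣ G.det) → ∀ x : ℕ,
    ((x.Prime ∧ (x : ℤ) ^ 2 ∣ G.det) ∨ (x.Prime ∧ (x : ℤ) ∣ G.det ∧ ¬ (x : ℤ) ^ 2 ∣ G.det)) → 17 ≤ x →
    x ≤ 4 * l ^ 2 := by
    intro l hl h5 hld x hx h17
    rcases hx with ⟨hx, hx2⟩ | ⟨hx, hx1, hx2⟩
    · exact c.lem5 hl h5 (fun h => hld ⟨hl, h⟩) hx h17 hx2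
    · exact c.lemQ hl (by omega) (fun h => hld ⟨hl, h⟩) hx h17 hx1 hx2
  refine ⟨fun x h => h.1, fun x h => h.1, fun x h h' => h'.2.2 h.2, ?_, ?_, ?_, ?_, ?_⟩
  · refine ⟨G.det.toNat, fun x hx => ?_⟩
    have h1 := Int.le_of_dvd c.hd ((dvd_pow_self _ two_ne_zero).trans hx.2)
    omega
  · intro h3 x hx h17
    exact c.lemQ Nat.prime_three (by norm_num) (fun h => h3 ⟨Nat.prime_three, h⟩) hx.1 h17 hx.2.1 hx.2.2
  · intro h5 x hx h17
    exact hboth 5 Nat.prime_five le_rfl h5 x hx h17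
  · intro l hl h7 hld x hx h17
    exact hboth l hl (by omega) hld x hx h17
  · intro l hl h7 hld x hx h17
    have hxd : x.Prime ∧ (x : ℤ) ∣ G.det := by
      rcases hx with ⟨hx, hx2⟩ | ⟨hx, hx1, hx2⟩
      · exact ⟨hx, (dvd_pow_self _ two_ne_zero).trans hx2⟩
      · exact ⟨hx, hx1⟩
    rcases c.tab hl h7 (fun h => hld ⟨hl, h⟩) hxd.1 h17 hxd.2 with h | h
    · obtain ⟨m, hm, hml, h1, h2⟩ := h
      have hA : (∀ L M : List ℕ, L.Pairwise (· < ·) → M.Pairwise (· < ·) →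
          (∀ x ∈ L, (x.Prime ∧ (x : ℤ) ^ 2 ∣ G.det) ∧ 3 ≤ x) →
          (∀ x ∈ M, (x.Prime ∧ (x : ℤ) ∣ G.det ∧ ¬ (x : ℤ) ^ 2 ∣ G.det) ∧ 3 ≤ x) →
          L.prod ^ 2 * M.prod ≤ 1 * l ^ 8) := by
        intro L M hs ht hL hM
        rw [one_mul]
        refine (Nat.le_of_dvd hm ?_).trans hml
        exact list_dvd2 L M (fun x hx => (hL x hx).1.1) (fun x hx => (hM x hx).1.1) hs ht
          (fun x hx hx' => (hM x hx').1.2.2 (hL x hx).1.2)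
          (fun x hx => h1 x (hL x hx).1.1 (hL x hx).2 (hL x hx).1.2)
          (fun x hx => h2 x (hM x hx).1.1 (hM x hx).2 (hM x hx).1.2.1)
      refine ⟨?_, Or.inl hA⟩
      intro L hs hL
      have h := hA L [] hs (by simp) (fun x hx => ⟨(hL x hx).1, by have := (hL x hx).2; omega⟩) (by simp)
      have h' : L.prod ^ 2 ≤ (l ^ 4) ^ 2 := by simpa [← pow_mul] using h
      have := (Nat.pow_le_pow_iff_left two_ne_zero).mp h'
      omega
    · obtain ⟨c1, c3, c4, ⟨p1, b1⟩, ⟨p3, b3⟩, ⟨p4, b4⟩, hP, hQ⟩ := h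
      have hb13 : c1 * c3 ≤ 16 * l ^ 4 := (Nat.mul_le_mul b1 b3).trans (by apply le_of_eq; ring)
      have hb34 : c3 * c4 ≤ 16 * l ^ 4 := (Nat.mul_le_mul b3 b4).trans (by apply le_of_eq; ring)
      have hb14 : c1 ^ 2 * (c3 * c4) ≤ 256 * l ^ 8 :=
        (Nat.mul_le_mul (Nat.pow_le_pow_left b1 2) hb34).trans (by apply le_of_eq; ring)
      refine ⟨?_, Or.inr ⟨?_, ?_⟩⟩
      · intro L hs hL
        refine (Nat.le_of_dvd (Nat.mul_pos p1 p3) ?_).trans hb13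
        have := list_dvd (k := 1) (c := c1 * c3) L (fun x hx => (hL x hx).1.1) hs (fun x hx => by
          rw [pow_one]
          rcases hP x (hL x hx).1.1 (hL x hx).2 (hL x hx).1.2 with h | h
          · exact h.mul_right _
          · exact h.1.mul_left _)
        simpa using this
      · intro L M hs ht hL hM
        refine (Nat.le_of_dvd (by positivity) ?_).trans hb14
        refine list_dvd2 L M (fun x hx => (hL x hx).1.1) (fun x hx => (hM x hx).1.1) hs ht
          (fun x hx hx' => (hM x hx').1.2.2 (hL x hx).1.2) (fun x hx => ?_) (fun x hx => ?_)
        · rcases hP x (hL x hx).1.1 (hL x hx).2 (hL x hx).1.2 with h | h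
          · exact (pow_dvd_pow_of_dvd h 2).mul_right _
          · rw [sq]; exact (mul_dvd_mul h.1 h.2).mul_left _
        · apply Dvd.dvd.mul_left
          rcases hQ x (hM x hx).1.1 (hM x hx).2 (hM x hx).1.2.1 (hM x hx).1.2.2 with h | h
          · exact h.mul_right _
          · exact h.mul_left _
      · intro M hs hM
        refine (Nat.le_of_dvd (Nat.mul_pos p3 p4) ?_).trans hb34
        have := list_dvd (k := 1) (c := c3 * c4) M (fun x hx => (hM x hx).1.1) hs (fun x hx => by
          rw [pow_one]
          rcases hQ x (hM x hx).1.1 (hM x hx).2 (hM x hx).1.2.1 (hM x hx).1.2.2 with h | h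
          · exact h.mul_right _
          · exact h.mul_left _)
        simpa using this

end fourteenA

section fifteenA
variable {P Q : ℕ → Prop}

lemma prime_cases {x : ℕ} (h : x.Prime) : x = 2 ∨ x = 3 ∨ x = 5 ∨ x = 7 ∨ x = 11 ∨ x = 13 ∨ x = 17 ∨
    x = 19 ∨ x = 23 ∨ 29 ≤ x := by
  by_contra hcon
  have hx : x < 29 := by omega
  interval_cases x <;> first | omega | (revert h; norm_num)

lemma large_l {l : ℕ} (hl : 7 ≤ l) (hall : ∀ r, r.Prime → 7 ≤ r → r < l → P r)
    (hL : ∀ L : List ℕ, L.Pairwise (· < ·) → (∀ x ∈ L, P x ∧ 5 ≤ x) → L.prod ≤ 16 * l ^ 4) : l ≤ 30 := by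
  by_contra hcon
  have mem : ∀ r, r.Prime → 7 ≤ r → r < l → P r ∧ 5 ≤ r := fun r h1 h2 h3 => ⟨hall r h1 h2 h3, by omega⟩
  have h60 : 60 < l := by
    by_contra h
    have h1 := hL [7, 11, 13, 17, 19, 23, 29] (by simp) (by
      simp only [List.mem_cons, List.not_mem_nil, or_false]
      rintro x (rfl | rfl | rfl | rfl | rfl | rfl | rfl) <;>
        exact mem _ (by norm_num) (by norm_num) (by omega))
    have h2 : l ^ 4 ≤ 60 ^ 4 := Nat.pow_le_pow_left (by omega) 4
    norm_num at h1 h2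
    omega
  have h320 : 320 < l := by
    by_contra h
    have h1 := hL [7, 11, 13, 17, 19, 23, 29, 31, 37, 41, 43, 47, 53, 59] (by simp) (by
      simp only [List.mem_cons, List.not_mem_nil, or_false]
      rintro x (rfl | rfl | rfl | rfl | rfl | rfl | rfl | rfl | rfl | rfl | rfl | rfl | rfl | rfl) <;>
        exact mem _ (by norm_num) (by norm_num) (by omega))
    have h2 : l ^ 4 ≤ 320 ^ 4 := Nat.pow_le_pow_left (by omega) 4
    norm_num at h1 h2
    omega
  obtain ⟨n, hn⟩ : ∃ n, n = (l - 1) / 2 := ⟨_, rfl⟩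
  obtain ⟨r1, hr1, a1, b1⟩ := Nat.exists_prime_lt_and_le_two_mul n (by omega)
  obtain ⟨r2, hr2, a2, b2⟩ := Nat.exists_prime_lt_and_le_two_mul (n / 2) (by omega)
  obtain ⟨r3, hr3, a3, b3⟩ := Nat.exists_prime_lt_and_le_two_mul (n / 4) (by omega)
  obtain ⟨r4, hr4, a4, b4⟩ := Nat.exists_prime_lt_and_le_two_mul (n / 8) (by omega)
  have h1 := hL [7, 11, 13, 17, r4, r3, r2, r1] (by simp; omega) (by
    simp only [List.mem_cons, List.not_mem_nil, or_false]
    rintro x (rfl | rfl | rfl | rfl | rfl | rfl | rfl | rfl) <;>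
        exact mem _ (by first | assumption | norm_num) (by omega) (by omega))
  have k1 : l ≤ 2 * r1 := by omega
  have k2 : l ≤ 4 * r2 := by omega
  have k3 : l ≤ 8 * r3 := by omega
  have k4 : l ≤ 16 * r4 := by omega
  have h2 := Nat.mul_le_mul (Nat.mul_le_mul k1 k2) (Nat.mul_le_mul k3 k4)
  have e1 : l * l * (l * l) = l ^ 4 := by ring
  have e2 : 2 * r1 * (4 * r2) * (8 * r3 * (16 * r4)) = 1024 * (r4 * (r3 * (r2 * r1))) := by ring
  have e3 : [7, 11, 13, 17, r4, r3, r2, r1].prod = 17017 * (r4 * (r3 * (r2 * r1))) := by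
    simp; ring
  rw [e1, e2] at h2
  rw [e3] at h1
  have h0 : 0 < l ^ 4 := by positivity
  omega

lemma Dat.core (d : Dat P Q) {x : ℕ} (hx : P x ∨ Q x) (h17 : 17 ≤ x) :
    ∃ l, (l = 7 ∨ l = 11 ∨ l = 13 ∨ l = 17 ∨ l = 19 ∨ l = 23 ∨ (l = 29 ∧ ¬ P 5)) ∧
      (∀ r, r.Prime → 7 ≤ r → r < l → P r) ∧ FT P Q l ∧ x ≤ 4 * l ^ 2 := by
  obtain ⟨N, hN⟩ := d.bd
  have hex : ∃ l, l.Prime ∧ 7 ≤ l ∧ ¬ P l := by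
    obtain ⟨l, hl, hlp⟩ := Nat.exists_infinite_primes (N + 8)
    exact ⟨l, hlp, by omega, fun h => by have := hN l h; omega⟩
  classical
  obtain ⟨hl, h7, hPl⟩ := Nat.find_spec hex
  have hmin : ∀ r, r.Prime → 7 ≤ r → r < Nat.find hex → P r := by
    intro r h1 h2 h3
    by_contra h
    exact Nat.find_min hex h3 ⟨h1, h2, h⟩
  generalize Nat.find hex = l at *
  have hft := d.ft l hl h7 hPl x hx h17
  have h30 := large_l h7 hmin hft.1
  refine ⟨l, ?_, hmin, hft, d.fl l hl h7 hPl x hx h17⟩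
  rcases prime_cases hl with h | h | h | h | h | h | h | h | h | h
  iterate 9 omega
  have h29 : l = 29 := by
    have : l ≠ 30 := by rintro rfl; revert hl; norm_num
    omega
  subst h29
  simp only [OfNat.ofNat_eq_ofNat, Nat.reduceEqDiff, true_and, false_or]
  intro h5
  have h1 := hft.1 [5, 7, 11, 13, 17, 19, 23] (by simp) (by
      simp only [List.mem_cons, List.not_mem_nil, or_false]
      rintro x (rfl | rfl | rfl | rfl | rfl | rfl | rfl)
      · exact ⟨h5, le_rfl⟩
      all_goals exact ⟨hmin _ (by norm_num) (by norm_num) (by norm_num), by norm_num⟩)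
  norm_num at h1

lemma list_le {A B : List ℕ} (h : List.Forall₂ (· ≤ ·) A B) : A.prod ≤ B.prod := by
  induction h with
  | nil => simp
  | cons h _ ih => simp only [List.prod_cons]; exact Nat.mul_le_mul h ih

lemma big {a b A B k l n : ℕ} (ha : a ≤ A) (hb : b ≤ B) (h : A ^ 2 * B ≤ k * l ^ 8) (hl : l ≤ n) :
    a ^ 2 * b ≤ k * n ^ 8 :=
  (Nat.mul_le_mul (Nat.pow_le_pow_left ha 2) hb).trans
    (h.trans (Nat.mul_le_mul_left k (Nat.pow_le_pow_left hl 8)))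

lemma big4 {a A l n : ℕ} (ha : a ≤ A) (h : A ≤ 16 * l ^ 4) (hl : l ≤ n) : a ≤ 16 * n ^ 4 :=
  ha.trans (h.trans (Nat.mul_le_mul_left 16 (Nat.pow_le_pow_left hl 4)))

end fifteenA

section sixteenA
variable {P Q : ℕ → Prop}

lemma ord_nat {y : ℕ → ℕ} (hy : ∀ k, (y k).Prime) {n : ℕ} (hm : ∀ k < n, y k < y (k + 1)) :
    (1 ≤ n → 3 ≤ y 1) ∧ (2 ≤ n → 5 ≤ y 2) ∧ (3 ≤ n → 7 ≤ y 3) ∧ (4 ≤ n → 11 ≤ y 4) ∧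
    (5 ≤ n → 13 ≤ y 5) ∧ (6 ≤ n → 17 ≤ y 6) ∧ (7 ≤ n → 19 ≤ y 7) ∧ (8 ≤ n → 23 ≤ y 8)
    ∧ (9 ≤ n → 29 ≤ y 9) := by
  have h0 := (hy 0).two_le
  have h1 : 1 ≤ n → 3 ≤ y 1 := fun h => by have := hm 0 (by omega); simp only [zero_add] at this; omega
  have h2 : 2 ≤ n → 5 ≤ y 2 := fun h => by
    have := hm 1 (by omega); have := prime_cases (hy 2); simp only [Nat.reduceAdd] at *; omega
  have h3 : 3 ≤ n → 7 ≤ y 3 := fun h => by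
    have := hm 2 (by omega); have := prime_cases (hy 3); simp only [Nat.reduceAdd] at *; omega
  have h4 : 4 ≤ n → 11 ≤ y 4 := fun h => by
    have := hm 3 (by omega); have := prime_cases (hy 4); simp only [Nat.reduceAdd] at *; omega
  have h5 : 5 ≤ n → 13 ≤ y 5 := fun h => by
    have := hm 4 (by omega); have := prime_cases (hy 5); simp only [Nat.reduceAdd] at *; omega
  have h6 : 6 ≤ n → 17 ≤ y 6 := fun h => by
    have := hm 5 (by omega); have := prime_cases (hy 6); simp only [Nat.reduceAdd] at *; omega
  have h7 : 7 ≤ n → 19 ≤ y 7 := fun h => by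
    have := hm 6 (by omega); have := prime_cases (hy 7); simp only [Nat.reduceAdd] at *; omega
  have h8 : 8 ≤ n → 23 ≤ y 8 := fun h => by
    have := hm 7 (by omega); have := prime_cases (hy 8); simp only [Nat.reduceAdd] at *; omega
  have h9 : 9 ≤ n → 29 ≤ y 9 := fun h => by
    have := hm 8 (by omega); have := prime_cases (hy 9); simp only [Nat.reduceAdd] at *; omega
  exact ⟨h1, h2, h3, h4, h5, h6, h7, h8, h9⟩

lemma mono_le {y : ℕ → ℕ} {n : ℕ} (hm : ∀ k < n, y k < y (k + 1)) {a : ℕ} (ha : a ≤ n) : y a ≤ y n := by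
  induction n, ha using Nat.le_induction with
  | base => exact le_rfl
  | succ n hn ih => exact (ih (fun k hk => hm k (by omega))).trans (hm n (by omega)).le

lemma pw {L : List ℕ} (h : L.IsChain (· < ·)) : L.Pairwise (· < ·) := List.isChain_iff_pairwise.mp h

set_option maxHeartbeats 4000000 in
lemma Dat.pside (d : Dat P Q) {y : ℕ → ℕ} {n : ℕ} (hy : ∀ k, P (y k)) (hm : ∀ k < n, y k < y (k + 1))
    (hcard : ∀ S : Finset ℕ, (∀ x ∈ S, P x ∧ x < y n) → S.card ≤ n) :
    y n ≤ [191, 661, 1601, 2069, 1831, 997, 449, 157, 47].getD n 0 := by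
  by_contra hcon
  obtain ⟨g1, g2, g3, g4, g5, g6, g7, g8, g9⟩ := ord_nat (fun k => d.pp _ (hy k)) hm
  have h17 : 17 ≤ y n := by
    by_cases h9 : 9 ≤ n
    · have := mono_le hm h9
      have := g9 h9
      omega
    · have : n ≤ 8 := by omega
      interval_cases n <;> simp at hcon <;> omega
  obtain ⟨l, hl, hall, hft, hle⟩ := d.core (Or.inl (hy n)) h17
  have h5 : 100 < y n → P 5 := by
    intro h
    by_contra h5
    have := d.f5 h5 _ (Or.inl (hy n)) h17
    omega
  have p7 := hall 7 (by norm_num) (by norm_num)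
  have p11 := hall 11 (by norm_num) (by norm_num)
  have p13 := hall 13 (by norm_num) (by norm_num)
  have p17 := hall 17 (by norm_num) (by norm_num)
  have p19 := hall 19 (by norm_num) (by norm_num)
  have hl29 : l ≤ 29 := by omega
  by_cases h8 : 8 ≤ n
  · have hyn : 29 ≤ y n := by
      by_cases h9 : 9 ≤ n
      · have := mono_le hm h9
        have := g9 h9
        omega
      · have : n = 8 := by omega
        subst this
        simp at hcon; omega
    have m8 : y 8 ≤ y n := mono_le hm h8
    have m3 := hm 2 (by omega)
    have m4 := hm 3 (by omega)
    have m5 := hm 4 (by omega)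
    have m6 := hm 5 (by omega)
    have m7 := hm 6 (by omega)
    have m8' := hm 7 (by omega)
    simp only [Nat.reduceAdd] at *
    have h1 := hft.1 [y 2, y 3, y 4, y 5, y 6, y 7, y n] (pw (by simp; omega)) (by
      simp only [List.mem_cons, List.not_mem_nil, or_false]
      rintro x (rfl | rfl | rfl | rfl | rfl | rfl | rfl) <;> exact ⟨hy _, by omega⟩)
    have h2 := list_le (A := [5, 7, 11, 13, 17, 19, 29]) (B := [y 2, y 3, y 4, y 5, y 6, y 7, y n])
      (by simp; omega)
    have := big4 h2 h1 hl29
    norm_num at this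
  · have hn : n ≤ 7 := by omega
    interval_cases n <;> simp at hcon
    · have := hcard {5} (by simp; exact ⟨h5 (by omega), by omega⟩)
      simp at this
    · have h13 : 13 ≤ l := by rcases hl with rfl | rfl | h <;> omega
      have := hcard {5, 7} (by
        simp only [Finset.mem_insert, Finset.mem_singleton, forall_eq_or_imp, forall_eq]
        exact ⟨⟨h5 (by omega), by omega⟩, p7 (by omega), by omega⟩)
      simp at this
    · have h13 : 23 ≤ l := by rcases hl with rfl | rfl | rfl | rfl | rfl | h <;> omega
      have := hcard {5, 7, 11} (by
        simp only [Finset.mem_insert, Finset.mem_singleton, forall_eq_or_imp, forall_eq]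
        exact ⟨⟨h5 (by omega), by omega⟩, ⟨p7 (by omega), by omega⟩, p11 (by omega), by omega⟩)
      simp at this
    · have h13 : 23 ≤ l := by rcases hl with rfl | rfl | rfl | rfl | rfl | h <;> omega
      have := hcard {5, 7, 11, 13} (by
        simp only [Finset.mem_insert, Finset.mem_singleton, forall_eq_or_imp, forall_eq]
        exact ⟨⟨h5 (by omega), by omega⟩, ⟨p7 (by omega), by omega⟩, ⟨p11 (by omega), by omega⟩,
          p13 (by omega), by omega⟩)
      simp at this
    · have h13 : 23 ≤ l := by rcases hl with rfl | rfl | rfl | rfl | rfl | h <;> omega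
      have := hcard {5, 7, 11, 13, 17} (by
        simp only [Finset.mem_insert, Finset.mem_singleton, forall_eq_or_imp, forall_eq]
        exact ⟨⟨h5 (by omega), by omega⟩, ⟨p7 (by omega), by omega⟩, ⟨p11 (by omega), by omega⟩,
          ⟨p13 (by omega), by omega⟩, p17 (by omega), by omega⟩)
      simp at this
    · have hP5 := h5 (by omega)
      have h13 : 17 ≤ l := by rcases hl with rfl | rfl | rfl | h <;> omega
      have hl23 : l ≤ 23 := by
        rcases hl with h | h | h | h | h | h | h
        iterate 6 omega
        exact absurd hP5 h.2
      have h1 := hft.1 [5, 7, 11, 13, y 5] (pw (by simp; omega)) (by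
        simp only [List.mem_cons, List.not_mem_nil, or_false]
        rintro x (rfl | rfl | rfl | rfl | rfl)
        · exact ⟨hP5, le_rfl⟩
        · exact ⟨p7 (by omega), by norm_num⟩
        · exact ⟨p11 (by omega), by norm_num⟩
        · exact ⟨p13 (by omega), by norm_num⟩
        · exact ⟨hy _, by omega⟩)
      have h2 := list_le (A := [5, 7, 11, 13, 998]) (B := [5, 7, 11, 13, y 5]) (by simp; omega)
      have := big4 h2 h1 hl23
      norm_num at this
    · have hP5 := h5 (by omega)
      have m3 := hm 2 (by omega)
      have m4 := hm 3 (by omega)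
      have m5 := hm 4 (by omega)
      have m6 := hm 5 (by omega)
      simp only [Nat.reduceAdd] at *
      by_cases hl17 : l ≤ 17
      · have h1 := hft.1 [y 2, y 3, y 4, y 5, y 6] (pw (by simp; omega)) (by
          simp only [List.mem_cons, List.not_mem_nil, or_false]
          rintro x (rfl | rfl | rfl | rfl | rfl) <;> exact ⟨hy _, by omega⟩)
        have h2 := list_le (A := [5, 7, 11, 13, 450]) (B := [y 2, y 3, y 4, y 5, y 6])
          (by simp; omega)
        have := big4 h2 h1 hl17
        norm_num at this
      · have h1 := hft.1 [5, 7, 11, 13, 17, y 6] (pw (by simp; omega)) (by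
          simp only [List.mem_cons, List.not_mem_nil, or_false]
          rintro x (rfl | rfl | rfl | rfl | rfl | rfl)
          · exact ⟨hP5, le_rfl⟩
          · exact ⟨p7 (by omega), by norm_num⟩
          · exact ⟨p11 (by omega), by norm_num⟩
          · exact ⟨p13 (by omega), by norm_num⟩
          · exact ⟨p17 (by omega), by norm_num⟩
          · exact ⟨hy _, by omega⟩)
        have h2 := list_le (A := [5, 7, 11, 13, 17, 450]) (B := [5, 7, 11, 13, 17, y 6])
          (by simp; omega)
        have := big4 h2 h1 hl29
        norm_num at this
    · have m3 := hm 2 (by omega)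
      have m4 := hm 3 (by omega)
      have m5 := hm 4 (by omega)
      have m6 := hm 5 (by omega)
      have m7 := hm 6 (by omega)
      simp only [Nat.reduceAdd] at *
      have h1 := hft.1 [y 2, y 3, y 4, y 5, y 6, y 7] (pw (by simp; omega)) (by
        simp only [List.mem_cons, List.not_mem_nil, or_false]
        rintro x (rfl | rfl | rfl | rfl | rfl | rfl) <;> exact ⟨hy _, by omega⟩)
      have h2 := list_le (A := [5, 7, 11, 13, 17, 158]) (B := [y 2, y 3, y 4, y 5, y 6, y 7])
        (by simp; omega)
      have := big4 h2 h1 hl29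
      norm_num at this

end sixteenA

section seventeenA
variable {P Q : ℕ → Prop}

lemma Dat.q3 (d : Dat P Q) {y l : ℕ} (hy : Q y) (hcon : 1597 < y) (h5 : P 5)
    (hl : 23 ≤ l) (hl29 : l ≤ 29) (hall : ∀ r, r.Prime → 7 ≤ r → r < l → P r) (hft : FT P Q l) :
    False := by
  have p7 := hall 7 (by norm_num) (by norm_num) (by omega)
  have p11 := hall 11 (by norm_num) (by norm_num) (by omega)
  have p13 := hall 13 (by norm_num) (by norm_num) (by omega)
  have p17 := hall 17 (by norm_num) (by norm_num) (by omega)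
  have p19 := hall 19 (by norm_num) (by norm_num) (by omega)
  have hb : 1598 ≤ [y].prod := by simp; omega
  rcases hft.2 with hA | ⟨hB, -⟩
  · have := hA [5, 7, 11, 13, 17, 19] [y] (pw (by simp)) (by simp) (by simp [*]) (by simp [*]; omega)
    have := big le_rfl hb this hl29
    norm_num at this
  · have := hB [5, 7, 11, 13, 17, 19] [y] (pw (by simp)) (by simp) (by simp [*]) (by simp [*]; omega)
    have := big le_rfl hb this hl29
    norm_num at this

lemma Dat.q4 (d : Dat P Q) {y : ℕ → ℕ} (hy : ∀ k, Q (y k)) (hm : ∀ k < 4, y k < y (k + 1))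
    {l : ℕ} (hcon : 653 < y 4) (h3 : P 3) (h5 : P 5)
    (hl : 13 ≤ l) (hl29 : l ≤ 29) (hall : ∀ r, r.Prime → 7 ≤ r → r < l → P r) (hft : FT P Q l) :
    False := by
  have p7 := hall 7 (by norm_num) (by norm_num) (by omega)
  have p11 := hall 11 (by norm_num) (by norm_num) (by omega)
  have p13 := hall 13 (by norm_num) (by norm_num)
  have p17 := hall 17 (by norm_num) (by norm_num)
  have hne : ∀ a, P a → ∀ k, y k ≠ a := fun a ha k h => d.pq a ha (h ▸ hy k)
  have h0 := (d.qp _ (hy 0)).two_le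
  have m1 := hm 0 (by omega)
  have m2 := hm 1 (by omega)
  have m3 := hm 2 (by omega)
  have m4 := hm 3 (by omega)
  simp only [Nat.reduceAdd, zero_add] at m1 m2 m3 m4
  have k1 : 13 ≤ y 1 := by
    have := prime_cases (d.qp _ (hy 1))
    have := hne 3 h3 1
    have := hne 5 h5 1
    have := hne 7 p7 1
    have := hne 11 p11 1
    omega
  have k2 : 17 ≤ y 2 := by
    have := prime_cases (d.qp _ (hy 2))
    omega
  have k3 : 19 ≤ y 3 := by
    have := prime_cases (d.qp _ (hy 3))
    omega
  have hM : [y 1, y 2, y 3, y 4].Pairwise (· < ·) := pw (by simp; omega)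
  have hMQ : ∀ x ∈ [y 1, y 2, y 3, y 4], Q x ∧ 5 ≤ x := by
    simp only [List.mem_cons, List.not_mem_nil, or_false]
    rintro x (rfl | rfl | rfl | rfl) <;> exact ⟨hy _, by omega⟩
  have h2 := list_le (A := [13, 17, 19, 654]) (B := [y 1, y 2, y 3, y 4]) (by simp; omega)
  rcases hft.2 with hA | ⟨hB, hC⟩
  · have := hA [3, 5, 7, 11] _ (pw (by simp)) hM (by simp [*]) (fun x hx => ⟨(hMQ x hx).1, by
      have := (hMQ x hx).2; omega⟩)
    have := big le_rfl h2 this hl29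
    norm_num at this
  · by_cases hl19 : l ≤ 19
    · have := big4 h2 (hC _ hM hMQ) hl19
      norm_num at this
    · have p13 := p13 (by omega)
      have p17 := p17 (by omega)
      have := hB [5, 7, 11, 13, 17] _ (pw (by simp)) hM (by simp [*]) hMQ
      have := big le_rfl h2 this hl29
      norm_num at this

lemma Dat.q5 (d : Dat P Q) {y : ℕ → ℕ} (hy : ∀ k, Q (y k)) (hm : ∀ k < 5, y k < y (k + 1))
    {l : ℕ} (hcon : 229 < y 5) (h3 : P 3) (h5 : P 5)
    (hl : 11 ≤ l) (hl23 : l ≤ 23) (hall : ∀ r, r.Prime → 7 ≤ r → r < l → P r) (hft : FT P Q l) :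
    False := by
  have p7 := hall 7 (by norm_num) (by norm_num) (by omega)
  have hne : ∀ a, P a → ∀ k, y k ≠ a := fun a ha k h => d.pq a ha (h ▸ hy k)
  have h0 := (d.qp _ (hy 0)).two_le
  have m1 := hm 0 (by omega)
  have m2 := hm 1 (by omega)
  have m3 := hm 2 (by omega)
  have m4 := hm 3 (by omega)
  have m5 := hm 4 (by omega)
  simp only [Nat.reduceAdd, zero_add] at m1 m2 m3 m4 m5
  have k1 : 11 ≤ y 1 := by
    have := prime_cases (d.qp _ (hy 1))
    have := hne 3 h3 1
    have := hne 5 h5 1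
    have := hne 7 p7 1
    omega
  have k2 : 13 ≤ y 2 := by
    have := prime_cases (d.qp _ (hy 2))
    omega
  have k3 : 17 ≤ y 3 := by
    have := prime_cases (d.qp _ (hy 3))
    omega
  have k4 : 19 ≤ y 4 := by
    have := prime_cases (d.qp _ (hy 4))
    omega
  have hM : [y 1, y 2, y 3, y 4, y 5].Pairwise (· < ·) := pw (by simp; omega)
  have hMQ : ∀ x ∈ [y 1, y 2, y 3, y 4, y 5], Q x ∧ 5 ≤ x := by
    simp only [List.mem_cons, List.not_mem_nil, or_false]
    rintro x (rfl | rfl | rfl | rfl | rfl) <;> exact ⟨hy _, by omega⟩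
  have h2 := list_le (A := [11, 13, 17, 19, 230]) (B := [y 1, y 2, y 3, y 4, y 5]) (by simp; omega)
  rcases hft.2 with hA | ⟨hB, hC⟩
  · have := hA [3, 5, 7] _ (pw (by simp)) hM (by simp [*]) (fun x hx => ⟨(hMQ x hx).1, by
      have := (hMQ x hx).2; omega⟩)
    have := big le_rfl h2 this hl23
    norm_num at this
  · have := big4 h2 (hC _ hM hMQ) hl23
    norm_num at this

lemma Dat.q6 (d : Dat P Q) {y : ℕ → ℕ} (hy : ∀ k, Q (y k)) (hm : ∀ k < 6, y k < y (k + 1))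
    {l : ℕ} (hcon : 67 < y 6) (h3 : P 3)
    (hl : l = 7 ∨ 11 ≤ l) (hl' : l ≤ 13 ∨ 17 ≤ l) (hl'' : l ≤ 23 ∨ l = 29)
    (hall : ∀ r, r.Prime → 7 ≤ r → r < l → P r) (hft : FT P Q l) :
    False := by
  have p7 := hall 7 (by norm_num) (by norm_num)
  have p11 := hall 11 (by norm_num) (by norm_num)
  have p13 := hall 13 (by norm_num) (by norm_num)
  have p17 := hall 17 (by norm_num) (by norm_num)
  have p19 := hall 19 (by norm_num) (by norm_num)
  have hne : ∀ a, P a → ∀ k, y k ≠ a := fun a ha k h => d.pq a ha (h ▸ hy k)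
  have h0 := (d.qp _ (hy 0)).two_le
  have m1 := hm 0 (by omega)
  have m2 := hm 1 (by omega)
  have m3 := hm 2 (by omega)
  have m4 := hm 3 (by omega)
  have m5 := hm 4 (by omega)
  have m6 := hm 5 (by omega)
  simp only [Nat.reduceAdd, zero_add] at m1 m2 m3 m4 m5 m6
  have k1 : 5 ≤ y 1 := by
    have := prime_cases (d.qp _ (hy 1))
    have := hne 3 h3 1
    omega
  have k2 : 7 ≤ y 2 := by
    have := prime_cases (d.qp _ (hy 2))
    omega
  have k3 : 11 ≤ y 3 := by
    have := prime_cases (d.qp _ (hy 3))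
    omega
  have k4 : 13 ≤ y 4 := by
    have := prime_cases (d.qp _ (hy 4))
    omega
  have k5 : 17 ≤ y 5 := by
    have := prime_cases (d.qp _ (hy 5))
    omega
  have hM : [y 1, y 2, y 3, y 4, y 5, y 6].Pairwise (· < ·) := pw (by simp; omega)
  have hMQ : ∀ x ∈ [y 1, y 2, y 3, y 4, y 5, y 6], Q x ∧ 5 ≤ x := by
    simp only [List.mem_cons, List.not_mem_nil, or_false]
    rintro x (rfl | rfl | rfl | rfl | rfl | rfl) <;> exact ⟨hy _, by omega⟩
  have hMQ' : ∀ x ∈ [y 1, y 2, y 3, y 4, y 5, y 6], Q x ∧ 3 ≤ x :=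
    fun x hx => ⟨(hMQ x hx).1, by have := (hMQ x hx).2; omega⟩
  have h2 := list_le (A := [5, 7, 11, 13, 17, 68]) (B := [y 1, y 2, y 3, y 4, y 5, y 6]) (by simp; omega)
  rcases hft.2 with hA | ⟨hB, hC⟩
  · rcases hl with hl | hl
    · have := hA [3] _ (pw (by simp)) hM (by simp [h3]) hMQ'
      have := big le_rfl h2 this hl.le
      norm_num at this
    · rcases hl' with hl' | hl'
      · have := hA [3, 7] _ (pw (by simp)) hM (by simp [h3, p7 (by omega)]) hMQ'
        have := big le_rfl h2 this hl'
        norm_num at this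
      · have := hA [3, 7, 11, 13] _ (pw (by simp)) hM
          (by simp [h3, p7 (by omega), p11 (by omega), p13 (by omega)]) hMQ'
        have := big le_rfl h2 this (show l ≤ 29 by omega)
        norm_num at this
  · rcases hl'' with hl23 | hl29
    · have := big4 h2 (hC _ hM hMQ) hl23
      norm_num at this
    · have := hB [7, 11, 13, 17, 19] _ (pw (by simp)) hM
        (by simp [p7 (by omega), p11 (by omega), p13 (by omega), p17 (by omega), p19 (by omega)]) hMQ
      have := big le_rfl h2 this hl29.le
      norm_num at this

lemma Dat.q7 (d : Dat P Q) {y : ℕ → ℕ} {n : ℕ} (hn : 7 ≤ n) (hy : ∀ k, Q (y k))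
    (hm : ∀ k < n, y k < y (k + 1))
    {l : ℕ} (hcon : 23 ≤ y n)
    (hl : l = 7 ∨ l = 11 ∨ l = 13 ∨ 17 ≤ l) (hl' : l ≤ 17 ∨ 19 ≤ l) (hl'' : l ≤ 29)
    (hall : ∀ r, r.Prime → 7 ≤ r → r < l → P r) (hft : FT P Q l) :
    False := by
  have p7 := hall 7 (by norm_num) (by norm_num)
  have p11 := hall 11 (by norm_num) (by norm_num)
  have p13 := hall 13 (by norm_num) (by norm_num)
  have p17 := hall 17 (by norm_num) (by norm_num)
  have m7 := mono_le hm hn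
  obtain ⟨k1, k2, k3, k4, k5, k6, -, -, -⟩ := ord_nat (fun k => d.qp _ (hy k)) hm
  have k1 := k1 (by omega)
  have k2 := k2 (by omega)
  have k3 := k3 (by omega)
  have k4 := k4 (by omega)
  have k5 := k5 (by omega)
  have k6 := k6 (by omega)
  have m2 := hm 1 (by omega)
  have m3 := hm 2 (by omega)
  have m4 := hm 3 (by omega)
  have m5 := hm 4 (by omega)
  have m6 := hm 5 (by omega)
  have m7' := hm 6 (by omega)
  simp only [Nat.reduceAdd] at m2 m3 m4 m5 m6 m7'
  have hM : [y 2, y 3, y 4, y 5, y 6, y n].Pairwise (· < ·) := pw (by simp; omega)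
  have hM' : [y 1, y 2, y 3, y 4, y 5, y 6, y n].Pairwise (· < ·) := pw (by simp; omega)
  have hMQ : ∀ x ∈ [y 2, y 3, y 4, y 5, y 6, y n], Q x ∧ 5 ≤ x := by
    simp only [List.mem_cons, List.not_mem_nil, or_false]
    rintro x (rfl | rfl | rfl | rfl | rfl | rfl) <;> exact ⟨hy _, by omega⟩
  have hMQ' : ∀ x ∈ [y 1, y 2, y 3, y 4, y 5, y 6, y n], Q x ∧ 3 ≤ x := by
    simp only [List.mem_cons, List.not_mem_nil, or_false]
    rintro x (rfl | rfl | rfl | rfl | rfl | rfl | rfl) <;> exact ⟨hy _, by omega⟩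
  have h2 := list_le (A := [5, 7, 11, 13, 17, 23]) (B := [y 2, y 3, y 4, y 5, y 6, y n]) (by simp; omega)
  have h2' := list_le (A := [3, 5, 7, 11, 13, 17, 23]) (B := [y 1, y 2, y 3, y 4, y 5, y 6, y n])
    (by simp; omega)
  rcases hft.2 with hA | ⟨hB, hC⟩
  · rcases hl with hl | hl | hl | hl
    · have := hA [] _ (pw (by simp)) hM' (by simp) hMQ'
      have := big le_rfl h2' this hl.le
      norm_num at this
    · have := hA [7] _ (pw (by simp)) hM' (by simp [p7 (by omega)]) hMQ'
      have := big le_rfl h2' this hl.le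
      norm_num at this
    · have := hA [7, 11] _ (pw (by simp)) hM' (by simp [p7 (by omega), p11 (by omega)]) hMQ'
      have := big le_rfl h2' this hl.le
      norm_num at this
    · have := hA [7, 11, 13] _ (pw (by simp)) hM'
          (by simp [p7 (by omega), p11 (by omega), p13 (by omega)]) hMQ'
      have := big le_rfl h2' this hl''
      norm_num at this
  · rcases hl' with hl23 | hl29
    · have := big4 h2 (hC _ hM hMQ) hl23
      norm_num at this
    · have := hB [7, 11, 13, 17] _ (pw (by simp)) hM
        (by simp [p7 (by omega), p11 (by omega), p13 (by omega), p17 (by omega)]) hMQ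
      have := big le_rfl h2 this hl''
      norm_num at this

set_option maxHeartbeats 1000000 in
lemma Dat.qside (d : Dat P Q) {y : ℕ → ℕ} {n : ℕ} (hy : ∀ k, Q (y k)) (hm : ∀ k < n, y k < y (k + 1)) :
    y n ≤ [11287, 6427, 3613, 1597, 653, 229, 67, 19].getD n 0 := by
  by_contra hcon
  obtain ⟨-, -, -, -, -, -, -, g8, -⟩ := ord_nat (fun k => d.qp _ (hy k)) hm
  have h20 : 20 ≤ y n := by
    by_cases h8 : 8 ≤ n
    · have := mono_le hm h8
      have := g8 h8
      omega
    · have : n ≤ 7 := by omega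
      interval_cases n <;> simp at hcon <;> omega
  obtain ⟨l, hl, hall, hft, hle⟩ := d.core (Or.inr (hy n)) (by omega)
  have h5 : 100 < y n → P 5 := by
    intro h
    by_contra h5
    have := d.f5 h5 _ (Or.inr (hy n)) (by omega)
    omega
  have h3 : 36 < y n → P 3 := by
    intro h
    by_contra h3
    have := d.f3 h3 _ (hy n) (by omega)
    omega
  have hl29 : l ≤ 29 := by omega
  by_cases h7 : 7 ≤ n
  · have h23 : 23 ≤ y n := by
      have := prime_cases (d.qp _ (hy n))
      omega
    exact d.q7 h7 hy hm h23 (by omega) (by omega) hl29 hall hft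
  · have hl29' := Nat.pow_le_pow_left hl29 2
    have hn : n ≤ 6 := by omega
    interval_cases n <;> simp at hcon
    · omega
    · omega
    · omega
    · exact d.q3 (hy _) hcon (h5 (by omega)) (by
        rcases hl with rfl | rfl | rfl | rfl | rfl | h <;> omega) hl29 hall hft
    · exact d.q4 hy hm hcon (h3 (by omega)) (h5 (by omega)) (by
        rcases hl with rfl | rfl | h <;> omega) hl29 hall hft
    · refine d.q5 hy hm hcon (h3 (by omega)) (h5 (by omega)) (by
        rcases hl with rfl | h <;> omega) ?_ hall hft
      rcases hl with h | h | h | h | h | h | h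
      iterate 6 omega
      exact absurd (h5 (by omega)) h.2
    · exact d.q6 hy hm hcon (h3 (by omega)) (by omega) (by omega) (by omega) hall hft

end seventeenA

lemma seq_of_fin {r : ℕ} {p : Fin r → ℕ} (hm : StrictMono p) (i : Fin r) :
    ∃ y : ℕ → ℕ, (∀ k, ∃ j, y k = p j) ∧ (∀ k < i.val, y k < y (k + 1)) ∧ y i.val = p i := by
  refine ⟨fun k => p ⟨min k i.val, lt_of_le_of_lt (min_le_right _ _) i.2⟩, fun k => ⟨_, rfl⟩, ?_, ?_⟩
  · intro k hk
    apply hm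
    rw [Fin.lt_def]
    show min k i.val < min (k + 1) i.val
    omega
  · show p ⟨min i.val i.val, _⟩ = p i
    congr 1
    apply Fin.ext
    simp

theorem ssf_totally_reflective_dim4_prime_bounds
    (G : Matrix (Fin 4) (Fin 4) ℤ) (hsymm : G.IsSymm) (hpos : PosDefM G)
    (hssf : StronglySquareFreeM G) (htr : TotallyReflectiveM G)
    (r s : ℕ) (p : Fin r → ℕ) (q : Fin s → ℕ)
    (hp : ∀ i, (p i).Prime) (hq : ∀ j, (q j).Prime)
    (hmonop : StrictMono p) (hmonoq : StrictMono q)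
    (hdisj : ∀ i j, p i ≠ q j)
    (hdet : G.det = (∏ i, (p i : ℤ) ^ 2) * ∏ j, (q j : ℤ)) :
    (∀ i : Fin r, p i ≤ [191, 661, 1601, 2069, 1831, 997, 449, 157, 47].getD (i : ℕ) 0) ∧
      (∀ j : Fin s, q j ≤ [11287, 6427, 3613, 1597, 653, 229, 67, 19].getD (j : ℕ) 0) := by
  have hdpos : 0 < G.det := by
    rw [hdet]
    have h1 : ∀ i, (0 : ℤ) < (p i : ℤ) := fun i => by exact_mod_cast (hp i).pos
    have h2 : ∀ j, (0 : ℤ) < (q j : ℤ) := fun j => by exact_mod_cast (hq j).pos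
    exact mul_pos (Finset.prod_pos fun i _ => pow_pos (h1 i) 2) (Finset.prod_pos fun j _ => h2 j)
  have c : Ctx G := by
    refine ⟨hsymm, hpos, hssf.1, htr, hdpos, ?_⟩
    intro x hx h
    have h1 := hssf.2 x hx
    have h2 : x ^ 3 ∣ G.det.natAbs := by
      have := Int.natAbs_dvd_natAbs.mpr h
      simpa [Int.natAbs_pow] using this
    have h3 := (hx.pow_dvd_iff_le_factorization (by simpa using hdpos.ne')).mp h2
    omega
  have d := c.dat
  have hPi : ∀ i, (p i).Prime ∧ ((p i : ℕ) : ℤ) ^ 2 ∣ G.det := by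
    intro i
    refine ⟨hp i, ?_⟩
    rw [hdet]
    exact (Finset.dvd_prod_of_mem (fun i => (p i : ℤ) ^ 2) (Finset.mem_univ i)).mul_right _
  have hQj : ∀ j, (q j).Prime ∧ ((q j : ℕ) : ℤ) ∣ G.det ∧ ¬ ((q j : ℕ) : ℤ) ^ 2 ∣ G.det := by
    intro j
    refine ⟨hq j, ?_, ?_⟩
    · rw [hdet]
      exact (Finset.dvd_prod_of_mem (fun j => (q j : ℤ)) (Finset.mem_univ j)).mul_left _
    · intro h
      have hqi := Nat.prime_iff_prime_int.mp (hq j)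
      have hcop : IsCoprime ((q j : ℤ) ^ 2) (∏ i, (p i : ℤ) ^ 2) := by
        apply IsCoprime.pow_left
        apply IsCoprime.prod_right
        intro i _
        apply IsCoprime.pow_right
        rw [Nat.isCoprime_iff_coprime]
        exact (Nat.coprime_primes (hq j) (hp i)).mpr (hdisj i j).symm
      rw [hdet] at h
      have h1 := hcop.dvd_of_dvd_mul_left h
      rw [← Finset.mul_prod_erase _ _ (Finset.mem_univ j), sq] at h1
      have h2 := (mul_dvd_mul_iff_left hqi.ne_zero).mp h1
      obtain ⟨k, hk, hk'⟩ := hqi.exists_mem_finset_dvd h2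
      have h3 := (Nat.prime_dvd_prime_iff_eq (hq j) (hq k)).mp (by exact_mod_cast hk')
      exact (Finset.ne_of_mem_erase hk) (hmonoq.injective h3.symm)
  have hsurj : ∀ x : ℕ, (x.Prime ∧ (x : ℤ) ^ 2 ∣ G.det) → ∃ i, p i = x := by
    rintro x ⟨hx, hx2⟩
    have hxi := Nat.prime_iff_prime_int.mp hx
    have h1 : (x : ℤ) ∣ G.det := (dvd_pow_self _ two_ne_zero).trans hx2
    rw [hdet] at h1
    rcases hxi.dvd_or_dvd h1 with h1 | h1
    · obtain ⟨i, -, hi⟩ := hxi.exists_mem_finset_dvd h1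
      have hi := hxi.dvd_of_dvd_pow hi
      exact ⟨i, ((Nat.prime_dvd_prime_iff_eq hx (hp i)).mp (by exact_mod_cast hi)).symm⟩
    · obtain ⟨j, -, hj⟩ := hxi.exists_mem_finset_dvd h1
      have h3 := (Nat.prime_dvd_prime_iff_eq hx (hq j)).mp (by exact_mod_cast hj)
      exact absurd (h3 ▸ hx2) (hQj j).2.2
  constructor
  · intro i
    obtain ⟨y, hy, hm, hyi⟩ := seq_of_fin hmonop i
    have key := d.pside (y := y) (n := i.val) (fun k => by
      obtain ⟨j, hj⟩ := hy k
      rw [hj]; exact hPi j) hm (by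
      intro S hS
      have hsub : S ⊆ (Finset.Iio i).image p := by
        intro x hx
        obtain ⟨k, rfl⟩ := hsurj x (hS x hx).1
        have h2 := (hS _ hx).2
        rw [hyi] at h2
        exact Finset.mem_image_of_mem _ (Finset.mem_Iio.mpr (hmonop.lt_iff_lt.mp h2))
      have h1 := (Finset.card_le_card hsub).trans Finset.card_image_le
      simpa using h1)
    rw [hyi] at key
    exact key
  · intro j
    obtain ⟨y, hy, hm, hyi⟩ := seq_of_fin hmonoq j
    have key := d.qside (y := y) (n := j.val) (fun k => by
      obtain ⟨j, hj⟩ := hy k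
      rw [hj]; exact hQj j) hm
    rw [hyi] at key
    exact key
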